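/- Lemma 5.3 (Exponential tightness). Under the setup and Assumption 4.1 (with a_n := π(E_{[ψ^←(n)]}) γ(n) ψ^←(n)/c_n and b_n := π(E_{[ψ^←(n)]}) ψ^←(n)/c_n², where c_n = 1 in the LDP case and c_n → ∞ with b_n → ∞ in the MDP case), the family (μ̃_n) of laws of the polygonal processes Ỹ_n is exponentially tight in 𝓓_S: for every p > 0 there exists a compact set K_p ⊂ 𝓓_S such that lim_{p→∞} limsup_{n→∞} b_n^{−1} log μ̃_n(K_p^c) = −∞. Moreover, for every ε > 0, lim_{u→0} limsup_{n→∞} b_n^{−1} log P[ w(Ỹ_n, u) > ε ] = −∞, where w(h,u) := sup_{s,t∈[0,1], |s−t|<u} |h(s) − h(t)| is the modulus of continuity. -/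

import Mathlib

open MeasureTheory ProbabilityTheory Filter Set Topology
open scoped ENNReal BoundedContinuousFunction

noncomputable section

/-- The truncation `⟦z⟧ = z/(|z| ∨ 1)`. -/
def trunc (z : ℝ) : ℝ := z / max |z| 1

/-- The cumulant `g(λ) = ∫ (e^{λ z} - 1 - λ ⟦z⟧) ρ(dz)` of a Lévy measure `ρ`. -/
def cumulant (ρ : Measure ℝ) (l : ℝ) : ℝ := ∫ z, (Real.exp (l * z) - 1 - l * trunc z) ∂ρ

/-- `ḡ(t) = min { |s| : g(s) = t }`. -/
def gbar (ρ : Measure ℝ) (t : ℝ) : ℝ := sInf {y : ℝ | ∃ s : ℝ, |s| = y ∧ cumulant ρ s = t}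

/-- The integrability functional `Φ_M` for local characteristics `(0, ρ, 0)`. -/
def PhiM (ρ : Measure ℝ) (x : ℝ) : ℝ≥0∞ :=
  (∫⁻ y, ENNReal.ofReal (trunc (x * y) ^ 2) ∂ρ) +
    ENNReal.ofReal |∫ y, (trunc (x * y) - x * trunc y) ∂ρ|

/-- Probability that the next `k` steps of a Markov chain with kernel `κ` started at `x`
lie in `A 0, …, A (k-1)` respectively. -/
def stepProb {E : Type*} [MeasurableSpace E] (κ : Kernel E E) :
    (ℕ → Set E) → ℕ → E → ℝ≥0∞
  | _, 0, _ => 1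
  | A, k + 1, x => ∫⁻ y in A 0, stepProb κ (fun i => A (i + 1)) k y ∂(κ x)

/-- First hitting time (after time `0`) of the set `a`, `⊤` if the set is never hit. -/
def hitT {E : Type*} (a : Set E) (ω : ℕ → E) : ℕ∞ :=
  ⨅ (n : ℕ) (_ : 0 < n ∧ ω n ∈ a), (n : ℕ∞)

/-- The real value of the hitting time (junk value `0` if infinite). -/
def hitTr {E : Type*} (a : Set E) (ω : ℕ → E) : ℝ := (hitT a ω).toNat

/-- The law of the Markov chain with initial distribution `π(· ∩ E_n)/π(E_n)`. -/
def Ppart {E : Type*} [MeasurableSpace E] (π : Measure E) (Epart : ℕ → Set E)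
    (Pm : E → Measure (ℕ → E)) (n : ℕ) : Measure (ℕ → E) :=
  Measure.bind ((π (Epart n))⁻¹ • π.restrict (Epart n)) Pm

/-- Regular variation with index `idx` at infinity. -/
def RegVary (h : ℝ → ℝ) (idx : ℝ) : Prop :=
  ∀ x : ℝ, 0 < x → Tendsto (fun t : ℝ => h (t * x) / h t) atTop (nhds (x ^ idx))

/-- Generalized inverse `ψ^←(x) = inf{y ≥ 1 : ψ(y) ≥ x}`. -/
def geninv (ψf : ℝ → ℝ) (x : ℝ) : ℝ := sInf {y : ℝ | 1 ≤ y ∧ x ≤ ψf y}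

/-- Large deviation principle with speed `b` and rate function `I`. -/
def IsLDP {X : Type*} [TopologicalSpace X] [MeasurableSpace X]
    (μ : ℕ → Measure X) (b : ℕ → ℝ) (I : X → ℝ≥0∞) : Prop :=
  ∀ A : Set X, MeasurableSet A →
    (-((⨅ x ∈ interior A, I x : ℝ≥0∞) : EReal)
        ≤ liminf (fun n => (((b n)⁻¹ : ℝ) : EReal) * ENNReal.log (μ n A)) atTop) ∧
      limsup (fun n => (((b n)⁻¹ : ℝ) : EReal) * ENNReal.log (μ n A)) atTop
        ≤ -((⨅ x ∈ closure A, I x : ℝ≥0∞) : EReal)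

/-- Good rate function: lower semicontinuous (nonnegativity is built into `ℝ≥0∞`)
with compact level sets. -/
def IsGoodRate {X : Type*} [TopologicalSpace X] (I : X → ℝ≥0∞) : Prop :=
  LowerSemicontinuous I ∧ ∀ c : ℝ≥0∞, c ≠ ⊤ → IsCompact {x | I x ≤ c}

/-- The space of real-valued functions on `[0,1]`, with the topology of uniform
convergence (the sup-norm topology). -/
abbrev Dsp : Type := UniformFun (Set.Icc (0 : ℝ) 1) ℝ

instance : MeasurableSpace Dsp := borel Dsp

/-- `φ` is a density of the absolutely continuous function `ξ` vanishing at `0`. -/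
def ACDensity (ξ : Dsp) (φ : ℝ → ℝ) : Prop :=
  IntegrableOn φ (Set.Icc (0 : ℝ) 1) volume ∧
    ∀ t : Set.Icc (0 : ℝ) 1, UniformFun.toFun ξ t = ∫ s in (0 : ℝ)..(t : ℝ), φ s

/-- The inverse subordinator `U(t) = inf{x ≥ 0 : S_α(x) ≥ t}`, with `U(t) = 0` for `t < 0`. -/
def invSub {Ω' : Type*} (Sa : ℝ → Ω' → ℝ) (t : ℝ) (ω : Ω') : ℝ :=
  if t < 0 then 0 else sInf {x : ℝ | 0 ≤ x ∧ t ≤ Sa x ω}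

open scoped Classical in
/-- The Lebesgue–Stieltjes measure `U(dt)` of the (monotone) path `t ↦ U(t)(ω)`. -/
def Umeasure {Ω' : Type*} (Sa : ℝ → Ω' → ℝ) (ω : Ω') : Measure ℝ :=
  if h : Monotone fun t => invSub Sa t ω then h.stieltjesFunction.measure else 0

/-- The limiting cumulant functional
`Λ(ψ) = ∫_0^∞ r^ζ E[ 1{r^β V ≤ 1} g̃( c_f ∫_0^{1 - r^β V} ψ(t) U(dt) ) ] dr`. -/
def LamFun (gt : ℝ → ℝ) (ζ β cf : ℝ) {Ω' : Type*} [MeasurableSpace Ω'] (P' : Measure Ω')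
    (Sa : ℝ → Ω' → ℝ) (V : Ω' → ℝ) (ψ : ℝ → ℝ) : ℝ :=
  ∫ r in Set.Ioi (0 : ℝ), r ^ ζ *
    ∫ ω, Set.indicator {ω' : Ω' | r ^ β * V ω' ≤ 1}
      (fun ω' => gt (cf * ∫ t in Set.Ioc (0 : ℝ) (1 - r ^ β * V ω'), ψ t ∂(Umeasure Sa ω')))
      ω ∂P'

/-- The rate function on densities,
`Λ*(φ) = sup_{ψ ∈ L^∞[0,1]} { ∫_0^1 ψ φ - Λ(ψ) }`. -/
def LamStar (gt : ℝ → ℝ) (ζ β cf : ℝ) {Ω' : Type*} [MeasurableSpace Ω'] (P' : Measure Ω')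
    (Sa : ℝ → Ω' → ℝ) (V : Ω' → ℝ) (φ : ℝ → ℝ) : ℝ≥0∞ :=
  ⨆ (ψ : ℝ → ℝ) (_ : Measurable ψ ∧ ∃ C : ℝ, ∀ t, |ψ t| ≤ C),
    ENNReal.ofReal ((∫ t in Set.Icc (0 : ℝ) 1, ψ t * φ t) - LamFun gt ζ β cf P' Sa V ψ)

/-- The path-space rate function: `Λ*(ξ')` for absolutely continuous `ξ` with `ξ(0) = 0`,
and `∞` otherwise. -/
def rateH (gt : ℝ → ℝ) (ζ β cf : ℝ) {Ω' : Type*} [MeasurableSpace Ω'] (P' : Measure Ω')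
    (Sa : ℝ → Ω' → ℝ) (V : Ω' → ℝ) (ξ : Dsp) : ℝ≥0∞ :=
  ⨅ (φ : ℝ → ℝ) (_ : ACDensity ξ φ), LamStar gt ζ β cf P' Sa V φ

/-- The normalized partial sum (step) process `Y_n`, as an element of `Dsp`. -/
def Yproc {Ω : Type*} (X : ℤ → Ω → ℝ) (aseq : ℕ → ℝ) (n : ℕ) (ω : Ω) : Dsp :=
  UniformFun.ofFun fun t => (aseq n)⁻¹ * ∑ i ∈ Finset.Icc 1 ⌊(n : ℝ) * (t : ℝ)⌋₊, X (i : ℤ) ω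

/-- The polygonal (piecewise linear interpolation) process `Ỹ_n`. -/
def Ytil {Ω : Type*} (X : ℤ → Ω → ℝ) (aseq : ℕ → ℝ) (n : ℕ) (ω : Ω) : Dsp :=
  UniformFun.ofFun fun t => (aseq n)⁻¹ *
    ((∑ i ∈ Finset.Icc 1 ⌊(n : ℝ) * (t : ℝ)⌋₊, X (i : ℤ) ω) +
      ((n : ℝ) * (t : ℝ) - ⌊(n : ℝ) * (t : ℝ)⌋₊) * X ((⌊(n : ℝ) * (t : ℝ)⌋₊ : ℤ) + 1) ω)

/-! ### Markov chains on path space -/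

/-- The laws `Pm x` are those of the Markov chain with kernel `κ` started at `x`. -/
structure IsChainLaw {E : Type*} [MeasurableSpace E] (κ : Kernel E E)
    (Pm : E → Measure (ℕ → E)) : Prop where
  prob : ∀ x, IsProbabilityMeasure (Pm x)
  start : ∀ x, Pm x {ω | ω 0 = x} = 1
  markov : ∀ (x : E) (k : ℕ) (A : ℕ → Set E), (∀ i, MeasurableSet (A i)) →
      Pm x {ω | ∀ i < k, ω (i + 1) ∈ A i} = stepProb κ A k x

/-- The shift on one-sided paths. -/
def pathShift {E : Type*} (ω : ℕ → E) : ℕ → E := fun i => ω (i + 1)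

/-- The cylinder sets determined by finitely many initial coordinates. -/
def pathCylinders (E : Type*) [MeasurableSpace E] : Set (Set (ℕ → E)) :=
  {S | ∃ (k : ℕ) (A : ℕ → Set E), (∀ i, MeasurableSet (A i)) ∧ S = {ω | ∀ i ≤ k, ω i ∈ A i}}

section Path

variable {E : Type*} [MeasurableSpace E]

lemma measurable_pathShift : Measurable (pathShift : (ℕ → E) → (ℕ → E)) :=
  measurable_pi_lambda _ fun i => measurable_pi_apply (i + 1)

lemma measurableSet_pathCylinder (k : ℕ) {A : ℕ → Set E} (hA : ∀ i, MeasurableSet (A i)) :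
    MeasurableSet {ω : ℕ → E | ∀ i ≤ k, ω i ∈ A i} := by
  have : {ω : ℕ → E | ∀ i ≤ k, ω i ∈ A i} = ⋂ i ∈ Finset.range (k + 1), (fun ω => ω i) ⁻¹' A i := by
    ext ω; simp
  rw [this]
  exact Finset.measurableSet_biInter _ fun i _ => measurable_pi_apply i (hA i)

lemma isPiSystem_pathCylinders : IsPiSystem (pathCylinders E) := by
  rintro _ ⟨k, A, hA, rfl⟩ _ ⟨l, B, hB, rfl⟩ -
  refine ⟨max k l, fun i => (if i ≤ k then A i else univ) ∩ (if i ≤ l then B i else univ),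
    fun i => ?_, ?_⟩
  · refine MeasurableSet.inter ?_ ?_ <;> split_ifs <;> simp [hA, hB]
  · ext ω
    constructor
    · rintro ⟨h1, h2⟩ i -
      refine ⟨?_, ?_⟩ <;> split_ifs with h
      exacts [h1 i h, mem_univ _, h2 i h, mem_univ _]
    · intro h
      refine ⟨fun i hi => ?_, fun i hi => ?_⟩
      · simpa [hi] using (h i (le_max_of_le_left hi)).1
      · simpa [hi] using (h i (le_max_of_le_right hi)).2

lemma generateFrom_pathCylinders :
    (inferInstance : MeasurableSpace (ℕ → E)) = MeasurableSpace.generateFrom (pathCylinders E) := by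
  apply le_antisymm
  · refine iSup_le fun i => ?_
    rintro _ ⟨B, hB, rfl⟩
    apply MeasurableSpace.measurableSet_generateFrom
    refine ⟨i, fun j => if j = i then B else univ, fun j => ?_, ?_⟩
    · dsimp only
      split_ifs
      exacts [hB, MeasurableSet.univ]
    · ext ω
      constructor
      · intro h j _
        dsimp only
        split_ifs with hj
        · subst hj; exact h
        · trivial
      · intro h; simpa using h i le_rfl
  · apply MeasurableSpace.generateFrom_le
    rintro _ ⟨k, A, hA, rfl⟩
    exact measurableSet_pathCylinder k hA

lemma measurable_stepProb (κ : Kernel E E) [IsMarkovKernel κ] (k : ℕ) :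
    ∀ A : ℕ → Set E, (∀ i, MeasurableSet (A i)) → Measurable fun x => stepProb κ A k x := by
  induction k with
  | zero => intro A _; simp only [stepProb]; exact measurable_const
  | succ k ih =>
    intro A hA
    simp only [stepProb]
    exact (ih _ fun i => hA (i + 1)).setLIntegral_kernel (hA 0)

variable {κ : Kernel E E} {Pm : E → Measure (ℕ → E)}

namespace IsChainLaw

lemma ae_start_mem (h : IsChainLaw κ Pm) (x : E) {B : Set E} (hB : MeasurableSet B) (hx : x ∈ B) :
    ∀ᵐ ω ∂(Pm x), ω 0 ∈ B := by
  have := h.prob x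
  have hm : MeasurableSet {ω : ℕ → E | ω 0 ∈ B} := measurable_pi_apply 0 hB
  refine (prob_compl_eq_zero_iff hm).2 ?_
  refine le_antisymm prob_le_one ?_
  rw [← h.start x]
  refine measure_mono ?_
  rintro ω rfl
  exact hx

lemma cylinder (h : IsChainLaw κ Pm) (x : E) (k : ℕ) {A : ℕ → Set E} (hA : ∀ i, MeasurableSet (A i)) :
    Pm x {ω | ∀ i ≤ k, ω i ∈ A i} = (A 0).indicator (stepProb κ (fun i => A (i + 1)) k) x := by
  by_cases hx : x ∈ A 0
  · rw [indicator_of_mem hx, ← h.markov x k _ fun i => hA (i + 1)]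
    refine measure_congr ?_
    filter_upwards [h.ae_start_mem x (hA 0) hx] with ω hω
    refine propext ⟨fun H i hi => H (i + 1) hi, fun H i hi => ?_⟩
    cases i with
    | zero => exact hω
    | succ i => exact H i hi
  · rw [indicator_of_notMem hx]
    refine measure_mono_null ?_ (h.ae_start_mem x (hA 0).compl hx)
    intro ω hω hω'
    exact hω' (hω 0 (Nat.zero_le _))

lemma measurable_law (h : IsChainLaw κ Pm) [IsMarkovKernel κ] : Measurable Pm := by
  have := h.prob
  refine Measurable.measure_of_isPiSystem_of_isProbabilityMeasure generateFrom_pathCylinders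
    isPiSystem_pathCylinders ?_
  rintro _ ⟨k, A, hA, rfl⟩
  simp_rw [h.cylinder _ k hA]
  exact (measurable_stepProb κ k _ fun i => hA (i + 1)).indicator (hA 0)

/-- The Markov property at time one. -/
lemma map_pathShift (h : IsChainLaw κ Pm) [IsMarkovKernel κ] (x : E) :
    (Pm x).map pathShift = Measure.bind (κ x) Pm := by
  have := h.prob
  have hm := h.measurable_law
  have : IsProbabilityMeasure ((Pm x).map pathShift) :=
    Measure.isProbabilityMeasure_map measurable_pathShift.aemeasurable
  refine ext_of_generate_finite _ generateFrom_pathCylinders isPiSystem_pathCylinders ?_ ?_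
  · rintro _ ⟨k, A, hA, rfl⟩
    have hS := measurableSet_pathCylinder k hA
    rw [Measure.map_apply measurable_pathShift hS, Measure.bind_apply hS hm.aemeasurable]
    simp_rw [h.cylinder _ k hA]
    rw [lintegral_indicator (hA 0)]
    have := h.markov x (k + 1) A hA
    simp only [stepProb] at this
    rw [← this]
    congr 1
    ext ω
    simp [pathShift]
  · rw [measure_univ, Measure.bind_apply MeasurableSet.univ hm.aemeasurable]
    simp

lemma lintegral_shift (h : IsChainLaw κ Pm) [IsMarkovKernel κ] (x : E) {F : (ℕ → E) → ℝ≥0∞} (hF : Measurable F) :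
    ∫⁻ ω, F (pathShift ω) ∂(Pm x) = ∫⁻ y, ∫⁻ ω, F ω ∂(Pm y) ∂(κ x) := by
  rw [← lintegral_map hF measurable_pathShift, h.map_pathShift,
    Measure.lintegral_bind h.measurable_law.aemeasurable hF.aemeasurable]

lemma lintegral_start_mul (h : IsChainLaw κ Pm) (x : E) {u : E → ℝ≥0∞} (hu : Measurable u)
    {F : (ℕ → E) → ℝ≥0∞} (hF : Measurable F) :
    ∫⁻ ω, u (ω 0) * F ω ∂(Pm x) = u x * ∫⁻ ω, F ω ∂(Pm x) := by
  rw [← lintegral_const_mul _ hF]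
  refine lintegral_congr_ae ?_
  filter_upwards [h.ae_start_mem x (hu (measurableSet_singleton (u x))) rfl] with ω hω
  rw [mem_preimage, mem_singleton_iff] at hω
  rw [hω]

lemma lintegral_shift_mul (h : IsChainLaw κ Pm) [IsMarkovKernel κ] (x : E) {u : E → ℝ≥0∞} (hu : Measurable u)
    {F : (ℕ → E) → ℝ≥0∞} (hF : Measurable F) :
    ∫⁻ ω, u (ω 1) * F (pathShift ω) ∂(Pm x) = ∫⁻ y, u y * ∫⁻ ω, F ω ∂(Pm y) ∂(κ x) := by
  have := h.lintegral_shift x (F := fun ω => u (ω 0) * F ω)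
    ((hu.comp (measurable_pi_apply 0)).mul hF)
  simp_rw [h.lintegral_start_mul _ hu hF] at this
  exact this

/-- Windows of the two-sided stationary measure are distributed as the chain started from
the invariant measure. -/
lemma map_window (h : IsChainLaw κ Pm) [IsMarkovKernel κ] {π : Measure E} {m : Measure (ℤ → E)}
    (hm : ∀ (n : ℤ) (k : ℕ) (A : ℕ → Set E), (∀ i, MeasurableSet (A i)) →
      m {s | ∀ i ≤ k, s (n + (i : ℤ)) ∈ A i}
        = ∫⁻ x in A 0, stepProb κ (fun i => A (i + 1)) k x ∂π)
    {Epart : ℕ → Set E} (hEmeas : ∀ n, MeasurableSet (Epart n))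
    (hEcover : (⋃ n, Epart n) = Set.univ) (hEfin : ∀ n, π (Epart n) ≠ ⊤) (n : ℤ) :
    m.map (fun s (i : ℕ) => s (n + (i : ℤ))) = Measure.bind π Pm := by
  have hmeas : Measurable fun (s : ℤ → E) (i : ℕ) => s (n + (i : ℤ)) :=
    measurable_pi_lambda _ fun i => measurable_pi_apply _
  have key : ∀ s ∈ pathCylinders E,
      m.map (fun s (i : ℕ) => s (n + (i : ℤ))) s = Measure.bind π Pm s := by
    rintro _ ⟨k, A, hA, rfl⟩
    have hS := measurableSet_pathCylinder k hA
    rw [Measure.map_apply hmeas hS, Measure.bind_apply hS h.measurable_law.aemeasurable]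
    simp_rw [h.cylinder _ k hA]
    rw [lintegral_indicator (hA 0), ← hm n k A hA]
    rfl
  have hB : ∀ i, {ω : ℕ → E | ∀ j ≤ 0, ω j ∈ Epart i} ∈ pathCylinders E :=
    fun i => ⟨0, fun _ => Epart i, fun _ => hEmeas i, rfl⟩
  refine Measure.ext_of_generateFrom_of_iUnion (pathCylinders E)
    (fun i => {ω : ℕ → E | ∀ j ≤ 0, ω j ∈ Epart i}) generateFrom_pathCylinders
    isPiSystem_pathCylinders ?_ hB ?_ key
  · refine eq_univ_of_forall fun ω => ?_
    have : ω 0 ∈ ⋃ n, Epart n := hEcover ▸ mem_univ _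
    obtain ⟨i, hi⟩ := mem_iUnion.1 this
    refine mem_iUnion.2 ⟨i, fun j hj => ?_⟩
    rw [Nat.le_zero.1 hj]; exact hi
  · intro i
    rw [key _ (hB i)]
    have hS := measurableSet_pathCylinder 0 (fun _ => hEmeas i)
    rw [Measure.bind_apply hS h.measurable_law.aemeasurable]
    simp_rw [h.cylinder _ 0 (fun _ => hEmeas i)]
    rw [lintegral_indicator (hEmeas i)]
    simp only [stepProb, lintegral_one, Measure.restrict_apply_univ]
    exact hEfin i

end IsChainLaw

end Path

/-! ### Excursions from the atom -/

/-- The sum `|f (ω 1)| + ⋯ + |f (ω n)|` along a path. -/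
def absSum {E : Type*} (f : E → ℝ) (n : ℕ) (ω : ℕ → E) : ℝ := ∑ i ∈ Finset.Icc 1 n, |f (ω i)|

/-- The sum of `|f|` along a path up to the first hitting time of `a`. -/
def cycleSum {E : Type*} (a : Set E) (f : E → ℝ) (ω : ℕ → E) : ℝ := absSum f (hitT a ω).toNat ω

section Excursion

variable {E : Type*}

lemma absSum_zero (f : E → ℝ) (ω : ℕ → E) : absSum f 0 ω = 0 := by simp [absSum]

lemma absSum_succ (f : E → ℝ) (n : ℕ) (ω : ℕ → E) :
    absSum f (n + 1) ω = |f (ω 1)| + absSum f n (pathShift ω) := by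
  induction n with
  | zero => simp [absSum]
  | succ n ih =>
    unfold absSum at ih ⊢
    rw [Finset.sum_Icc_succ_top (by omega), ih, Finset.sum_Icc_succ_top (by omega), add_assoc]
    rfl

lemma absSum_nonneg (f : E → ℝ) (n : ℕ) (ω : ℕ → E) : 0 ≤ absSum f n ω :=
  Finset.sum_nonneg fun _ _ => abs_nonneg _

lemma absSum_mono (f : E → ℝ) (ω : ℕ → E) : Monotone fun n => absSum f n ω := fun _ _ h =>
  Finset.sum_le_sum_of_subset_of_nonneg (Finset.Icc_subset_Icc_right h) fun _ _ _ => abs_nonneg _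

lemma cycleSum_nonneg (a : Set E) (f : E → ℝ) (ω : ℕ → E) : 0 ≤ cycleSum a f ω :=
  absSum_nonneg _ _ _

lemma lt_hitT_iff (a : Set E) (ω : ℕ → E) (n : ℕ) :
    (n : ℕ∞) < hitT a ω ↔ ∀ i : ℕ, 0 < i → i ≤ n → ω i ∉ a := by
  rw [← ENat.add_one_le_iff (ENat.natCast_ne_top n), hitT, le_iInf₂_iff]
  constructor
  · intro h i hi hin hia
    have := h i ⟨hi, hia⟩
    norm_cast at this
    omega
  · rintro h i ⟨hi, hia⟩
    norm_cast
    by_contra hlt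
    exact h i hi (by omega) hia

lemma hitT_of_mem {a : Set E} {ω : ℕ → E} (h : ω 1 ∈ a) : hitT a ω = 1 := by
  apply le_antisymm
  · exact iInf₂_le 1 ⟨one_pos, h⟩
  · refine le_iInf₂ fun i hi => ?_
    exact_mod_cast hi.1

lemma hitT_of_notMem {a : Set E} {ω : ℕ → E} (h : ω 1 ∉ a) :
    hitT a ω = hitT a (pathShift ω) + 1 := by
  apply le_antisymm
  · by_cases htop : hitT a (pathShift ω) = ⊤
    · simp [htop]
    · obtain ⟨k, hk⟩ := ENat.ne_top_iff_exists.1 htop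
      rw [← hk]
      by_contra hlt
      rw [not_le] at hlt
      have h1 := (lt_hitT_iff a ω (k + 1)).1 (by exact_mod_cast hlt)
      have h2 : (k : ℕ∞) < hitT a (pathShift ω) :=
        (lt_hitT_iff a _ k).2 fun i hi hik => h1 (i + 1) (by omega) (by omega)
      rw [← hk] at h2
      exact lt_irrefl _ h2
  · refine le_iInf₂ fun i hi => ?_
    obtain ⟨j, rfl⟩ : ∃ j, i = j + 1 := ⟨i - 1, by omega⟩
    have hj : 0 < j := by
      rcases Nat.eq_zero_or_pos j with rfl | hj
      · exact absurd hi.2 h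
      · exact hj
    push_cast
    gcongr
    exact iInf₂_le j ⟨hj, hi.2⟩

lemma one_le_hitT (a : Set E) (ω : ℕ → E) : 1 ≤ hitT a ω :=
  le_iInf₂ fun i hi => by exact_mod_cast hi.1

lemma cycleSum_of_mem {a : Set E} (f : E → ℝ) {ω : ℕ → E} (h : ω 1 ∈ a) :
    cycleSum a f ω = |f (ω 1)| := by
  simp [cycleSum, hitT_of_mem h, absSum]

lemma cycleSum_of_notMem {a : Set E} (f : E → ℝ) {ω : ℕ → E} (h : ω 1 ∉ a)
    (htop : hitT a (pathShift ω) ≠ ⊤) :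
    cycleSum a f ω = |f (ω 1)| + cycleSum a f (pathShift ω) := by
  have : (hitT a ω).toNat = (hitT a (pathShift ω)).toNat + 1 := by
    rw [hitT_of_notMem h, ENat.toNat_add htop (by simp)]; rfl
  rw [cycleSum, this, absSum_succ, cycleSum]

variable [MeasurableSpace E]

lemma measurable_absSum {f : E → ℝ} (hf : Measurable f) (n : ℕ) :
    Measurable (absSum f n) := by
  unfold absSum
  exact Finset.measurable_sum _ fun i _ =>
    (continuous_abs.measurable.comp hf).comp (measurable_pi_apply i)

lemma measurableSet_lt_hitT {a : Set E} (ha : MeasurableSet a) (n : ℕ) :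
    MeasurableSet {ω : ℕ → E | (n : ℕ∞) < hitT a ω} := by
  simp_rw [lt_hitT_iff]
  have : {ω : ℕ → E | ∀ i : ℕ, 0 < i → i ≤ n → ω i ∉ a} =
      ⋂ (i : ℕ) (_ : 0 < i) (_ : i ≤ n), (fun ω => ω i) ⁻¹' aᶜ := by
    ext ω; simp
  rw [this]
  exact MeasurableSet.iInter fun i => MeasurableSet.iInter fun _ => MeasurableSet.iInter fun _ =>
    measurable_pi_apply i ha.compl

lemma measurable_hitT {a : Set E} (ha : MeasurableSet a) :
    Measurable (hitT a : (ℕ → E) → ℕ∞) := by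
  refine measurable_to_countable' fun k => ?_
  have htop : MeasurableSet {ω : ℕ → E | hitT a ω = ⊤} := by
    have : {ω : ℕ → E | hitT a ω = ⊤} = ⋂ n : ℕ, {ω | (n : ℕ∞) < hitT a ω} := by
      ext ω
      simp only [mem_iInter]
      exact ENat.eq_top_iff_forall_gt
    rw [this]
    exact MeasurableSet.iInter fun n => measurableSet_lt_hitT ha n
  induction k using ENat.recTopCoe with
  | top => exact htop
  | coe k =>
    cases k with
    | zero =>
      convert MeasurableSet.empty using 1
      ext ω
      have := one_le_hitT a ω
      simp only [mem_preimage, mem_singleton_iff, mem_empty_iff_false, iff_false]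
      intro h
      rw [h] at this
      simp at this
    | succ k =>
      convert (measurableSet_lt_hitT ha k).diff (measurableSet_lt_hitT ha (k + 1)) using 1
      ext ω
      change hitT a ω = ((k + 1 : ℕ) : ℕ∞) ↔ (k : ℕ∞) < hitT a ω ∧ ¬ (((k + 1 : ℕ) : ℕ∞) < hitT a ω)
      rw [← ENat.add_one_le_iff (ENat.natCast_ne_top k), not_lt]
      push_cast
      exact ⟨fun h => ⟨h.ge, h.le⟩, fun h => le_antisymm h.2 h.1⟩

lemma measurable_absSum_hitT {a : Set E} (ha : MeasurableSet a) {f : E → ℝ} (hf : Measurable f)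
    (φ : ℕ∞ → ℕ) : Measurable fun ω => absSum f (φ (hitT a ω)) ω := by
  have h1 : Measurable fun p : (ℕ → E) × ℕ∞ => absSum f (φ p.2) p.1 :=
    measurable_from_prod_countable_left fun k => measurable_absSum hf (φ k)
  exact h1.comp (measurable_id.prodMk (measurable_hitT ha))

lemma measurable_cycleSum {a : Set E} (ha : MeasurableSet a) {f : E → ℝ} (hf : Measurable f) :
    Measurable (cycleSum a f) := measurable_absSum_hitT ha hf ENat.toNat

lemma measurable_hitT_toNat {a : Set E} (ha : MeasurableSet a) :
    Measurable fun ω : ℕ → E => ((hitT a ω).toNat : ℝ) :=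
  (measurable_from_top (f := fun k : ℕ∞ => (k.toNat : ℝ))).comp (measurable_hitT ha)

end Excursion

section Renewal

variable {E : Type*}

open scoped Classical in
/-- The exponential functional `exp(μ S_j - τ j)` of a path stopped at the first hitting time of
`a`, with the discount replaced by `exp(-τ n)` if the path does not hit `a` up to time `j`. -/
def renewalFun (a : Set E) (f : E → ℝ) (μ τ : ℝ) (n : ℕ) : ℕ → (ℕ → E) → ℝ≥0∞
  | 0, _ => ENNReal.ofReal (Real.exp (-(τ * n)))
  | j + 1, ω => ENNReal.ofReal (Real.exp (μ * |f (ω 1)| - τ)) *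
      (if ω 1 ∈ a then 1 else renewalFun a f μ τ n j (pathShift ω))

open scoped Classical in
/-- The value of `Φ` at the part of `|f (ω 1)| + ⋯ + |f (ω n)|` that comes after the first hitting
time of `a`, if this time is at most `n`, and `0` otherwise. -/
def postHit (a : Set E) (f : E → ℝ) (Φ : ℝ → ℝ≥0∞) : ℕ → (ℕ → E) → ℝ≥0∞
  | 0, _ => 0
  | n + 1, ω => if ω 1 ∈ a then Φ (absSum f n (pathShift ω)) else postHit a f Φ n (pathShift ω)

open scoped Classical in
lemma renewalFun_succ_eq (a : Set E) (f : E → ℝ) (μ τ : ℝ) (n j : ℕ) (ω : ℕ → E) :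
    renewalFun a f μ τ n (j + 1) ω =
      a.indicator (fun y => ENNReal.ofReal (Real.exp (μ * |f y| - τ))) (ω 1) +
        aᶜ.indicator (fun y => ENNReal.ofReal (Real.exp (μ * |f y| - τ))) (ω 1) *
          renewalFun a f μ τ n j (pathShift ω) := by
  rw [renewalFun]
  by_cases h : ω 1 ∈ a <;> simp [h]

lemma postHit_succ_eq (a : Set E) (f : E → ℝ) (Φ : ℝ → ℝ≥0∞) (n : ℕ) (ω : ℕ → E) :
    postHit a f Φ (n + 1) ω = a.indicator 1 (ω 1) * Φ (absSum f n (pathShift ω)) +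
        aᶜ.indicator 1 (ω 1) * postHit a f Φ n (pathShift ω) := by
  rw [postHit]
  by_cases h : ω 1 ∈ a <;> simp [h]

lemma renewalFun_le {a : Set E} (f : E → ℝ) {μ τ : ℝ} (hμ : 0 ≤ μ) (hτ : 0 ≤ τ) (n : ℕ) (j : ℕ) :
    ∀ ω, hitT a ω ≠ ⊤ → renewalFun a f μ τ n j ω ≤
      ENNReal.ofReal (Real.exp (μ * cycleSum a f ω - τ * min ((hitT a ω).toNat : ℝ) n)) := by
  induction j with
  | zero =>
    intro ω _
    rw [renewalFun]
    gcongr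
    have h1 := mul_nonneg hμ (cycleSum_nonneg a f ω)
    have h2 : τ * min ((hitT a ω).toNat : ℝ) n ≤ τ * n := by gcongr; exact min_le_right _ _
    linarith
  | succ j ih =>
    intro ω hω
    rw [renewalFun]
    split_ifs with h
    · rw [mul_one, cycleSum_of_mem f h, hitT_of_mem h]
      gcongr
      have : min (((1 : ℕ∞).toNat : ℕ) : ℝ) n ≤ 1 := by simp
      nlinarith
    · have htop : hitT a (pathShift ω) ≠ ⊤ := by
        intro h'
        rw [hitT_of_notMem h, h'] at hω
        exact hω rfl
      refine (mul_le_mul_right (ih _ htop) _).trans ?_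
      rw [← ENNReal.ofReal_mul (Real.exp_nonneg _), ← Real.exp_add]
      gcongr
      rw [cycleSum_of_notMem f h htop, hitT_of_notMem h, ENat.toNat_add htop (by simp)]
      have : min (((hitT a (pathShift ω)).toNat + (1 : ℕ∞).toNat : ℕ) : ℝ) n ≤
          min ((hitT a (pathShift ω)).toNat : ℝ) n + 1 := by
        rw [← min_add_add_right]
        refine min_le_min (by simp) (by linarith)
      nlinarith

open scoped Classical in
lemma postHit_eq (a : Set E) (f : E → ℝ) (Φ : ℝ → ℝ≥0∞) (n : ℕ) : ∀ ω,
    postHit a f Φ n ω =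
      if hitT a ω ≤ n then Φ (absSum f n ω - absSum f (hitT a ω).toNat ω) else 0 := by
  induction n with
  | zero =>
    intro ω
    rw [postHit, if_neg]
    intro h
    exact absurd ((one_le_hitT a ω).trans h) (by simp)
  | succ n ih =>
    intro ω
    rw [postHit]
    by_cases h : ω 1 ∈ a
    · have h1 : hitT a ω ≤ ((n + 1 : ℕ) : ℕ∞) := by
        rw [hitT_of_mem h]; exact_mod_cast Nat.le_add_left 1 n
      rw [if_pos h, if_pos h1, hitT_of_mem h, absSum_succ]
      simp [absSum]
    · rw [if_neg h, ih]
      have h1 : hitT a ω ≤ ((n + 1 : ℕ) : ℕ∞) ↔ hitT a (pathShift ω) ≤ n := by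
        rw [hitT_of_notMem h]
        push_cast
        exact ENat.add_le_add_iff_right (by simp)
      by_cases h2 : hitT a (pathShift ω) ≤ n
      · have htop : hitT a (pathShift ω) ≠ ⊤ := ne_top_of_le_ne_top (by simp) h2
        rw [if_pos h2, if_pos (h1.2 h2), hitT_of_notMem h, ENat.toNat_add htop (by simp)]
        change _ = Φ (_ - absSum f (_ + 1) ω)
        rw [absSum_succ, absSum_succ]
        congr 1
        ring
      · rw [if_neg h2, if_neg (h1.not.2 h2)]

variable [MeasurableSpace E] {κ : Kernel E E} {Pm : E → Measure (ℕ → E)}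

lemma measurable_expWeight {f : E → ℝ} (hf : Measurable f) (μ τ : ℝ) :
    Measurable fun y => ENNReal.ofReal (Real.exp (μ * |f y| - τ)) := by
  have : Measurable fun y => |f y| := continuous_abs.measurable.comp hf
  fun_prop

lemma measurable_renewalFun {a : Set E} (ha : MeasurableSet a) {f : E → ℝ} (hf : Measurable f)
    (μ τ : ℝ) (n j : ℕ) : Measurable (renewalFun a f μ τ n j) := by
  induction j with
  | zero =>
    have : renewalFun a f μ τ n 0 = fun _ => ENNReal.ofReal (Real.exp (-(τ * n))) := rfl
    rw [this]; exact measurable_const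
  | succ j ih =>
    have : renewalFun a f μ τ n (j + 1) = _ := funext fun ω => renewalFun_succ_eq a f μ τ n j ω
    rw [this]
    have hu := measurable_expWeight hf μ τ
    exact ((hu.indicator ha).comp (measurable_pi_apply 1)).add
      (((hu.indicator ha.compl).comp (measurable_pi_apply 1)).mul (ih.comp measurable_pathShift))

lemma measurable_postHit {a : Set E} (ha : MeasurableSet a) {f : E → ℝ} (hf : Measurable f)
    {Φ : ℝ → ℝ≥0∞} (hΦ : Measurable Φ) (n : ℕ) : Measurable (postHit a f Φ n) := by
  induction n with
  | zero =>
    have : postHit a f Φ 0 = fun _ => 0 := rfl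
    rw [this]; exact measurable_const
  | succ n ih =>
    have : postHit a f Φ (n + 1) = _ := funext fun ω => postHit_succ_eq a f Φ n ω
    rw [this]
    have h1 : Measurable (1 : E → ℝ≥0∞) := measurable_one
    exact (((h1.indicator ha).comp (measurable_pi_apply 1)).mul
      ((hΦ.comp (measurable_absSum hf n)).comp measurable_pathShift)).add
      (((h1.indicator ha.compl).comp (measurable_pi_apply 1)).mul (ih.comp measurable_pathShift))

namespace IsChainLaw

lemma lintegral_renewalFun_succ (h : IsChainLaw κ Pm) [IsMarkovKernel κ] {a : Set E}
    (ha : MeasurableSet a) {f : E → ℝ} (hf : Measurable f) (μ τ : ℝ) (n j : ℕ) (x : E) :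
    ∫⁻ ω, renewalFun a f μ τ n (j + 1) ω ∂(Pm x) =
      ∫⁻ y, (a.indicator (fun y => ENNReal.ofReal (Real.exp (μ * |f y| - τ))) y +
        aᶜ.indicator (fun y => ENNReal.ofReal (Real.exp (μ * |f y| - τ))) y *
          ∫⁻ ω, renewalFun a f μ τ n j ω ∂(Pm y)) ∂(κ x) := by
  have hu := measurable_expWeight hf μ τ
  have hR := measurable_renewalFun ha hf μ τ n j
  have hx : Measurable fun ω : ℕ → E =>
      a.indicator (fun y => ENNReal.ofReal (Real.exp (μ * |f y| - τ))) (ω 1) :=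
    (hu.indicator ha).comp (measurable_pi_apply 1)
  simp_rw [renewalFun_succ_eq]
  rw [lintegral_add_left hx,
    lintegral_add_left (hu.indicator ha), h.lintegral_shift_mul x (hu.indicator ha.compl) hR]
  congr 1
  have := h.lintegral_shift_mul x (hu.indicator ha) (F := fun _ => 1) measurable_const
  have hp := h.prob
  simpa using this

/-- Exponential moments of partial sums from a drift condition on one excursion. -/
lemma lintegral_exp_le_renewalFun (h : IsChainLaw κ Pm) [IsMarkovKernel κ] {a : Set E}
    (ha : MeasurableSet a) (hatom : ∀ x ∈ a, ∀ y ∈ a, κ x = κ y) {xa : E} (hxa : xa ∈ a)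
    {f : E → ℝ} (hf : Measurable f) {μ τ : ℝ} (n : ℕ)
    (hR : ∀ j, ∫⁻ ω, renewalFun a f μ τ n j ω ∂(Pm xa) ≤ 1) (j : ℕ) : ∀ x : E,
    ∫⁻ ω, ENNReal.ofReal (Real.exp (μ * absSum f j ω - τ * j)) ∂(Pm x) ≤
      ENNReal.ofReal (Real.exp (τ * n)) * ∫⁻ ω, renewalFun a f μ τ n j ω ∂(Pm x) := by
  have hp := h.prob
  induction j with
  | zero =>
    intro x
    simp only [absSum_zero, mul_zero, Nat.cast_zero, sub_zero, Real.exp_zero, ENNReal.ofReal_one,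
      lintegral_one, measure_univ, renewalFun, lintegral_const, mul_one]
    rw [← ENNReal.ofReal_mul (Real.exp_nonneg _), ← Real.exp_add]
    simp
  | succ j ih =>
    intro x
    have hS := measurable_absSum hf j
    have hu := measurable_expWeight hf μ τ
    have h1 : ∀ ω : ℕ → E, ENNReal.ofReal (Real.exp (μ * absSum f (j + 1) ω - τ * (j + 1 : ℕ))) =
        ENNReal.ofReal (Real.exp (μ * |f (ω 1)| - τ)) *
          ENNReal.ofReal (Real.exp (μ * absSum f j (pathShift ω) - τ * j)) := by
      intro ω
      rw [← ENNReal.ofReal_mul (Real.exp_nonneg _), ← Real.exp_add, absSum_succ]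
      congr 2
      push_cast
      ring
    simp_rw [h1]
    rw [h.lintegral_shift_mul x hu
      (F := fun ω => ENNReal.ofReal (Real.exp (μ * absSum f j ω - τ * j))) (by fun_prop),
      h.lintegral_renewalFun_succ ha hf, ← lintegral_const_mul' _ _ ENNReal.ofReal_ne_top]
    refine lintegral_mono fun y => ?_
    refine (mul_le_mul_right (ih y) _).trans ?_
    by_cases hy : y ∈ a
    · have : ∫⁻ ω, renewalFun a f μ τ n j ω ∂(Pm y) ≤ 1 := by
        refine le_trans (le_of_eq ?_) (hR j)
        cases j with
        | zero => simp [renewalFun]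
        | succ j =>
          rw [h.lintegral_renewalFun_succ ha hf, h.lintegral_renewalFun_succ ha hf,
            hatom y hy xa hxa]
      simp only [hy, indicator_of_mem, mem_compl_iff, not_true_eq_false, not_false_eq_true,
        indicator_of_notMem, zero_mul, add_zero]
      rw [mul_comm]
      gcongr
      exact mul_le_of_le_one_right' this
    · simp only [hy, indicator_of_mem, mem_compl_iff, not_false_eq_true,
        indicator_of_notMem, zero_add]
      rw [mul_left_comm]

lemma lintegral_exp_absSum_le (h : IsChainLaw κ Pm) [IsMarkovKernel κ] {a : Set E}
    (ha : MeasurableSet a) (hatom : ∀ x ∈ a, ∀ y ∈ a, κ x = κ y) {xa : E} (hxa : xa ∈ a)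
    (hfin : ∀ x, ∀ᵐ ω ∂(Pm x), hitT a ω ≠ ⊤)
    {f : E → ℝ} (hf : Measurable f) {μ τ : ℝ} (hμ : 0 ≤ μ) (hτ : 0 ≤ τ) (n : ℕ)
    (hR : ∫⁻ ω, ENNReal.ofReal (Real.exp (μ * cycleSum a f ω -
      τ * min ((hitT a ω).toNat : ℝ) n)) ∂(Pm xa) ≤ 1) (x : E) :
    ∫⁻ ω, ENNReal.ofReal (Real.exp (μ * absSum f n ω)) ∂(Pm x) ≤
      ENNReal.ofReal (Real.exp (2 * (τ * n))) *
        ∫⁻ ω, ENNReal.ofReal (Real.exp (μ * cycleSum a f ω)) ∂(Pm x) := by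
  have hle : ∀ y, ∀ᵐ ω ∂(Pm y), renewalFun a f μ τ n n ω ≤
      ENNReal.ofReal (Real.exp (μ * cycleSum a f ω - τ * min ((hitT a ω).toNat : ℝ) n)) :=
    fun y => (hfin y).mono fun ω hω => renewalFun_le f hμ hτ n n ω hω
  have key := h.lintegral_exp_le_renewalFun ha hatom hxa hf n (μ := μ)
    (fun j => (lintegral_mono_ae ((hfin xa).mono fun ω hω => renewalFun_le f hμ hτ n j ω hω)).trans
      hR) n x
  have h1 : ∀ ω : ℕ → E, ENNReal.ofReal (Real.exp (μ * absSum f n ω)) =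
      ENNReal.ofReal (Real.exp (τ * n)) *
        ENNReal.ofReal (Real.exp (μ * absSum f n ω - τ * n)) := by
    intro ω
    rw [← ENNReal.ofReal_mul (Real.exp_nonneg _), ← Real.exp_add]
    congr 2
    ring
  simp_rw [h1]
  rw [lintegral_const_mul' _ _ ENNReal.ofReal_ne_top, two_mul, Real.exp_add,
    ENNReal.ofReal_mul (Real.exp_nonneg _), mul_assoc]
  gcongr
  refine key.trans ?_
  gcongr 1
  refine lintegral_mono_ae ((hle x).mono fun ω hω => hω.trans ?_)
  gcongr
  have : 0 ≤ τ * min ((hitT a ω).toNat : ℝ) n := by positivity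
  linarith

lemma lintegral_postHit_le (h : IsChainLaw κ Pm) [IsMarkovKernel κ] {a : Set E}
    (ha : MeasurableSet a) {f : E → ℝ} (hf : Measurable f) {Φ : ℝ → ℝ≥0∞} (hΦ : Measurable Φ)
    {M : ℝ≥0∞} (n : ℕ) (hM : ∀ j ≤ n, ∀ y, ∫⁻ ω, Φ (absSum f j ω) ∂(Pm y) ≤ M) : ∀ x : E,
    ∫⁻ ω, postHit a f Φ n ω ∂(Pm x) ≤ M * ∫⁻ ω, postHit a f 1 n ω ∂(Pm x) := by
  have hp := h.prob
  induction n with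
  | zero => intro x; simp [postHit]
  | succ n ih =>
    intro x
    have h1 : Measurable (1 : E → ℝ≥0∞) := measurable_one
    have hs : ∀ Φ : ℝ → ℝ≥0∞, Measurable Φ → ∫⁻ ω, postHit a f Φ (n + 1) ω ∂(Pm x) =
        ∫⁻ y, (a.indicator 1 y * ∫⁻ ω, Φ (absSum f n ω) ∂(Pm y) +
          aᶜ.indicator 1 y * ∫⁻ ω, postHit a f Φ n ω ∂(Pm y)) ∂(κ x) := by
      intro Φ hΦ
      have hF1 : Measurable fun ω : ℕ → E => Φ (absSum f n ω) := hΦ.comp (measurable_absSum hf n)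
      have hF2 := measurable_postHit ha hf hΦ n
      have hm1 : Measurable fun y => ∫⁻ ω, Φ (absSum f n ω) ∂(Pm y) :=
        (Measure.measurable_lintegral hF1).comp h.measurable_law
      have hx : Measurable fun ω : ℕ → E =>
          a.indicator (1 : E → ℝ≥0∞) (ω 1) * Φ (absSum f n (pathShift ω)) :=
        ((h1.indicator ha).comp (measurable_pi_apply 1)).mul (hF1.comp measurable_pathShift)
      have hy : Measurable fun y =>
          a.indicator (1 : E → ℝ≥0∞) y * ∫⁻ ω, Φ (absSum f n ω) ∂(Pm y) :=
        (h1.indicator ha).mul hm1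
      simp_rw [postHit_succ_eq]
      rw [lintegral_add_left hx,
        lintegral_add_left hy,
        h.lintegral_shift_mul x (h1.indicator ha.compl) hF2,
        h.lintegral_shift_mul x (h1.indicator ha) hF1]
    rw [hs Φ hΦ, hs 1 measurable_one]
    have hm : Measurable fun y => a.indicator 1 y * ∫⁻ ω, (1 : ℝ → ℝ≥0∞) (absSum f n ω) ∂(Pm y) +
        aᶜ.indicator 1 y * ∫⁻ ω, postHit a f 1 n ω ∂(Pm y) := by
      have hF2 := measurable_postHit ha hf (measurable_one : Measurable (1 : ℝ → ℝ≥0∞)) n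
      refine ((h1.indicator ha).mul ((Measure.measurable_lintegral ?_).comp h.measurable_law)).add
        ((h1.indicator ha.compl).mul ((Measure.measurable_lintegral hF2).comp h.measurable_law))
      exact measurable_const
    rw [← lintegral_const_mul _ hm]
    refine lintegral_mono fun y => ?_
    simp only [Pi.one_apply, lintegral_one, measure_univ, mul_one]
    by_cases hy : y ∈ a
    · simpa [hy] using hM n (Nat.le_succ n) y
    · simpa [hy] using ih (fun j hj => hM j (hj.trans (Nat.le_succ n))) y

/-- Splitting a partial sum at the first hitting time of the atom. -/
lemma lintegral_absSum_split (h : IsChainLaw κ Pm) [IsMarkovKernel κ] {a : Set E}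
    (ha : MeasurableSet a) {f : E → ℝ} (hf : Measurable f) {Φ : ℝ → ℝ≥0∞} (hΦ : Measurable Φ)
    (hsub : ∀ s t : ℝ, 0 ≤ s → 0 ≤ t → Φ (s + t) ≤ Φ (2 * s) + Φ (2 * t))
    (hmono : ∀ s : ℝ, 0 ≤ s → Φ s ≤ Φ (2 * s))
    {M : ℝ≥0∞} (n : ℕ) (hM : ∀ j ≤ n, ∀ y, ∫⁻ ω, Φ (2 * absSum f j ω) ∂(Pm y) ≤ M) (x : E) :
    ∫⁻ ω, Φ (absSum f n ω) ∂(Pm x) ≤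
      ∫⁻ ω, Φ (2 * absSum f (hitT a ω ⊓ n).toNat ω) ∂(Pm x) + M * Pm x {ω | hitT a ω ≤ n} := by
  classical
  have hΦ2 : Measurable fun s : ℝ => Φ (2 * s) := hΦ.comp (measurable_const_mul 2)
  have hset : MeasurableSet {ω : ℕ → E | hitT a ω ≤ n} := by
    have : {ω : ℕ → E | hitT a ω ≤ n} = {ω | (n : ℕ∞) < hitT a ω}ᶜ := by ext ω; simp
    rw [this]; exact (measurableSet_lt_hitT ha n).compl
  have h2 := h.lintegral_postHit_le ha hf hΦ2 n hM x
  have h3 : ∫⁻ ω, postHit a f 1 n ω ∂(Pm x) = Pm x {ω | hitT a ω ≤ n} := by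
    rw [← lintegral_indicator_one hset]
    refine lintegral_congr fun ω => ?_
    rw [postHit_eq]
    by_cases hω : hitT a ω ≤ n <;> simp [hω]
  rw [h3] at h2
  refine le_trans ?_ (add_le_add_right h2 _)
  have hm : Measurable fun ω => Φ (2 * absSum f (hitT a ω ⊓ n).toNat ω) :=
    hΦ2.comp (measurable_absSum_hitT ha hf fun k => (k ⊓ n).toNat)
  rw [← lintegral_add_left hm]
  refine lintegral_mono fun ω => ?_
  dsimp only
  rw [postHit_eq]
  by_cases hω : hitT a ω ≤ n
  · rw [if_pos hω, inf_eq_left.2 hω]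
    have hle : absSum f (hitT a ω).toNat ω ≤ absSum f n ω :=
      absSum_mono f ω (ENat.toNat_le_of_le_natCast hω)
    have := hsub (absSum f (hitT a ω).toNat ω) (absSum f n ω - absSum f (hitT a ω).toNat ω)
      (absSum_nonneg _ _ _) (by linarith)
    rwa [add_sub_cancel] at this
  · rw [if_neg hω, add_zero, inf_eq_right.2 (le_of_not_ge hω), ENat.toNat_natCast]
    exact hmono _ (absSum_nonneg _ _ _)

end IsChainLaw

end Renewal

/-- A lower Potter bound for monotone regularly varying functions of positive index. -/
lemma RegVary.exists_potter_lower {h : ℝ → ℝ} (hm : Monotone h) {idx s : ℝ} (hR : RegVary h idx)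
    (hs0 : 0 ≤ s) (hs : s < idx) :
    ∃ x₀ > (0 : ℝ), ∃ c > (0 : ℝ), ∀ x ≥ x₀, 0 < h x ∧ ∀ θ ≥ (1 : ℝ), c * θ ^ s * h x ≤ h (θ * x) := by
  have h2 := hR 2 two_pos
  have hlt : (2 : ℝ) ^ s < 2 ^ idx := Real.rpow_lt_rpow_of_exponent_lt one_lt_two hs
  have hone : (1 : ℝ) ≤ 2 ^ s := Real.one_le_rpow one_le_two hs0
  obtain ⟨x₀, hx₀⟩ := eventually_atTop.1 (h2.eventually (lt_mem_nhds hlt))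
  have hpos : ∀ t ≥ max x₀ 1, 0 < h t ∧ 2 ^ s * h t ≤ h (t * 2) := by
    intro t ht
    have hr := hx₀ t ((le_max_left _ _).trans ht)
    have ht1 : 1 ≤ t := (le_max_right _ _).trans ht
    have hmt : h t ≤ h (t * 2) := hm (by linarith)
    have ht0 : 0 < h t := by
      rcases lt_trichotomy (h t) 0 with h0 | h0 | h0
      · have : h (t * 2) / h t ≤ 1 := by rw [div_le_one_of_neg h0]; exact hmt
        linarith
      · rw [h0, div_zero] at hr; linarith
      · exact h0
    exact ⟨ht0, ((lt_div_iff₀ ht0).1 hr).le⟩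
  refine ⟨max x₀ 1, by positivity, (2 ^ s)⁻¹, by positivity, fun x hx => ⟨(hpos x hx).1, ?_⟩⟩
  have hx1 : 1 ≤ x := (le_max_right _ _).trans hx
  have hiter : ∀ k : ℕ, (2 ^ s) ^ k * h x ≤ h (2 ^ k * x) := by
    intro k
    induction k with
    | zero => simp
    | succ k ih =>
      have hk : max x₀ 1 ≤ 2 ^ k * x :=
        hx.trans (le_mul_of_one_le_left (by linarith) (one_le_pow₀ one_le_two))
      have := (hpos _ hk).2
      rw [show (2 : ℝ) ^ (k + 1) * x = 2 ^ k * x * 2 by ring]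
      refine le_trans ?_ this
      rw [pow_succ', mul_assoc]
      gcongr
  intro θ hθ
  obtain ⟨k, hk1, hk2⟩ := exists_nat_pow_near hθ one_lt_two
  refine le_trans ?_ ((hiter k).trans (hm (by gcongr)))
  refine mul_le_mul_of_nonneg_right ?_ (hpos x hx).1.le
  have : θ ^ s ≤ (2 ^ (k + 1)) ^ s := Real.rpow_le_rpow (by linarith) hk2.le hs0
  rw [← Real.rpow_natCast_mul (by norm_num), mul_comm, Real.rpow_mul_natCast (by norm_num)] at this
  rw [inv_mul_le_iff₀ (by positivity), ← pow_succ']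
  exact this

section RegularSequence

/-- Positive sequences that are regularly varying with index `ζ`. -/
def RegSeq (p : ℕ → ℝ) (ζ : ℝ) : Prop :=
  (∀ k, 0 < p k) ∧
    ∀ r : ℝ, 0 < r → Tendsto (fun n : ℕ => p ⌊r * (n : ℝ)⌋₊ / p n) atTop (𝓝 (r ^ ζ))

/-- The logarithm of the slowly varying part of a regularly varying sequence. -/
def logSlow (p : ℕ → ℝ) (ζ : ℝ) (k : ℕ) : ℝ := Real.log (p k) - ζ * Real.log k

namespace RegSeq

variable {p : ℕ → ℝ} {ζ : ℝ}

lemma tendsto_logSlow (hp : RegSeq p ζ) {r : ℝ} (hr : 0 < r) :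
    Tendsto (fun n : ℕ => logSlow p ζ ⌊r * (n : ℝ)⌋₊ - logSlow p ζ n) atTop (𝓝 0) := by
  have h1 : Tendsto (fun n : ℕ => Real.log (p ⌊r * (n : ℝ)⌋₊ / p n)) atTop
      (𝓝 (Real.log (r ^ ζ))) := (hp.2 r hr).log (Real.rpow_pos_of_pos hr ζ).ne'
  have h2 : Tendsto (fun n : ℕ => Real.log ((⌊r * (n : ℝ)⌋₊ : ℝ) / n)) atTop (𝓝 (Real.log r)) :=
    ((tendsto_nat_floor_mul_div_atTop hr.le).comp tendsto_natCast_atTop_atTop).log hr.ne'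
  have h3 := h1.sub (h2.const_mul ζ)
  rw [Real.log_rpow hr, sub_self] at h3
  refine h3.congr' ?_
  have hfl : ∀ᶠ n : ℕ in atTop, 1 ≤ r * (n : ℝ) :=
    (tendsto_natCast_atTop_atTop.const_mul_atTop hr).eventually_ge_atTop 1
  filter_upwards [hfl, eventually_gt_atTop 0] with n hn hn0
  have hf : 0 < ⌊r * (n : ℝ)⌋₊ := Nat.floor_pos.2 hn
  rw [Real.log_div (hp.1 _).ne' (hp.1 _).ne', Real.log_div (by positivity) (by positivity)]
  simp only [logSlow]
  ring

lemma exists_logSlow_bound (hp : RegSeq p ζ) :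
    ∃ K : ℕ, 1 ≤ K ∧ ∀ k ≥ K, ∀ m, k ≤ m → m ≤ 2 * k → |logSlow p ζ m - logSlow p ζ k| ≤ 2 := by
  set h := logSlow p ζ with hh
  let B : ℕ → Set ℝ := fun K => {r ∈ Icc (1 : ℝ) 3 | ∃ k ≥ K, 1 < |h ⌊r * (k : ℝ)⌋₊ - h k|}
  have hBmeas : ∀ K, MeasurableSet (B K) := by
    intro K
    have : B K = Icc (1 : ℝ) 3 ∩ ⋃ k ≥ K, {r : ℝ | 1 < |h ⌊r * (k : ℝ)⌋₊ - h k|} := by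
      ext r; simp [B]
    rw [this]
    refine measurableSet_Icc.inter (MeasurableSet.biUnion (to_countable _) fun k _ => ?_)
    have hf : Measurable fun r : ℝ => |h ⌊r * (k : ℝ)⌋₊ - h k| := by
      have h1 : Measurable fun r : ℝ => ⌊r * (k : ℝ)⌋₊ := Nat.measurable_floor.comp (by fun_prop)
      have h2 : Measurable fun r : ℝ => h ⌊r * (k : ℝ)⌋₊ :=
        (measurable_from_top : Measurable h).comp h1
      exact continuous_abs.measurable.comp (h2.sub_const _)
    exact measurableSet_lt measurable_const hf
  have hBanti : Antitone B := fun i j hij r hr => ⟨hr.1, hr.2.imp fun k hk => ⟨hij.trans hk.1, hk.2⟩⟩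
  have hBempty : ⋂ K, B K = ∅ := by
    ext r
    simp only [mem_iInter, mem_empty_iff_false, iff_false, not_forall]
    by_cases hr : r ∈ Icc (1 : ℝ) 3
    · have ht := hp.tendsto_logSlow (r := r) (by linarith [hr.1])
      have := ht.eventually (Metric.ball_mem_nhds (0 : ℝ) one_pos)
      obtain ⟨K, hK⟩ := eventually_atTop.1 this
      refine ⟨K, fun hB => ?_⟩
      obtain ⟨-, k, hk, hk'⟩ := hB
      have := hK k hk
      rw [Real.dist_0_eq_abs] at this
      exact absurd hk' (not_lt.2 this.le)
    · exact ⟨0, fun hB => hr hB.1⟩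
  have hlim : Tendsto (fun K => volume (B K)) atTop (𝓝 0) := by
    have := tendsto_measure_iInter_atTop (μ := volume) (fun K => (hBmeas K).nullMeasurableSet) hBanti
      ⟨0, ne_top_of_le_ne_top (by simp : volume (Icc (1 : ℝ) 3) ≠ ⊤)
        (measure_mono fun r hr => hr.1)⟩
    rwa [hBempty, measure_empty] at this
  obtain ⟨K, hK⟩ := eventually_atTop.1 (hlim.eventually
    (gt_mem_nhds (show (0 : ℝ≥0∞) < ENNReal.ofReal (1 / 4) by simp)))
  refine ⟨max K 1, le_max_right _ _, fun k hk m hkm hmk => ?_⟩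
  have hk1 : 1 ≤ k := (le_max_right _ _).trans hk
  have hkK : K ≤ k := (le_max_left _ _).trans hk
  have hk0 : (0 : ℝ) < k := by exact_mod_cast hk1
  have hm0 : (0 : ℝ) < m := by exact_mod_cast hk1.trans hkm
  have hkm' : (k : ℝ) ≤ m := by exact_mod_cast hkm
  have hmk' : (m : ℝ) ≤ 2 * k := by exact_mod_cast hmk
  obtain ⟨r, hr, hrB⟩ : ∃ r ∈ Icc (2 : ℝ) 3, r ∉ B K ∪ (fun x => (k / m : ℝ) * x) ⁻¹' B K := by
    by_contra! hcon
    have h1 : volume (Icc (2 : ℝ) 3) ≤ volume (B K ∪ (fun x => (k / m : ℝ) * x) ⁻¹' B K) :=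
      measure_mono hcon
    refine absurd h1 (not_le.2 ((measure_union_le _ _).trans_lt ?_))
    rw [Real.volume_preimage_mul_left (by positivity), Real.volume_Icc]
    have h2 : ENNReal.ofReal |((k : ℝ) / m)⁻¹| ≤ ENNReal.ofReal 2 := by
      gcongr
      rw [abs_of_pos (by positivity), inv_div, div_le_iff₀ hk0]
      exact hmk'
    calc _ ≤ ENNReal.ofReal (1 / 4) + ENNReal.ofReal 2 * ENNReal.ofReal (1 / 4) :=
          add_le_add (hK K le_rfl).le (mul_le_mul' h2 (hK K le_rfl).le)
      _ = ENNReal.ofReal (3 / 4) := by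
          rw [← ENNReal.ofReal_mul (by norm_num), ← ENNReal.ofReal_add (by norm_num) (by norm_num)]
          norm_num
      _ < _ := by rw [ENNReal.ofReal_lt_ofReal_iff] <;> norm_num
  have good : ∀ r ∈ Icc (1 : ℝ) 3, r ∉ B K → ∀ k ≥ K, |h ⌊r * (k : ℝ)⌋₊ - h k| ≤ 1 := by
    intro r hr hrB k hk
    by_contra! hc
    exact hrB ⟨hr, k, hk, hc⟩
  simp only [mem_union, mem_preimage, not_or] at hrB
  have hr' : (k / m : ℝ) * r ∈ Icc (1 : ℝ) 3 := by
    have h1 : (1 / 2 : ℝ) ≤ k / m := by rw [le_div_iff₀ hm0]; linarith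
    have h2 : (k / m : ℝ) ≤ 1 := by rw [div_le_one hm0]; exact hkm'
    constructor <;> nlinarith [hr.1, hr.2]
  have g1 := good r ⟨by linarith [hr.1], hr.2⟩ hrB.1 k hkK
  have g2 := good _ hr' hrB.2 m (hkK.trans hkm)
  rw [show (k / m : ℝ) * r * m = r * k by field_simp] at g2
  rw [abs_le] at *
  constructor <;> linarith [g1.1, g1.2, g2.1, g2.2]

/-- Potter bounds for regularly varying sequences. -/
lemma exists_potter (hp : RegSeq p ζ) {η : ℝ} (hη : 0 < η) :
    ∃ K : ℕ, 1 ≤ K ∧ ∃ C > (0 : ℝ), ∀ k ≥ K, ∀ m ≥ k,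
      p m ≤ C * ((m : ℝ) / k) ^ (ζ + η) * p k ∧ p k ≤ C * ((m : ℝ) / k) ^ (η - ζ) * p m := by
  obtain ⟨K₁, hK₁, hb⟩ := hp.exists_logSlow_bound
  have ht := hp.tendsto_logSlow (r := 2) two_pos
  obtain ⟨K₂, hK₂⟩ := eventually_atTop.1 (ht.eventually (Metric.closedBall_mem_nhds (0 : ℝ)
    (show 0 < η * Real.log 2 from mul_pos hη (Real.log_pos one_lt_two))))
  have hfl : ∀ k : ℕ, ⌊(2 : ℝ) * k⌋₊ = 2 * k := fun k => by
    rw [show (2 : ℝ) * k = ((2 * k : ℕ) : ℝ) by push_cast; ring]; exact Nat.floor_natCast _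
  have hstep : ∀ k ≥ K₂, |logSlow p ζ (2 * k) - logSlow p ζ k| ≤ η * Real.log 2 := by
    intro k hk
    have := hK₂ k hk
    rwa [Real.dist_0_eq_abs, hfl] at this
  have key : ∀ k ≥ max K₁ K₂, ∀ m ≥ k,
      |logSlow p ζ m - logSlow p ζ k| ≤ 2 + η * Real.log ((m : ℝ) / k) := by
    intro k hk m hm
    have hkK₁ : K₁ ≤ k := (le_max_left _ _).trans hk
    have hk1 : 1 ≤ k := hK₁.trans hkK₁
    have hk0 : (0 : ℝ) < k := by exact_mod_cast hk1
    have hmk : (1 : ℝ) ≤ (m : ℝ) / k := by rw [one_le_div hk0]; exact_mod_cast hm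
    obtain ⟨j, hj1, hj2⟩ := exists_nat_pow_near hmk one_lt_two
    have hit : ∀ j : ℕ, |logSlow p ζ (2 ^ j * k) - logSlow p ζ k| ≤ j * (η * Real.log 2) := by
      intro j
      induction j with
      | zero => simp
      | succ j ih =>
        have := hstep (2 ^ j * k) (((le_max_right _ _).trans hk).trans
          (Nat.le_mul_of_pos_left _ (by positivity)))
        rw [← mul_assoc, ← pow_succ'] at this
        rw [abs_le] at *
        push_cast
        constructor <;> linarith [ih.1, ih.2, this.1, this.2]
    have h1 : 2 ^ j * k ≤ m := by
      rw [le_div_iff₀ hk0] at hj1; exact_mod_cast hj1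
    have h2 : m ≤ 2 * (2 ^ j * k) := by
      rw [div_lt_iff₀ hk0] at hj2
      have : (m : ℝ) ≤ 2 * (2 ^ j * k) := by rw [pow_succ] at hj2; linarith
      exact_mod_cast this
    have hb' := hb (2 ^ j * k) (hkK₁.trans (Nat.le_mul_of_pos_left _ (by positivity))) m h1 h2
    have hj := hit j
    have hlog : j * Real.log 2 ≤ Real.log ((m : ℝ) / k) := by
      rw [← Real.log_pow]; exact Real.log_le_log (by positivity) hj1
    have := mul_le_mul_of_nonneg_left hlog hη.le
    rw [abs_le] at *
    constructor <;> nlinarith [hj.1, hj.2, hb'.1, hb'.2]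
  refine ⟨max K₁ K₂, hK₁.trans (le_max_left _ _), Real.exp 2, Real.exp_pos _, fun k hk m hm => ?_⟩
  have hk1 : 1 ≤ k := hK₁.trans ((le_max_left _ _).trans hk)
  have hk0 : (0 : ℝ) < k := by exact_mod_cast hk1
  have hm0 : (0 : ℝ) < m := by exact_mod_cast hk1.trans hm
  have hb := abs_le.1 (key k hk m hm)
  have hq : (0 : ℝ) < m / k := by positivity
  rw [Real.log_div hm0.ne' hk0.ne'] at hb
  simp only [logSlow] at hb
  constructor
  · rw [← Real.exp_log (hp.1 m), ← Real.exp_log (hp.1 k), Real.rpow_def_of_pos hq, ← Real.exp_add,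
      ← Real.exp_add, Real.log_div hm0.ne' hk0.ne']
    gcongr
    nlinarith [hb.1, hb.2]
  · rw [← Real.exp_log (hp.1 m), ← Real.exp_log (hp.1 k), Real.rpow_def_of_pos hq, ← Real.exp_add,
      ← Real.exp_add, Real.log_div hm0.ne' hk0.ne']
    gcongr
    nlinarith [hb.1, hb.2]

lemma exists_mul_le (hp : RegSeq p ζ) (hζ : -1 < ζ) :
    ∃ K : ℕ, 1 ≤ K ∧ ∃ C > (0 : ℝ), ∀ k ≥ K, ∀ m ≥ k, k * p k ≤ C * (m * p m) := by
  obtain ⟨K, hK, C, hC, h⟩ := hp.exists_potter (η := 1 + ζ) (by linarith)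
  refine ⟨K, hK, C, hC, fun k hk m hm => ?_⟩
  have hk0 : (0 : ℝ) < k := by exact_mod_cast hK.trans hk
  have := (h k hk m hm).2
  rw [show 1 + ζ - ζ = 1 by ring, Real.rpow_one] at this
  calc k * p k ≤ k * (C * (m / k) * p m) := by gcongr
    _ = _ := by field_simp

lemma tendsto_mul_atTop (hp : RegSeq p ζ) (hζ : -1 < ζ) :
    Tendsto (fun k : ℕ => (k : ℝ) * p k) atTop atTop := by
  obtain ⟨K, hK, C, hC, h⟩ := hp.exists_potter (η := (1 + ζ) / 2) (by linarith)
  have hK0 : (0 : ℝ) < K := by exact_mod_cast hK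
  have ht : Tendsto (fun m : ℕ => K * p K / C * ((m : ℝ) / K) ^ ((1 + ζ) / 2)) atTop atTop := by
    refine Tendsto.const_mul_atTop (div_pos (mul_pos hK0 (hp.1 K)) hC) ?_
    exact (tendsto_rpow_atTop (by linarith)).comp
      (tendsto_natCast_atTop_atTop.atTop_div_const hK0)
  refine tendsto_atTop_mono' _ ?_ ht
  filter_upwards [eventually_ge_atTop K] with m hm
  have hm0 : (0 : ℝ) < m := by exact_mod_cast hK.trans hm
  have hq : (0 : ℝ) < m / K := by positivity
  have := (h K le_rfl m hm).2
  rw [show (1 + ζ) / 2 - ζ = 1 - (1 + ζ) / 2 by ring, Real.rpow_sub hq, Real.rpow_one] at this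
  have hr : 0 < ((m : ℝ) / K) ^ ((1 + ζ) / 2) := by positivity
  rw [div_mul_eq_mul_div, div_le_iff₀ hC]
  calc _ ≤ K * (C * ((m : ℝ) / K / ((m : ℝ) / K) ^ ((1 + ζ) / 2)) * p m) *
        ((m : ℝ) / K) ^ ((1 + ζ) / 2) := by gcongr
    _ = _ := by field_simp

end RegSeq

lemma sum_rpow_le {s : ℝ} (hs : -1 < s) (hs' : s ≤ 0) (n : ℕ) :
    ∑ k ∈ Finset.range n, ((k : ℝ) + 1) ^ s ≤ (n : ℝ) ^ (s + 1) / (s + 1) := by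
  have hs1 : 0 < s + 1 := by linarith
  induction n with
  | zero => simp [Real.zero_rpow hs1.ne']
  | succ n ih =>
    rw [Finset.sum_range_succ]
    have hn : (0 : ℝ) < (n : ℝ) + 1 := by positivity
    have hb := _root_.rpow_one_add_le_one_add_mul_self (s := -(1 / ((n : ℝ) + 1))) (p := s + 1)
      (by rw [neg_le_neg_iff, div_le_one hn]; simp) hs1.le (by linarith)
    have h1 : (n : ℝ) ^ (s + 1) = ((n : ℝ) + 1) ^ (s + 1) * (1 + -(1 / ((n : ℝ) + 1))) ^ (s + 1) := by
      rw [← Real.mul_rpow hn.le]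
      · congr 1; field_simp; ring
      · rw [← sub_eq_add_neg, sub_nonneg, div_le_one hn]; simp
    have h2 : ((n : ℝ) + 1) ^ (s + 1) = ((n : ℝ) + 1) ^ s * ((n : ℝ) + 1) := by
      rw [Real.rpow_add_one hn.ne']
    have h3 : (n : ℝ) ^ (s + 1) + (s + 1) * ((n : ℝ) + 1) ^ s ≤ ((n : ℝ) + 1) ^ (s + 1) := by
      rw [h1]
      have h4 := mul_le_mul_of_nonneg_left hb (Real.rpow_nonneg hn.le (s + 1))
      have h5 : ((n : ℝ) + 1) ^ (s + 1) * (1 + (s + 1) * -(1 / ((n : ℝ) + 1))) =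
          ((n : ℝ) + 1) ^ (s + 1) - (s + 1) * ((n : ℝ) + 1) ^ s := by
        rw [h2]; field_simp; ring
      linarith
    push_cast
    rw [le_div_iff₀ hs1] at *
    linarith

lemma sum_Ico_rpow_neg_le {e : ℝ} (he : 0 < e) {n : ℕ} (hn : 1 ≤ n) (N : ℕ) :
    ∑ k ∈ Finset.Ico n N, ((k : ℝ) / n) ^ (-1 - e) ≤ (1 + 1 / e) * n := by
  have hn0 : (0 : ℝ) < n := by exact_mod_cast hn
  rcases le_or_gt N n with hN | hN
  · rw [Finset.Ico_eq_empty (by omega)]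
    simp only [Finset.sum_empty]
    positivity
  suffices h : ∑ k ∈ Finset.Ico n N, ((k : ℝ) / n) ^ (-1 - e) ≤
      1 + n / e * (1 - (((N - 1 : ℕ) : ℝ) / n) ^ (-e)) by
    refine h.trans ?_
    have h1 : 0 ≤ n / e * (((N - 1 : ℕ) : ℝ) / n) ^ (-e) := by positivity
    have h2 : (1 : ℝ) ≤ n := by exact_mod_cast hn
    have h3 : (1 + 1 / e) * n = n + n / e := by ring
    rw [h3, mul_sub, mul_one]
    linarith
  induction N, hN using Nat.le_induction with
  | base => simp [hn0.ne']
  | succ N hN ih =>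
    have hnN : n ≤ N := (Nat.le_succ n).trans hN
    rw [Finset.sum_Ico_succ_top hnN]
    have hN1 : n ≤ N - 1 := by omega
    have hN0 : (0 : ℝ) < ((N - 1 : ℕ) : ℝ) := by
      have : 1 ≤ N - 1 := hn.trans hN1
      exact_mod_cast this
    have hNN : (N : ℝ) = ((N - 1 : ℕ) : ℝ) + 1 := by
      have : N = (N - 1) + 1 := by omega
      exact_mod_cast this
    have hNp : (0 : ℝ) < N := by linarith
    simp only [Nat.add_sub_cancel]
    have hq : (0 : ℝ) < N / n := by positivity
    have h1 : (((N - 1 : ℕ) : ℝ) / n) ^ (-e) = ((N : ℝ) / n) ^ (-e) * (1 - 1 / N) ^ (-e) := by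
      have h0 : (0 : ℝ) ≤ 1 - 1 / N := by
        rw [sub_nonneg, div_le_one hNp, hNN]; linarith
      rw [← Real.mul_rpow hq.le h0]
      congr 1
      rw [show ((N - 1 : ℕ) : ℝ) = N - 1 by linarith]
      field_simp
    have h2 : 1 + e / N ≤ (1 - 1 / (N : ℝ)) ^ (-e) := by
      have h0 : (0 : ℝ) < 1 - 1 / N := by
        rw [sub_pos, div_lt_one hNp, hNN]; linarith
      rw [Real.rpow_def_of_pos h0]
      have hl := Real.log_le_sub_one_of_pos h0
      have hx := Real.add_one_le_exp (Real.log (1 - 1 / (N : ℝ)) * -e)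
      have : e / N = e * (1 / N) := by ring
      nlinarith
    have h3 : ((N : ℝ) / n) ^ (-1 - e) = ((N : ℝ) / n) ^ (-e) * (n / N) := by
      rw [show -1 - e = -e + -1 by ring, Real.rpow_add hq, Real.rpow_neg_one, inv_div]
    have h4 : ((N : ℝ) / n) ^ (-e) * (1 + e / N) ≤ (((N - 1 : ℕ) : ℝ) / n) ^ (-e) := by
      rw [h1]; gcongr
    have h5 : n / e * (((N : ℝ) / n) ^ (-e) * (1 + e / N)) =
        n / e * ((N : ℝ) / n) ^ (-e) + ((N : ℝ) / n) ^ (-e) * (n / N) := by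
      field_simp
    have h6 := mul_le_mul_of_nonneg_left h4 (show 0 ≤ n / e by positivity)
    rw [h3]
    rw [h5] at h6
    linarith

namespace RegSeq

variable {p : ℕ → ℝ} {ζ : ℝ}

lemma exists_sum_tail_le (hp : RegSeq p ζ) {ε : ℝ} (hε : 0 < ε) :
    ∃ n₀ : ℕ, ∃ C > (0 : ℝ), ∀ n ≥ n₀, ∀ N : ℕ,
      ∑ k ∈ Finset.Ico n N, p k * ((k : ℝ) / n) ^ (-ζ - 1 - ε) ≤ C * (n * p n) := by
  obtain ⟨K, hK, C, hC, h⟩ := hp.exists_potter (η := ε / 2) (by linarith)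
  refine ⟨K, C * (1 + 1 / (ε / 2)), by positivity, fun n hn N => ?_⟩
  have hn0 : (0 : ℝ) < n := by exact_mod_cast hK.trans hn
  have hpn := hp.1 n
  calc _ ≤ ∑ k ∈ Finset.Ico n N, C * p n * ((k : ℝ) / n) ^ (-1 - ε / 2) := by
        refine Finset.sum_le_sum fun k hk => ?_
        have hk := Finset.mem_Ico.1 hk
        have hk0 : (0 : ℝ) < k := hn0.trans_le (by exact_mod_cast hk.1)
        have hq : (0 : ℝ) < k / n := by positivity
        refine (mul_le_mul_of_nonneg_right (h n hn k hk.1).1 (by positivity)).trans (le_of_eq ?_)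
        have : ((k : ℝ) / n) ^ (-1 - ε / 2) =
            ((k : ℝ) / n) ^ (ζ + ε / 2) * ((k : ℝ) / n) ^ (-ζ - 1 - ε) := by
          rw [← Real.rpow_add hq]; congr 1; ring
        rw [this]
        ac_rfl
    _ = C * p n * ∑ k ∈ Finset.Ico n N, ((k : ℝ) / n) ^ (-1 - ε / 2) := by rw [Finset.mul_sum]
    _ ≤ C * p n * ((1 + 1 / (ε / 2)) * n) := by
        gcongr
        exact sum_Ico_rpow_neg_le (by linarith) (hK.trans hn) N
    _ = _ := by ring

lemma exists_sum_head_le (hp : RegSeq p ζ) (hζ : -1 < ζ) (R : ℕ) (hR : 1 ≤ R) :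
    ∃ n₀ : ℕ, ∃ C > (0 : ℝ), ∀ n ≥ n₀, ∑ k ∈ Finset.range (R * n), p k ≤ C * (n * p n) := by
  set η := max ((1 + ζ) / 2) (ζ + 1 / 2) with hη
  have hη0 : 0 < η := lt_max_of_lt_left (by linarith)
  have hη1 : -1 < ζ - η := by
    have : η < 1 + ζ := max_lt (by linarith) (by linarith)
    linarith
  have hη2 : ζ - η ≤ 0 := by
    have := le_max_right ((1 + ζ) / 2) (ζ + 1 / 2)
    linarith
  obtain ⟨K, hK, C, hC, h⟩ := hp.exists_potter hη0
  obtain ⟨n₁, hn₁⟩ := eventually_atTop.1 ((hp.tendsto_mul_atTop hζ).eventually_ge_atTop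
    (∑ k ∈ Finset.range K, p k))
  have hs1 : 0 < ζ - η + 1 := by linarith
  refine ⟨max K n₁, 1 + C / (ζ - η + 1) + C * (R : ℝ) ^ |ζ + η| * R, by positivity, fun n hn => ?_⟩
  have hnK : K ≤ n := (le_max_left _ _).trans hn
  have hn1 := hn₁ n ((le_max_right _ _).trans hn)
  have hn0 : (0 : ℝ) < n := by exact_mod_cast hK.trans hnK
  have hpn := hp.1 n
  have hR1 : (1 : ℝ) ≤ R := by exact_mod_cast hR
  have hsplit : ∑ k ∈ Finset.range (R * n), p k = ∑ k ∈ Finset.range K, p k +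
      ∑ k ∈ Finset.Ico K n, p k + ∑ k ∈ Finset.Ico n (R * n), p k := by
    rw [Finset.sum_range_add_sum_Ico _ hnK,
      Finset.sum_range_add_sum_Ico _ (Nat.le_mul_of_pos_left n hR)]
  have hmid : ∑ k ∈ Finset.Ico K n, p k ≤ C / (ζ - η + 1) * (n * p n) := by
    calc _ ≤ ∑ k ∈ Finset.Ico K n, C * p n * (n : ℝ) ^ (η - ζ) * (k : ℝ) ^ (ζ - η) := by
          refine Finset.sum_le_sum fun k hk => ?_
          have hk := Finset.mem_Ico.1 hk
          have hk0 : (0 : ℝ) < k := by exact_mod_cast hK.trans hk.1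
          refine (h k hk.1 n hk.2.le).2.trans (le_of_eq ?_)
          rw [Real.div_rpow hn0.le hk0.le, show ζ - η = -(η - ζ) by ring, Real.rpow_neg hk0.le]
          ring
      _ = C * p n * (n : ℝ) ^ (η - ζ) * ∑ k ∈ Finset.Ico K n, (k : ℝ) ^ (ζ - η) := by
          rw [Finset.mul_sum]
      _ ≤ C * p n * (n : ℝ) ^ (η - ζ) * ((n : ℝ) ^ (ζ - η + 1) / (ζ - η + 1)) := by
          gcongr
          refine le_trans ?_ (sum_rpow_le hη1 hη2 n)
          rw [Finset.sum_Ico_eq_sum_range]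
          calc _ ≤ ∑ k ∈ Finset.range (n - K), ((k : ℝ) + 1) ^ (ζ - η) := by
                refine Finset.sum_le_sum fun k _ => ?_
                refine Real.rpow_le_rpow_of_nonpos (by positivity) ?_ hη2
                push_cast
                have : (1 : ℝ) ≤ K := by exact_mod_cast hK
                linarith
            _ ≤ _ := Finset.sum_le_sum_of_subset_of_nonneg
                (Finset.range_mono (Nat.sub_le _ _)) fun k _ _ => by positivity
      _ = _ := by
          have : (n : ℝ) ^ (η - ζ) * (n : ℝ) ^ (ζ - η + 1) = n := by
            rw [← Real.rpow_add hn0, show η - ζ + (ζ - η + 1) = 1 by ring, Real.rpow_one]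
          calc _ = C * p n * ((n : ℝ) ^ (η - ζ) * (n : ℝ) ^ (ζ - η + 1)) / (ζ - η + 1) := by ring
            _ = _ := by rw [this]; ring
  have hlast : ∑ k ∈ Finset.Ico n (R * n), p k ≤ C * (R : ℝ) ^ |ζ + η| * R * (n * p n) := by
    calc _ ≤ ∑ k ∈ Finset.Ico n (R * n), C * (R : ℝ) ^ |ζ + η| * p n := by
          refine Finset.sum_le_sum fun k hk => ?_
          have hk := Finset.mem_Ico.1 hk
          refine (h n hnK k hk.1).1.trans ?_
          gcongr
          have hq1 : (1 : ℝ) ≤ k / n := by rw [one_le_div hn0]; exact_mod_cast hk.1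
          have hq2 : (k : ℝ) / n ≤ R := by rw [div_le_iff₀ hn0]; exact_mod_cast hk.2.le
          exact (Real.rpow_le_rpow_of_exponent_le hq1 (le_abs_self _)).trans
            (Real.rpow_le_rpow (by linarith) hq2 (abs_nonneg _))
      _ = ((R * n - n : ℕ) : ℝ) * (C * (R : ℝ) ^ |ζ + η| * p n) := by simp
      _ ≤ (R * n : ℕ) * (C * (R : ℝ) ^ |ζ + η| * p n) := by
          gcongr
          exact Nat.sub_le _ _
      _ = _ := by push_cast; ring
  rw [hsplit]
  linarith

end RegSeq

end RegularSequence

section Inverse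

variable {ψf : ℝ → ℝ} {β : ℝ}

lemma RegVary.tendsto_atTop (hψ : Monotone ψf) (hR : RegVary ψf β) (hβ : 0 < β) :
    Tendsto ψf atTop atTop := by
  obtain ⟨x₀, hx₀, c, hc, h⟩ := hR.exists_potter_lower hψ (s := β / 2) (by linarith) (by linarith)
  have ht : Tendsto (fun x => c * (x / x₀) ^ (β / 2) * ψf x₀) atTop atTop :=
    (((tendsto_rpow_atTop (by linarith)).comp (tendsto_id.atTop_div_const hx₀)).const_mul_atTop
      hc).atTop_mul_const (h x₀ le_rfl).1
  refine tendsto_atTop_mono' _ ?_ ht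
  filter_upwards [eventually_ge_atTop x₀] with x hx
  have := (h x₀ le_rfl).2 (x / x₀) (by rwa [ge_iff_le, one_le_div hx₀])
  rwa [div_mul_cancel₀ _ hx₀.ne'] at this

lemma geninv_set_nonempty (ht : Tendsto ψf atTop atTop) (x : ℝ) :
    {y : ℝ | 1 ≤ y ∧ x ≤ ψf y}.Nonempty :=
  ((eventually_ge_atTop 1).and (ht.eventually_ge_atTop x)).exists

lemma one_le_geninv (ht : Tendsto ψf atTop atTop) (x : ℝ) : 1 ≤ geninv ψf x :=
  le_csInf (geninv_set_nonempty ht x) fun _ hy => hy.1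

lemma geninv_mono (ht : Tendsto ψf atTop atTop) : Monotone (geninv ψf) := fun _ y hxy =>
  csInf_le_csInf ⟨1, fun _ hy => hy.1⟩ (geninv_set_nonempty ht y) fun _ hz => ⟨hz.1, hxy.trans hz.2⟩

lemma le_apply_of_geninv_lt (hψ : Monotone ψf) (ht : Tendsto ψf atTop atTop) {x y : ℝ}
    (h : geninv ψf x < y) : x ≤ ψf y := by
  obtain ⟨z, hz, hzy⟩ := exists_lt_of_csInf_lt (geninv_set_nonempty ht x) h
  exact hz.2.trans (hψ hzy.le)

lemma tendsto_geninv (hψ : Monotone ψf) (ht : Tendsto ψf atTop atTop) :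
    Tendsto (geninv ψf) atTop atTop := by
  refine tendsto_atTop.2 fun M => ?_
  filter_upwards [eventually_gt_atTop (ψf M)] with x hx
  by_contra! hc
  exact absurd (le_apply_of_geninv_lt hψ ht hc) (not_le.2 hx)

end Inverse

section Cumulant

/-- The centred exponential cumulant `∫ (e^{yz} - 1 - yz) ρ(dz)`. -/
def centredCumulant (ρ : Measure ℝ) (y : ℝ) : ℝ := ∫ z, (Real.exp (y * z) - 1 - y * z) ∂ρ

/-- The symmetrised cumulant `∫ (e^{yz} + e^{-yz} - 2) ρ(dz)`. -/
def symCumulant (ρ : Measure ℝ) (y : ℝ) : ℝ≥0∞ :=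
  ∫⁻ z, ENNReal.ofReal (4 * Real.sinh (y * z / 2) ^ 2) ∂ρ

lemma four_mul_sinh_half_sq (x : ℝ) :
    4 * Real.sinh (x / 2) ^ 2 = Real.exp x + Real.exp (-x) - 2 := by
  have h1 : Real.exp x = Real.exp (x / 2) ^ 2 := by rw [← Real.exp_nat_mul]; congr 1; push_cast; ring
  have h2 : Real.exp (-x) = Real.exp (-(x / 2)) ^ 2 := by
    rw [← Real.exp_nat_mul]; congr 1; push_cast; ring
  have h3 : Real.exp (x / 2) * Real.exp (-(x / 2)) = 1 := by rw [← Real.exp_add]; simp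
  rw [Real.sinh_eq, h1, h2]
  nlinarith

lemma exp_sub_one_sub_nonneg (x : ℝ) : 0 ≤ Real.exp x - 1 - x := by
  linarith [Real.add_one_le_exp x]

lemma exp_sub_one_sub_le (x : ℝ) : Real.exp x - 1 - x ≤ 4 * Real.sinh (x / 2) ^ 2 := by
  rw [four_mul_sinh_half_sq]
  linarith [Real.add_one_le_exp (-x)]

lemma min_sq_abs_le_exp (x : ℝ) : min (x ^ 2) |x| / 4 ≤ Real.exp x - 1 - x := by
  rcases le_or_gt 0 x with hx | hx
  · have := Real.quadratic_le_exp_of_nonneg hx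
    have h2 := min_le_left (x ^ 2) |x|
    nlinarith [sq_nonneg x]
  · rcases le_or_gt (-2) x with h | h
    · have h1 := Real.add_one_le_exp (x / 2)
      have h2 : Real.exp x = Real.exp (x / 2) ^ 2 := by
        rw [← Real.exp_nat_mul]; congr 1; push_cast; ring
      have h3 := min_le_left (x ^ 2) |x|
      nlinarith
    · have h3 := min_le_right (x ^ 2) |x|
      rw [abs_of_neg hx] at h3 ⊢
      linarith [Real.exp_pos x]

lemma exp_neg_abs_sinh (x : ℝ) (hx : |x| ≤ 1) (y : ℝ) :
    4 * Real.sinh (y * x / 2) ^ 2 ≤ 4 * (Real.sinh (|y| / 2) ^ 2) * x ^ 2 := by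
  have hconv : ConvexOn ℝ (Ici (0 : ℝ)) Real.sinh := by
    refine convexOn_of_deriv2_nonneg (convex_Ici 0) Real.continuous_sinh.continuousOn
      Real.differentiable_sinh.differentiableOn (by
        rw [Real.deriv_sinh]; exact Real.differentiable_cosh.differentiableOn) ?_
    intro x hx
    rw [interior_Ici] at hx
    simp only [Function.iterate_succ, Function.iterate_zero, Function.comp_apply, id_eq,
      Real.deriv_sinh, Real.deriv_cosh]
    exact Real.sinh_nonneg_iff.2 (le_of_lt hx)
  have h := hconv.2 (show |y| / 2 ∈ Ici (0 : ℝ) from div_nonneg (abs_nonneg y) two_pos.le)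
    (show (0 : ℝ) ∈ Ici (0 : ℝ) from Set.mem_Ici.2 le_rfl) (abs_nonneg x) (sub_nonneg.2 hx) (add_sub_cancel |x| 1)
  simp only [smul_eq_mul, mul_zero, add_zero, Real.sinh_zero] at h
  have h2 : |Real.sinh (y * x / 2)| = Real.sinh (|x| * (|y| / 2)) := by
    rw [Real.abs_sinh, abs_div, abs_mul]; congr 1; simp; ring
  rw [← sq_abs (Real.sinh (y * x / 2)), h2, ← sq_abs x]
  have h0 : 0 ≤ Real.sinh (|x| * (|y| / 2)) := Real.sinh_nonneg_iff.2 (by positivity)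
  have := pow_le_pow_left₀ h0 h 2
  rw [mul_pow] at this
  linarith

variable {ρ : Measure ℝ}

lemma symCumulant_mono {s t : ℝ} (h : |s| ≤ |t|) : symCumulant ρ s ≤ symCumulant ρ t := by
  refine lintegral_mono fun z => ?_
  refine ENNReal.ofReal_le_ofReal (mul_le_mul_of_nonneg_left ?_ (by norm_num))
  rw [sq_le_sq, Real.abs_sinh, Real.abs_sinh, Real.sinh_le_sinh, abs_div, abs_div, abs_mul, abs_mul]
  gcongr

lemma symCumulant_abs (y : ℝ) : symCumulant ρ |y| = symCumulant ρ y :=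
  le_antisymm (symCumulant_mono (by simp)) (symCumulant_mono (by simp))

lemma measurable_symCumulant : Measurable (symCumulant ρ) := by
  have h1 : Monotone fun y : ℝ => symCumulant ρ (max y 0) := fun s t hst =>
    symCumulant_mono (by
      rw [abs_of_nonneg (le_max_right _ _), abs_of_nonneg (le_max_right _ _)]
      exact max_le_max_right 0 hst)
  have h2 : symCumulant ρ = (fun y : ℝ => symCumulant ρ (max y 0)) ∘ fun y => |y| := by
    funext y
    simp [symCumulant_abs]
  rw [h2]
  exact h1.measurable.comp continuous_abs.measurable

lemma symCumulant_add_le {s t : ℝ} (hs : 0 ≤ s) (ht : 0 ≤ t) :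
    symCumulant ρ (s + t) ≤ symCumulant ρ (2 * s) + symCumulant ρ (2 * t) := by
  rcases le_total s t with h | h
  · refine (symCumulant_mono ?_).trans le_add_self
    rw [abs_of_nonneg (by positivity), abs_of_nonneg (by positivity)]; linarith
  · refine (symCumulant_mono ?_).trans le_self_add
    rw [abs_of_nonneg (by positivity), abs_of_nonneg (by positivity)]; linarith

lemma symCumulant_mul_le {θ : ℝ} (hθ : |θ| ≤ 1) (y : ℝ) :
    symCumulant ρ (θ * y) ≤ ENNReal.ofReal (θ ^ 2) * symCumulant ρ y := by
  rw [symCumulant, symCumulant, ← lintegral_const_mul' _ _ ENNReal.ofReal_ne_top]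
  refine lintegral_mono fun z => ?_
  dsimp only
  rw [← ENNReal.ofReal_mul (sq_nonneg _)]
  gcongr 1
  have := exp_neg_abs_sinh θ hθ (y * z)
  rw [show y * z * θ = θ * y * z by ring] at this
  refine this.trans (le_of_eq ?_)
  have h : Real.sinh (|y * z| / 2) ^ 2 = Real.sinh (y * z / 2) ^ 2 := by
    rw [← sq_abs (Real.sinh (y * z / 2)), Real.abs_sinh, abs_div]; simp
  rw [h]; ring

lemma setLIntegral_small_sq (hρ2 : (∫⁻ z, ENNReal.ofReal (trunc z ^ 2) ∂ρ) ≠ ⊤) :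
    (∫⁻ z in {z : ℝ | |z| ≤ 1}, ENNReal.ofReal (z ^ 2) ∂ρ) ≠ ⊤ := by
  refine ne_top_of_le_ne_top hρ2 (le_trans (le_of_eq ?_)
    (setLIntegral_le_lintegral {z : ℝ | |z| ≤ 1} _))
  have hm : MeasurableSet {z : ℝ | |z| ≤ 1} := (isClosed_le continuous_abs continuous_const).measurableSet
  refine setLIntegral_congr_fun hm fun z hz => ?_
  have : max |z| 1 = 1 := max_eq_right hz
  simp [trunc, this]

lemma lintegral_exp_large (hρexp : ∀ l : ℝ,
    (∫⁻ z in {z : ℝ | 1 < |z|}, ENNReal.ofReal (Real.exp (l * z)) ∂ρ) ≠ ⊤) (y : ℝ) :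
    (∫⁻ z in {z : ℝ | 1 < |z|}, ENNReal.ofReal (Real.exp (y * z) + Real.exp (-(y * z))) ∂ρ) ≠ ⊤ := by
  have h1 : Measurable fun z : ℝ => ENNReal.ofReal (Real.exp (y * z)) := by fun_prop
  simp_rw [ENNReal.ofReal_add (Real.exp_nonneg _) (Real.exp_nonneg _)]
  rw [lintegral_add_left h1]
  simp_rw [← neg_mul]
  exact ENNReal.add_ne_top.2 ⟨hρexp y, hρexp (-y)⟩

lemma symCumulant_ne_top (hρ2 : (∫⁻ z, ENNReal.ofReal (trunc z ^ 2) ∂ρ) ≠ ⊤)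
    (hρexp : ∀ l : ℝ, (∫⁻ z in {z : ℝ | 1 < |z|}, ENNReal.ofReal (Real.exp (l * z)) ∂ρ) ≠ ⊤)
    (y : ℝ) : symCumulant ρ y ≠ ⊤ := by
  have hm : MeasurableSet {z : ℝ | |z| ≤ 1} := (isClosed_le continuous_abs continuous_const).measurableSet
  rw [symCumulant, ← lintegral_add_compl _ hm]
  refine ENNReal.add_ne_top.2 ⟨?_, ?_⟩
  · refine ne_top_of_le_ne_top (ENNReal.mul_ne_top ENNReal.ofReal_ne_top
      (setLIntegral_small_sq hρ2)) (?_ : _ ≤ ENNReal.ofReal (4 * Real.sinh (|y| / 2) ^ 2) * _)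
    rw [← lintegral_const_mul' _ _ ENNReal.ofReal_ne_top]
    refine setLIntegral_mono' hm fun z hz => ?_
    rw [← ENNReal.ofReal_mul (by positivity)]
    exact ENNReal.ofReal_le_ofReal (exp_neg_abs_sinh z hz y)
  · have hc : {z : ℝ | |z| ≤ 1}ᶜ = {z : ℝ | 1 < |z|} := by ext; simp
    rw [hc]
    refine ne_top_of_le_ne_top (lintegral_exp_large hρexp y) (lintegral_mono fun z => ?_)
    rw [four_mul_sinh_half_sq]
    gcongr
    linarith

lemma integrable_centred
    (hρ2 : (∫⁻ z, ENNReal.ofReal (trunc z ^ 2) ∂ρ) ≠ ⊤)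
    (hρexp : ∀ l : ℝ, (∫⁻ z in {z : ℝ | 1 < |z|}, ENNReal.ofReal (Real.exp (l * z)) ∂ρ) ≠ ⊤)
    (y : ℝ) : Integrable (fun z => Real.exp (y * z) - 1 - y * z) ρ := by
  refine ⟨by fun_prop, (lintegral_mono fun z => ?_).trans_lt
    (symCumulant_ne_top hρ2 hρexp y).lt_top⟩
  rw [Real.enorm_eq_ofReal (exp_sub_one_sub_nonneg _)]
  exact ENNReal.ofReal_le_ofReal (exp_sub_one_sub_le _)

lemma integrable_sub_trunc
    (hρexp : ∀ l : ℝ, (∫⁻ z in {z : ℝ | 1 < |z|}, ENNReal.ofReal (Real.exp (l * z)) ∂ρ) ≠ ⊤) :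
    Integrable (fun z => z - trunc z) ρ := by
  have hm : MeasurableSet {z : ℝ | 1 < |z|} := (isOpen_lt continuous_const continuous_abs).measurableSet
  have hmeas : Measurable fun z : ℝ => z - trunc z := by
    unfold trunc
    have : Measurable fun z : ℝ => |z| := continuous_abs.measurable
    fun_prop
  refine ⟨hmeas.aestronglyMeasurable, lt_of_le_of_lt ?_ (lintegral_exp_large hρexp 1).lt_top⟩
  rw [← lintegral_indicator hm]
  refine lintegral_mono fun z => ?_
  by_cases hz : 1 < |z|
  · rw [indicator_of_mem (show z ∈ {z : ℝ | 1 < |z|} from hz), Real.enorm_eq_ofReal_abs]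
    gcongr
    have hmax : max |z| 1 = |z| := max_eq_left hz.le
    have h0 : |z| ≠ 0 := by positivity
    have h1 : z - trunc z = z * (1 - 1 / |z|) := by rw [trunc, hmax]; field_simp
    have h2 : 0 ≤ 1 - 1 / |z| := by rw [sub_nonneg, div_le_one (by positivity)]; exact hz.le
    have h3 : 1 - 1 / |z| ≤ 1 := by have : 0 ≤ 1 / |z| := by positivity
                                    linarith
    dsimp only
    rw [h1, abs_mul, abs_of_nonneg h2]
    have h4 : |z| ≤ Real.exp (1 * z) + Real.exp (-(1 * z)) := by
      rw [one_mul]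
      have e1 := Real.add_one_le_exp z
      have e2 := Real.add_one_le_exp (-z)
      rw [abs_le]
      constructor <;> linarith [Real.exp_pos z, Real.exp_pos (-z)]
    nlinarith [abs_nonneg z]
  · have hmax : max |z| 1 = 1 := max_eq_right (not_lt.1 hz)
    simp [trunc, hmax]

lemma cumulant_eq
    (hρ2 : (∫⁻ z, ENNReal.ofReal (trunc z ^ 2) ∂ρ) ≠ ⊤)
    (hρexp : ∀ l : ℝ, (∫⁻ z in {z : ℝ | 1 < |z|}, ENNReal.ofReal (Real.exp (l * z)) ∂ρ) ≠ ⊤)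
    (y : ℝ) : cumulant ρ y = centredCumulant ρ y + y * ∫ z, (z - trunc z) ∂ρ := by
  rw [cumulant, centredCumulant, ← integral_const_mul,
    ← integral_add (integrable_centred hρ2 hρexp y) ((integrable_sub_trunc hρexp).const_mul y)]
  congr 1
  funext z
  ring

lemma centredCumulant_nonneg (y : ℝ) : 0 ≤ centredCumulant ρ y :=
  integral_nonneg fun _ => exp_sub_one_sub_nonneg _

lemma ofReal_centredCumulant
    (hρ2 : (∫⁻ z, ENNReal.ofReal (trunc z ^ 2) ∂ρ) ≠ ⊤)
    (hρexp : ∀ l : ℝ, (∫⁻ z in {z : ℝ | 1 < |z|}, ENNReal.ofReal (Real.exp (l * z)) ∂ρ) ≠ ⊤)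
    (y : ℝ) : ENNReal.ofReal (centredCumulant ρ y) =
      ∫⁻ z, ENNReal.ofReal (Real.exp (y * z) - 1 - y * z) ∂ρ :=
  ofReal_integral_eq_lintegral_ofReal (integrable_centred hρ2 hρexp y)
    (ae_of_all _ fun _ => exp_sub_one_sub_nonneg _)

lemma ofReal_centredCumulant_le
    (hρ2 : (∫⁻ z, ENNReal.ofReal (trunc z ^ 2) ∂ρ) ≠ ⊤)
    (hρexp : ∀ l : ℝ, (∫⁻ z in {z : ℝ | 1 < |z|}, ENNReal.ofReal (Real.exp (l * z)) ∂ρ) ≠ ⊤)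
    (y : ℝ) : ENNReal.ofReal (centredCumulant ρ y) ≤ symCumulant ρ y := by
  rw [ofReal_centredCumulant hρ2 hρexp]
  exact lintegral_mono fun z => ENNReal.ofReal_le_ofReal (exp_sub_one_sub_le _)

lemma symCumulant_eq
    (hρ2 : (∫⁻ z, ENNReal.ofReal (trunc z ^ 2) ∂ρ) ≠ ⊤)
    (hρexp : ∀ l : ℝ, (∫⁻ z in {z : ℝ | 1 < |z|}, ENNReal.ofReal (Real.exp (l * z)) ∂ρ) ≠ ⊤)
    (y : ℝ) : symCumulant ρ y =
      ENNReal.ofReal (centredCumulant ρ y) + ENNReal.ofReal (centredCumulant ρ (-y)) := by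
  rw [ofReal_centredCumulant hρ2 hρexp, ofReal_centredCumulant hρ2 hρexp,
    ← lintegral_add_left (by fun_prop), symCumulant]
  refine lintegral_congr fun z => ?_
  rw [← ENNReal.ofReal_add (exp_sub_one_sub_nonneg _) (exp_sub_one_sub_nonneg _),
    four_mul_sinh_half_sq]
  congr 1
  rw [neg_mul]
  ring

lemma convexOn_centredCumulant
    (hρ2 : (∫⁻ z, ENNReal.ofReal (trunc z ^ 2) ∂ρ) ≠ ⊤)
    (hρexp : ∀ l : ℝ, (∫⁻ z in {z : ℝ | 1 < |z|}, ENNReal.ofReal (Real.exp (l * z)) ∂ρ) ≠ ⊤) :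
    ConvexOn ℝ univ (centredCumulant ρ) := by
  refine ⟨convex_univ, fun x _ y _ a b ha hb hab => ?_⟩
  simp only [smul_eq_mul]
  rw [centredCumulant, centredCumulant, centredCumulant, ← integral_const_mul, ← integral_const_mul,
    ← integral_add ((integrable_centred hρ2 hρexp x).const_mul a)
      ((integrable_centred hρ2 hρexp y).const_mul b)]
  refine integral_mono (integrable_centred hρ2 hρexp _)
    (((integrable_centred hρ2 hρexp x).const_mul a).add
      ((integrable_centred hρ2 hρexp y).const_mul b)) fun z => ?_
  have := convexOn_exp.2 (mem_univ (x * z)) (mem_univ (y * z)) ha hb hab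
  simp only [smul_eq_mul] at this
  dsimp only
  rw [show (a * x + b * y) * z = a * (x * z) + b * (y * z) by ring]
  have hb' : b = 1 - a := by linarith
  subst hb'
  linarith

lemma continuous_centredCumulant
    (hρ2 : (∫⁻ z, ENNReal.ofReal (trunc z ^ 2) ∂ρ) ≠ ⊤)
    (hρexp : ∀ l : ℝ, (∫⁻ z in {z : ℝ | 1 < |z|}, ENNReal.ofReal (Real.exp (l * z)) ∂ρ) ≠ ⊤) :
    Continuous (centredCumulant ρ) :=
  continuousOn_univ.1 ((convexOn_centredCumulant hρ2 hρexp).continuousOn isOpen_univ)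

lemma centredCumulant_zero : centredCumulant ρ 0 = 0 := by simp [centredCumulant]

/-- The growth bound on the cumulant encoded in the integrability of `exp(-k₀ ḡ^δ)`. -/
lemma exists_symCumulant_le
    (hρ2 : (∫⁻ z, ENNReal.ofReal (trunc z ^ 2) ∂ρ) ≠ ⊤)
    (hρexp : ∀ l : ℝ, (∫⁻ z in {z : ℝ | 1 < |z|}, ENNReal.ofReal (Real.exp (l * z)) ∂ρ) ≠ ⊤)
    (hd : ∫ z, (z - trunc z) ∂ρ = 0) {δ k₀ : ℝ} (hδ : 0 ≤ δ) (hk₀ : 0 < k₀)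
    (hg : (∫⁻ t in Set.Ioi (0:ℝ), ENNReal.ofReal (Real.exp (-k₀ * gbar ρ t ^ δ))) ≠ ⊤) :
    ∃ C > (0 : ℝ), ∀ y : ℝ, symCumulant ρ y ≤ ENNReal.ofReal (C * Real.exp (k₀ * |y| ^ δ)) := by
  have hcum : ∀ y, cumulant ρ y = centredCumulant ρ y := fun y => by
    rw [cumulant_eq hρ2 hρexp, hd, mul_zero, add_zero]
  set I := ∫⁻ t in Set.Ioi (0:ℝ), ENNReal.ofReal (Real.exp (-k₀ * gbar ρ t ^ δ)) with hI
  have key : ∀ y : ℝ, centredCumulant ρ y ≤ I.toReal * Real.exp (k₀ * |y| ^ δ) := by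
    intro y
    have hgb : ∀ t ∈ Ioc 0 (centredCumulant ρ y), gbar ρ t ≤ |y| := by
      intro t ht
      have hiv : t ∈ centredCumulant ρ '' uIcc 0 y := by
        have h := intermediate_value_uIcc (a := 0) (b := y)
          (continuous_centredCumulant hρ2 hρexp).continuousOn
        apply h
        rw [centredCumulant_zero, uIcc_of_le (centredCumulant_nonneg y)]
        exact mem_Icc.2 ⟨(mem_Ioc.1 ht).1.le, (mem_Ioc.1 ht).2⟩
      obtain ⟨s, hs, hst⟩ := hiv
      have hmem : |s| ∈ {y : ℝ | ∃ s : ℝ, |s| = y ∧ cumulant ρ s = t} := ⟨s, rfl, (hcum s).trans hst⟩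
      have hbdd : BddBelow {y : ℝ | ∃ s : ℝ, |s| = y ∧ cumulant ρ s = t} :=
        ⟨0, by rintro _ ⟨s, rfl, -⟩; exact abs_nonneg s⟩
      refine (csInf_le hbdd hmem).trans ?_
      simpa using abs_sub_left_of_mem_uIcc hs
    have h1 : ENNReal.ofReal (Real.exp (-k₀ * |y| ^ δ)) * ENNReal.ofReal (centredCumulant ρ y) ≤ I := by
      calc _ = ∫⁻ t in Ioc 0 (centredCumulant ρ y), ENNReal.ofReal (Real.exp (-k₀ * |y| ^ δ)) := by
            simp
        _ ≤ ∫⁻ t in Ioc 0 (centredCumulant ρ y), ENNReal.ofReal (Real.exp (-k₀ * gbar ρ t ^ δ)) := by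
            refine setLIntegral_mono' measurableSet_Ioc fun t ht => ?_
            gcongr 2
            rw [neg_mul, neg_mul, neg_le_neg_iff]
            gcongr
            · refine Real.sInf_nonneg ?_
              rintro _ ⟨s, rfl, -⟩; exact abs_nonneg s
            · exact hgb t ht
        _ ≤ I := lintegral_mono_set fun t ht => ht.1
    rw [← ENNReal.ofReal_mul (Real.exp_nonneg _)] at h1
    have h2 := ENNReal.toReal_mono hg h1
    rw [ENNReal.toReal_ofReal (mul_nonneg (Real.exp_nonneg _) (centredCumulant_nonneg y)),
      neg_mul, Real.exp_neg] at h2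
    rw [inv_mul_le_iff₀ (Real.exp_pos _)] at h2
    linarith
  refine ⟨2 * I.toReal + 1, by positivity, fun y => ?_⟩
  rw [symCumulant_eq hρ2 hρexp, ← ENNReal.ofReal_add (centredCumulant_nonneg _)
    (centredCumulant_nonneg _)]
  gcongr
  have h1 := key y
  have h2 := key (-y)
  rw [abs_neg] at h2
  have h3 := Real.exp_pos (k₀ * |y| ^ δ)
  nlinarith

/-- A lower bound on the cumulant. -/
lemma exists_le_centredCumulant
    (hρ2 : (∫⁻ z, ENNReal.ofReal (trunc z ^ 2) ∂ρ) ≠ ⊤)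
    (hρexp : ∀ l : ℝ, (∫⁻ z in {z : ℝ | 1 < |z|}, ENNReal.ofReal (Real.exp (l * z)) ∂ρ) ≠ ⊤)
    (hρ0 : ρ {0} = 0) (hρ : ρ ≠ 0) :
    ∃ c > (0 : ℝ), ∀ y : ℝ, 0 ≤ y → c * min (y ^ 2) y ≤ centredCumulant ρ y := by
  have hnn : ∀ z : ℝ, 0 ≤ min (z ^ 2) |z| / 4 := fun z => by positivity
  have hmeas : Measurable fun z : ℝ => min (z ^ 2) |z| / 4 := by
    have : Measurable fun z : ℝ => |z| := continuous_abs.measurable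
    fun_prop
  have hintg : Integrable (fun z : ℝ => min (z ^ 2) |z| / 4) ρ := by
    refine (integrable_centred hρ2 hρexp 1).mono' hmeas.aestronglyMeasurable
      (ae_of_all _ fun z => ?_)
    rw [Real.norm_of_nonneg (hnn z), one_mul]
    exact min_sq_abs_le_exp z
  refine ⟨∫ z, min (z ^ 2) |z| / 4 ∂ρ, ?_, fun y hy => ?_⟩
  · rw [gt_iff_lt, integral_pos_iff_support_of_nonneg hnn hintg]
    have hs : Function.support (fun z : ℝ => min (z ^ 2) |z| / 4) = {0}ᶜ := by
      ext z
      simp only [Function.mem_support, mem_compl_iff, mem_singleton_iff]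
      constructor
      · rintro h rfl; simp at h
      · intro h
        have : 0 < min (z ^ 2) |z| := lt_min (by positivity) (by positivity)
        positivity
    rw [hs, pos_iff_ne_zero]
    intro h
    refine hρ (Measure.measure_univ_eq_zero.1 ?_)
    rw [← union_compl_self ({0} : Set ℝ)]
    exact measure_union_null hρ0 h
  · rw [mul_comm, ← integral_const_mul, centredCumulant]
    refine integral_mono (hintg.const_mul _) (integrable_centred hρ2 hρexp y) fun z => ?_
    refine le_trans ?_ (min_sq_abs_le_exp (y * z))
    dsimp only
    rw [← mul_div_assoc]
    gcongr
    refine le_min ?_ ?_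
    · rw [mul_pow]
      exact mul_le_mul (min_le_left _ _) (min_le_left _ _) (by positivity) (by positivity)
    · rw [abs_mul, abs_of_nonneg hy]
      exact mul_le_mul (min_le_right _ _) (min_le_right _ _) (by positivity) (by positivity)

lemma ne_zero_of_gbar {δ k₀ : ℝ}
    (hδ : 0 < δ) (hg : (∫⁻ t in Set.Ioi (0:ℝ), ENNReal.ofReal (Real.exp (-k₀ * gbar ρ t ^ δ))) ≠ ⊤) :
    ρ ≠ 0 := by
  rintro rfl
  refine hg ?_
  rw [setLIntegral_congr_fun (g := fun _ => 1) measurableSet_Ioi]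
  · simp
  · intro t ht
    have : gbar 0 t = 0 := by
      have h : {y : ℝ | ∃ s : ℝ, |s| = y ∧ cumulant 0 s = t} = ∅ := by
        ext y
        simp only [cumulant, integral_zero_measure, mem_empty_iff_false, iff_false]
        rintro ⟨s, -, h⟩
        exact absurd h (ne_of_lt ht)
      rw [gbar, h, Real.sInf_empty]
    simp [this, Real.zero_rpow hδ.ne']

end Cumulant

section Centring

variable {Ω : Type*} [MeasurableSpace Ω] {P : Measure Ω} [IsProbabilityMeasure P]
  {E : Type*} [MeasurableSpace E] {π : Measure E} {ρ : Measure ℝ}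

/-- Centring of the process forces centring of the Lévy measure, unless the process vanishes. -/
lemma centring_dichotomy
    (hρ2 : (∫⁻ z, ENNReal.ofReal (trunc z ^ 2) ∂ρ) ≠ ⊤)
    (hρexp : ∀ l : ℝ, (∫⁻ z in {z : ℝ | 1 < |z|}, ENNReal.ofReal (Real.exp (l * z)) ∂ρ) ≠ ⊤)
    {f : E → ℝ} (hfint : Integrable f π) (hcf : (∫ x, f x ∂π) ≠ 0)
    {X : ℤ → Ω → ℝ}
    (hX : ∀ i c, ∫ ω, Real.exp (c * X i ω) ∂P = Real.exp (∫ x, cumulant ρ (c * f x) ∂π))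
    (hmean : ∫ ω, X 0 ω ∂P = 0) :
    ∫ z, (z - trunc z) ∂ρ = 0 ∨ ∀ i, X i =ᵐ[P] 0 := by
  have hintg : ∀ i c, Integrable (fun ω => Real.exp (c * X i ω)) P := by
    intro i c
    by_contra h
    have := hX i c
    rw [integral_undef h] at this
    exact (Real.exp_pos _).ne this
  have hset : ∀ i, (0 : ℝ) ∈ interior (integrableExpSet (X i) P) := by
    intro i
    have : integrableExpSet (X i) P = univ := eq_univ_of_forall fun c => hintg i c
    simp [this]
  have hmgf : ∀ i c, mgf (X i) P c = Real.exp (∫ x, cumulant ρ (c * f x) ∂π) := hX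
  have hder : ∀ i, HasDerivAt (mgf (X i) P) (∫ ω, X i ω ∂P) 0 := by
    intro i
    have := hasDerivAt_mgf (hset i)
    simpa using this
  have hcum0 : cumulant ρ 0 = 0 := by simp [cumulant]
  by_cases hall : ∀ c : ℝ, Integrable (fun x => cumulant ρ (c * f x)) π
  · left
    set d := ∫ z, (z - trunc z) ∂ρ with hd
    set cf := ∫ x, f x ∂π with hcf'
    have hle : ∀ c, Real.exp (c * (d * cf)) ≤ mgf (X 0) P c := by
      intro c
      rw [hmgf]
      gcongr
      have h1 : ∀ x, cumulant ρ (c * f x) = centredCumulant ρ (c * f x) + c * d * f x := fun x => by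
        rw [cumulant_eq hρ2 hρexp]; ring
      have h2 : Integrable (fun x => c * d * f x) π := hfint.const_mul _
      calc c * (d * cf) = ∫ x, c * d * f x ∂π := by rw [integral_const_mul]; ring
        _ ≤ _ := integral_mono h2 (hall c) fun x => by
          rw [h1]; linarith [centredCumulant_nonneg (ρ := ρ) (c * f x)]
    have hmin : IsLocalMin (fun c => mgf (X 0) P c - Real.exp (c * (d * cf))) 0 := by
      refine Eventually.of_forall fun c => ?_
      have h0 : mgf (X 0) P 0 - Real.exp (0 * (d * cf)) = 0 := by rw [hmgf]; simp [hcum0]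
      dsimp only
      rw [h0]
      linarith [hle c]
    have hd1 : HasDerivAt (fun c : ℝ => Real.exp (c * (d * cf))) (d * cf) 0 := by
      have := ((hasDerivAt_id (0 : ℝ)).mul_const (d * cf)).exp
      simpa using this
    have h2 := hmin.hasDerivAt_eq_zero ((hder 0).sub hd1)
    rw [hmean, zero_sub, neg_eq_zero, mul_eq_zero] at h2
    exact h2.resolve_right hcf
  · right
    push Not at hall
    obtain ⟨c, hc⟩ := hall
    have hc0 : c ≠ 0 := by
      rintro rfl
      simp [hcum0] at hc
    intro i
    have hmi : ∫ ω, X i ω ∂P = 0 := by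
      rw [← hmean]
      have : mgf (X i) P = mgf (X 0) P := funext fun c => by rw [hmgf, hmgf]
      have h1 := hder i
      rw [this] at h1
      exact h1.unique (hder 0)
    have hXi : Integrable (X i) P := integrable_of_mem_interior_integrableExpSet (hset i)
    have h1 : ∫ ω, (Real.exp (c * X i ω) - 1 - c * X i ω) ∂P = 0 := by
      have h2 : Integrable (fun ω => Real.exp (c * X i ω) - 1) P :=
        (hintg i c).sub (integrable_const 1)
      rw [integral_sub h2 (hXi.const_mul c),
        integral_sub (hintg i c) (integrable_const 1), integral_const_mul, hmi, hX,
        integral_undef hc]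
      simp
    have h2 := (integral_eq_zero_iff_of_nonneg (fun ω => exp_sub_one_sub_nonneg (c * X i ω))
      (((hintg i c).sub (integrable_const 1)).sub (hXi.const_mul c))).1 h1
    filter_upwards [h2] with ω hω
    have h3 := min_sq_abs_le_exp (c * X i ω)
    simp only [Pi.zero_apply] at hω ⊢
    rw [hω] at h3
    by_contra hne
    have : 0 < min ((c * X i ω) ^ 2) |c * X i ω| := lt_min (by positivity) (by positivity)
    linarith

end Centring

lemma measure_ge_le_exp_mul_lintegral {Ω : Type*} [MeasurableSpace Ω] (P : Measure Ω) {S : Ω → ℝ}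
    (hS : Measurable S) {μ : ℝ} (hμ : 0 ≤ μ) (z : ℝ) :
    P {ω | z ≤ S ω} ≤ ENNReal.ofReal (Real.exp (-(μ * z))) *
      ∫⁻ ω, ENNReal.ofReal (Real.exp (μ * S ω)) ∂P := by
  rw [← lintegral_const_mul' _ _ ENNReal.ofReal_ne_top,
    ← lintegral_indicator_one (measurableSet_le measurable_const hS)]
  refine lintegral_mono fun ω => ?_
  by_cases hω : z ≤ S ω
  swap
  · rw [indicator_of_notMem (by exact hω)]; exact zero_le
  rw [indicator_of_mem (by exact hω), ← ENNReal.ofReal_mul (Real.exp_nonneg _), ← Real.exp_add, Pi.one_apply, ENNReal.one_le_ofReal,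
    Real.one_le_exp_iff]
  nlinarith [mul_le_mul_of_nonneg_left hω hμ]

lemma exp_le_exp_one_mul_exp_rpow {δ : ℝ} (hδ : 1 ≤ δ) {y : ℝ} (hy : 0 ≤ y) :
    Real.exp y ≤ Real.exp 1 * Real.exp (y ^ δ) := by
  rw [← Real.exp_add]
  refine Real.exp_le_exp.2 ?_
  rcases le_total y 1 with h | h
  · linarith [Real.rpow_nonneg hy δ]
  · linarith [Real.self_le_rpow_of_one_le h hδ]

lemma exp_mul_le_one_add {s y : ℝ} (hs0 : 0 ≤ s) (hs1 : s ≤ 1) :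
    Real.exp (s * y) ≤ 1 + s * Real.exp y := by
  have := convexOn_exp.2 (mem_univ y) (mem_univ (0 : ℝ)) hs0 (sub_nonneg.2 hs1) (by ring)
  simp only [smul_eq_mul, mul_zero, add_zero, Real.exp_zero, mul_one] at this
  linarith

section CycleMoments

variable {E : Type*} [MeasurableSpace E] {κ : Kernel E E} {Pm : E → Measure (ℕ → E)}

lemma lintegral_exp_cycleSum_le (h : IsChainLaw κ Pm) {a : Set E} (ha : MeasurableSet a)
    {f : E → ℝ} (hf : Measurable f) {δ l C : ℝ} (hδ : 1 ≤ δ) (hl : 0 < l)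
    {x : E} (hx : ∫⁻ ω, ENNReal.ofReal (Real.exp ((l * cycleSum a f ω) ^ δ)) ∂(Pm x)
      ≤ ENNReal.ofReal C)
    {μ : ℝ} (hμ : 0 ≤ μ) (hμl : μ ≤ l) :
    ∫⁻ ω, ENNReal.ofReal (Real.exp (μ * cycleSum a f ω)) ∂(Pm x) ≤
      1 + ENNReal.ofReal (μ / l * (Real.exp 1 * C)) := by
  have := h.prob x
  have hm := measurable_cycleSum ha hf
  calc _ ≤ ∫⁻ ω, (1 + ENNReal.ofReal (μ / l * Real.exp 1) *
        ENNReal.ofReal (Real.exp ((l * cycleSum a f ω) ^ δ))) ∂(Pm x) := by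
        refine lintegral_mono fun ω => ?_
        dsimp only
        rw [← ENNReal.ofReal_mul (by positivity), ← ENNReal.ofReal_one,
          ← ENNReal.ofReal_add zero_le_one (by positivity)]
        refine ENNReal.ofReal_le_ofReal ?_
        have h1 := exp_mul_le_one_add (y := l * cycleSum a f ω) (div_nonneg hμ hl.le)
          ((div_le_one hl).2 hμl)
        rw [← mul_assoc, div_mul_cancel₀ _ hl.ne'] at h1
        refine h1.trans ?_
        rw [mul_assoc]
        gcongr
        exact exp_le_exp_one_mul_exp_rpow hδ (mul_nonneg hl.le (cycleSum_nonneg _ _ _))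
    _ ≤ _ := by
        rw [lintegral_add_left measurable_const, lintegral_const, measure_univ, mul_one,
          lintegral_const_mul' _ _ ENNReal.ofReal_ne_top]
        gcongr
        rw [← mul_assoc (μ / l), ENNReal.ofReal_mul (p := μ / l * Real.exp 1) (by positivity)]
        gcongr

/-- A renewal-type condition for the exponential moment at scale `n / θ`. -/
lemma lintegral_exp_cycleSum_sub_le_one (h : IsChainLaw κ Pm) {a : Set E} (ha : MeasurableSet a)
    {f : E → ℝ} (hf : Measurable f) {μ θ K : ℝ} (hθ : 1 ≤ θ) {n : ℕ} (hn : 1 ≤ n) (x : E)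
    (hfin : ∀ᵐ ω ∂(Pm x), hitT a ω ≠ ⊤)
    (hK : ∫⁻ ω, ENNReal.ofReal (Real.exp (2 * μ * cycleSum a f ω)) ∂(Pm x) ≤ 1 + ENNReal.ofReal K)
    (hKT : ENNReal.ofReal K ≤ ENNReal.ofReal (1 - Real.exp (-2)) *
      Pm x {ω | ((⌊(n : ℝ) / θ⌋₊ : ℕ) : ℕ∞) < hitT a ω}) :
    ∫⁻ ω, ENNReal.ofReal (Real.exp (μ * cycleSum a f ω -
      θ / n * min ((hitT a ω).toNat : ℝ) n)) ∂(Pm x) ≤ 1 := by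
  have := h.prob x
  have hn0 : (0 : ℝ) < n := by exact_mod_cast hn
  have hθ0 : 0 < θ := by linarith
  set A := {ω : ℕ → E | ((⌊(n : ℝ) / θ⌋₊ : ℕ) : ℕ∞) < hitT a ω} with hA
  have hAm : MeasurableSet A := measurableSet_lt_hitT ha _
  have hcm := measurable_cycleSum ha hf
  have hTm := measurable_hitT_toNat ha
  set e : ℝ := 1 - Real.exp (-2)
  have he : 0 ≤ e := by
    simp only [e, sub_nonneg, Real.exp_le_one_iff]; norm_num
  have hb : ∫⁻ ω, ENNReal.ofReal (Real.exp (-2 * (θ / n * min ((hitT a ω).toNat : ℝ) n))) ∂(Pm x) +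
      ENNReal.ofReal e * Pm x A ≤ 1 := by
    rw [← lintegral_indicator_const hAm, ← lintegral_add_left (by fun_prop)]
    calc _ ≤ ∫⁻ ω, 1 ∂(Pm x) := by
          refine lintegral_mono_ae ?_
          filter_upwards [hfin] with ω hω
          by_cases hωA : ω ∈ A
          · rw [indicator_of_mem hωA, ← ENNReal.ofReal_add (Real.exp_nonneg _) he, ← ENNReal.ofReal_one]
            refine ENNReal.ofReal_le_ofReal ?_
            have h1 : (n : ℝ) / θ ≤ min ((hitT a ω).toNat : ℝ) n := by
              refine le_min ?_ (div_le_self hn0.le hθ)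
              have h2 : ⌊(n : ℝ) / θ⌋₊ < (hitT a ω).toNat := by
                have h3 : ((⌊(n : ℝ) / θ⌋₊ : ℕ) : ℕ∞) < hitT a ω := hωA
                rw [← ENat.natCast_toNat hω] at h3
                exact_mod_cast h3
              exact (Nat.lt_of_floor_lt h2).le
            have h4 : 1 ≤ θ / n * min ((hitT a ω).toNat : ℝ) n := by
              calc 1 = θ / n * (n / θ) := by field_simp
                _ ≤ _ := by gcongr
            have h5 : Real.exp (-2 * (θ / n * min ((hitT a ω).toNat : ℝ) n)) ≤ Real.exp (-2) :=
              Real.exp_le_exp.2 (by linarith)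
            simp only [e]
            linarith
          · rw [indicator_of_notMem hωA, add_zero, ← ENNReal.ofReal_one]
            refine ENNReal.ofReal_le_ofReal (Real.exp_le_one_iff.2 ?_)
            have : 0 ≤ θ / n * min ((hitT a ω).toNat : ℝ) n := by positivity
            linarith
      _ = 1 := by simp
  have h2 : 2 * ∫⁻ ω, ENNReal.ofReal (Real.exp (μ * cycleSum a f ω -
      θ / n * min ((hitT a ω).toNat : ℝ) n)) ∂(Pm x) ≤ 2 := by
    calc _ ≤ ∫⁻ ω, (ENNReal.ofReal (Real.exp (2 * μ * cycleSum a f ω)) +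
          ENNReal.ofReal (Real.exp (-2 * (θ / n * min ((hitT a ω).toNat : ℝ) n)))) ∂(Pm x) := by
          rw [← lintegral_const_mul' _ _ (by simp)]
          refine lintegral_mono fun ω => ?_
          dsimp only
          rw [← ENNReal.ofReal_add (Real.exp_nonneg _) (Real.exp_nonneg _),
            show (2 : ℝ≥0∞) = ENNReal.ofReal 2 by simp, ← ENNReal.ofReal_mul (by norm_num)]
          refine ENNReal.ofReal_le_ofReal ?_
          set u := μ * cycleSum a f ω
          set v := θ / n * min ((hitT a ω).toNat : ℝ) n
          have h1 : Real.exp (u - v) = Real.exp u * Real.exp (-v) := by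
            rw [← Real.exp_add, sub_eq_add_neg]
          have h2 : Real.exp (2 * μ * cycleSum a f ω) = Real.exp u ^ 2 := by
            rw [← Real.exp_nat_mul]; congr 1; simp only [u]; push_cast; ring
          have h3 : Real.exp (-2 * v) = Real.exp (-v) ^ 2 := by
            rw [← Real.exp_nat_mul]; congr 1; push_cast; ring
          rw [h1, h2, h3]
          nlinarith [sq_nonneg (Real.exp u - Real.exp (-v))]
      _ ≤ (1 + ENNReal.ofReal K) +
          ∫⁻ ω, ENNReal.ofReal (Real.exp (-2 * (θ / n * min ((hitT a ω).toNat : ℝ) n))) ∂(Pm x) := by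
          rw [lintegral_add_left (by fun_prop)]
          gcongr
      _ ≤ 1 + (∫⁻ ω, ENNReal.ofReal (Real.exp (-2 * (θ / n * min ((hitT a ω).toNat : ℝ) n))) ∂(Pm x)
          + ENNReal.ofReal e * Pm x A) := by
          rw [add_assoc, add_comm (ENNReal.ofReal K)]
          gcongr
      _ ≤ 1 + 1 := by gcongr
      _ = 2 := one_add_one_eq_two
  have h3 := (ENNReal.mul_le_mul_iff_right (a := 2) (by simp) (by simp)).1 (h2.trans_eq (mul_one 2).symm)
  exact h3

/-- Tail bound of Weibull type for `|f(Z_1)| + ⋯ + |f(Z_n)|` at distances of order at least `n`. -/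
lemma measure_absSum_ge_le_far (h : IsChainLaw κ Pm) [IsMarkovKernel κ] {a : Set E}
    (ha : MeasurableSet a) (hatom : ∀ x ∈ a, ∀ y ∈ a, κ x = κ y) {xa : E} (hxa : xa ∈ a)
    (hfin : ∀ x, ∀ᵐ ω ∂(Pm x), hitT a ω ≠ ⊤)
    {f : E → ℝ} (hf : Measurable f) {δ l C : ℝ} (hδ : 1 ≤ δ) (hl : 0 < l) (hC : 1 ≤ C)
    (hx : ∀ x, ∫⁻ ω, ENNReal.ofReal (Real.exp ((l * cycleSum a f ω) ^ δ)) ∂(Pm x)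
      ≤ ENNReal.ofReal C) {n : ℕ} (hn : 1 ≤ n) {v : ℝ} (hv : 0 < v)
    (hvC : Real.log C ≤ (l * v) ^ δ) (x : E) :
    Pm x {ω | 8 * n * v ≤ absSum f n ω} ≤ ENNReal.ofReal (Real.exp (-(2 * n * (l * v) ^ δ))) := by
  set w := (l * v) ^ δ with hw
  have hw0 : 0 ≤ w := by positivity
  set μ := w / v with hμ
  have hμ0 : 0 ≤ μ := by positivity
  have hn1 : (1 : ℝ) ≤ n := by exact_mod_cast hn
  have hlogC : 0 ≤ Real.log C := Real.log_nonneg hC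
  have hpt : ∀ ω, μ * cycleSum a f ω ≤ (l * cycleSum a f ω) ^ δ + w := by
    intro ω
    set ξ := cycleSum a f ω with hξ
    have hξ0 : 0 ≤ ξ := cycleSum_nonneg _ _ _
    rcases le_total ξ v with hv' | hv'
    · have : μ * ξ ≤ μ * v := by gcongr
      rw [hμ, div_mul_cancel₀ _ hv.ne'] at this
      have h2 : 0 ≤ (l * ξ) ^ δ := by positivity
      rw [hμ]; linarith
    · have hr : 1 ≤ ξ / v := (one_le_div hv).2 hv'
      have h1 : (l * ξ) ^ δ = (ξ / v) ^ δ * w := by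
        rw [hw, ← Real.mul_rpow (by positivity) (by positivity)]; congr 1; field_simp
      have h2 : ξ / v * w ≤ (ξ / v) ^ δ * w := by
        gcongr; exact Real.self_le_rpow_of_one_le hr hδ
      rw [h1, hμ]
      calc w / v * ξ = ξ / v * w := by ring
        _ ≤ _ := by linarith
  set τ := w + Real.log C with hτ
  have hexp : ∀ x, ∫⁻ ω, ENNReal.ofReal (Real.exp (μ * cycleSum a f ω)) ∂(Pm x) ≤
      ENNReal.ofReal (Real.exp τ) := by
    intro x
    calc _ ≤ ∫⁻ ω, ENNReal.ofReal (Real.exp w) *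
          ENNReal.ofReal (Real.exp ((l * cycleSum a f ω) ^ δ)) ∂(Pm x) := by
          refine lintegral_mono fun ω => ?_
          dsimp only
          rw [← ENNReal.ofReal_mul (Real.exp_nonneg _), ← Real.exp_add, add_comm]
          exact ENNReal.ofReal_le_ofReal (Real.exp_le_exp.2 (hpt ω))
      _ ≤ ENNReal.ofReal (Real.exp w) * ENNReal.ofReal C := by
          rw [lintegral_const_mul' _ _ ENNReal.ofReal_ne_top]
          gcongr
          exact hx x
      _ = _ := by
          rw [← ENNReal.ofReal_mul (Real.exp_nonneg _), hτ, Real.exp_add, Real.exp_log (by linarith)]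
  have hR : ∫⁻ ω, ENNReal.ofReal (Real.exp (μ * cycleSum a f ω -
      τ * min ((hitT a ω).toNat : ℝ) n)) ∂(Pm xa) ≤ 1 := by
    calc _ ≤ ∫⁻ ω, ENNReal.ofReal (Real.exp (-τ)) *
          ENNReal.ofReal (Real.exp (μ * cycleSum a f ω)) ∂(Pm xa) := by
          refine lintegral_mono_ae ?_
          filter_upwards [hfin xa] with ω hω
          rw [← ENNReal.ofReal_mul (Real.exp_nonneg _), ← Real.exp_add]
          refine ENNReal.ofReal_le_ofReal (Real.exp_le_exp.2 ?_)
          have h1 : (1 : ℝ) ≤ (hitT a ω).toNat := by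
            have := one_le_hitT a ω
            rw [← ENat.natCast_toNat hω] at this
            exact_mod_cast this
          have h2 : τ * 1 ≤ τ * min ((hitT a ω).toNat : ℝ) n := by
            have : 0 ≤ τ := by positivity
            gcongr
            exact le_min h1 hn1
          linarith
      _ ≤ ENNReal.ofReal (Real.exp (-τ)) * ENNReal.ofReal (Real.exp τ) := by
          rw [lintegral_const_mul' _ _ ENNReal.ofReal_ne_top]
          gcongr
          exact hexp xa
      _ = 1 := by rw [← ENNReal.ofReal_mul (Real.exp_nonneg _), ← Real.exp_add]; simp
  have hmain := h.lintegral_exp_absSum_le ha hatom hxa hfin hf hμ0 (by positivity : 0 ≤ τ) n hR x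
  refine (measure_ge_le_exp_mul_lintegral (Pm x) (measurable_absSum hf n) hμ0 _).trans ?_
  calc _ ≤ ENNReal.ofReal (Real.exp (-(μ * (8 * n * v)))) * (ENNReal.ofReal (Real.exp (2 * (τ * n))) *
        ENNReal.ofReal (Real.exp τ)) := by
        gcongr
        exact hmain.trans (by gcongr; exact hexp x)
    _ ≤ _ := by
        rw [← ENNReal.ofReal_mul (Real.exp_nonneg _), ← ENNReal.ofReal_mul (Real.exp_nonneg _),
          ← Real.exp_add, ← Real.exp_add]
        refine ENNReal.ofReal_le_ofReal (Real.exp_le_exp.2 ?_)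
        have h1 : μ * (8 * n * v) = 8 * n * w := by rw [hμ]; field_simp
        have h2 : τ ≤ 2 * w := by rw [hτ]; linarith
        have h3 : τ * n ≤ 2 * w * n := by gcongr
        have h4 : 2 * w * 1 ≤ 2 * w * n := by gcongr
        rw [h1]
        nlinarith

/-- Tail bound for `|f(Z_1)| + ⋯ + |f(Z_n)|` coming from the regeneration structure at time scale
`n / θ`. -/
lemma measure_absSum_ge_le_near (h : IsChainLaw κ Pm) [IsMarkovKernel κ] {a : Set E}
    (ha : MeasurableSet a) (hatom : ∀ x ∈ a, ∀ y ∈ a, κ x = κ y) {xa : E} (hxa : xa ∈ a)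
    (hfin : ∀ x, ∀ᵐ ω ∂(Pm x), hitT a ω ≠ ⊤)
    {f : E → ℝ} (hf : Measurable f) {δ l C : ℝ} (hδ : 1 ≤ δ) (hl : 0 < l) (hC : 1 ≤ C)
    (hx : ∀ x, ∫⁻ ω, ENNReal.ofReal (Real.exp ((l * cycleSum a f ω) ^ δ)) ∂(Pm x)
      ≤ ENNReal.ofReal C) {n : ℕ} (hn : 1 ≤ n) {θ μ : ℝ} (hθ : 1 ≤ θ) (hμ : 0 ≤ μ)
    (hμT : ENNReal.ofReal (2 * μ / l * (Real.exp 1 * C)) ≤ ENNReal.ofReal (1 - Real.exp (-2)) *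
      Pm xa {ω | ((⌊(n : ℝ) / θ⌋₊ : ℕ) : ℕ∞) < hitT a ω}) (x : E) (z : ℝ) :
    Pm x {ω | z ≤ absSum f n ω} ≤
      ENNReal.ofReal ((1 + Real.exp 1 * C) * Real.exp (2 * θ - μ * z)) := by
  have := h.prob xa
  have hn0 : (0 : ℝ) < n := by exact_mod_cast hn
  have hμl : 2 * μ ≤ l := by
    have h1 : ENNReal.ofReal (2 * μ / l * (Real.exp 1 * C)) ≤ ENNReal.ofReal 1 := by
      refine hμT.trans ((mul_le_mul' (ENNReal.ofReal_le_ofReal (sub_le_self 1 (Real.exp_nonneg _)))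
        prob_le_one).trans_eq (mul_one _))
    rw [ENNReal.ofReal_le_ofReal_iff zero_le_one] at h1
    have h2 : 2 * μ / l * 1 ≤ 2 * μ / l * (Real.exp 1 * C) := by
      gcongr
      have := Real.one_le_exp (zero_le_one (α := ℝ))
      nlinarith
    rw [mul_one] at h2
    exact (div_le_one hl).1 (h2.trans h1)
  have hR := lintegral_exp_cycleSum_sub_le_one h ha hf hθ hn xa (hfin xa)
    (lintegral_exp_cycleSum_le h ha hf hδ hl (hx xa) (by positivity : 0 ≤ 2 * μ) hμl) hμT
  have hmain := h.lintegral_exp_absSum_le ha hatom hxa hfin hf hμ (by positivity) n hR x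
  have hcyc := lintegral_exp_cycleSum_le h ha hf hδ hl (hx x) hμ (by linarith)
  refine (measure_ge_le_exp_mul_lintegral (Pm x) (measurable_absSum hf n) hμ z).trans ?_
  calc _ ≤ ENNReal.ofReal (Real.exp (-(μ * z))) * (ENNReal.ofReal (Real.exp (2 * θ)) *
        ENNReal.ofReal (1 + Real.exp 1 * C)) := by
        gcongr
        refine hmain.trans ?_
        rw [div_mul_cancel₀ _ hn0.ne']
        gcongr
        refine hcyc.trans ?_
        rw [← ENNReal.ofReal_one, ← ENNReal.ofReal_add zero_le_one (by positivity)]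
        have h1 : μ / l ≤ 1 := (div_le_one hl).2 (by linarith)
        exact ENNReal.ofReal_le_ofReal
          (add_le_add_right (mul_le_of_le_one_left (by positivity) h1) _)
    _ = _ := by
        rw [← ENNReal.ofReal_mul (Real.exp_nonneg _), ← ENNReal.ofReal_mul (Real.exp_nonneg _)]
        congr 1
        rw [sub_eq_add_neg, Real.exp_add]
        ring

end CycleMoments

/-- A Markov chain regenerating at the atom `a`, whose return time to `a` has the tail
`q / γ` with `γ` regularly varying of index `α`, and for which the sum of `|f|` over one cycle has a
uniformly bounded stretched exponential moment. -/
structure IsRegenerative {E : Type*} [MeasurableSpace E] (κ : Kernel E E)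
    (Pm : E → Measure (ℕ → E)) (a : Set E) (xa : E) (γ : ℝ → ℝ) (α q : ℝ)
    (f : E → ℝ) (δ l C : ℝ) : Prop where
  law : IsChainLaw κ Pm
  meas_atom : MeasurableSet a
  atom : ∀ x ∈ a, ∀ y ∈ a, κ x = κ y
  mem_atom : xa ∈ a
  hit_ne_top : ∀ x, ∀ᵐ ω ∂(Pm x), hitT a ω ≠ ⊤
  mono : Monotone γ
  pos : ∀ x, 0 < γ x
  regVary : RegVary γ α
  index_pos : 0 < α
  const_pos : 0 < q
  tail : ∀ x ≥ 0, Pm xa {ω | ((⌊x⌋₊ : ℕ) : ℕ∞) < hitT a ω} = ENNReal.ofReal (q / γ x)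
  meas_fun : Measurable f
  one_le_exponent : 1 ≤ δ
  exponent_lt : δ * (1 - α) < 1
  rate_pos : 0 < l
  one_le_bound : 1 ≤ C
  cycle : ∀ x, ∫⁻ ω, ENNReal.ofReal (Real.exp ((l * cycleSum a f ω) ^ δ)) ∂(Pm x)
      ≤ ENNReal.ofReal C

lemma exists_index_lt {δ α : ℝ} (hδ : 1 ≤ δ) (h : δ * (1 - α) < 1) (hα : 0 < α) :
    ∃ s, 0 < s ∧ s < α ∧ δ * (1 - s) < 1 := by
  have h0 : 1 - 1 / δ < α := by
    have : (1 - α) < 1 / δ := by rw [lt_div_iff₀ (by linarith)]; linarith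
    linarith
  obtain ⟨s, hs1, hs2⟩ := exists_between (max_lt hα h0)
  refine ⟨s, (le_max_left _ _).trans_lt hs1, hs2, ?_⟩
  have h1 := (le_max_right 0 (1 - 1 / δ)).trans_lt hs1
  have h2 : 1 - s < 1 / δ := by linarith
  rw [lt_div_iff₀ (by linarith)] at h2
  linarith

lemma exists_add_const_le_rpow {p q A B : ℝ} (hp : 0 ≤ p) (hpq : p < q) (hB : 0 < B) :
    ∃ K : ℝ, 0 ≤ K ∧ ∀ y ≥ (0 : ℝ), A * y ^ p ≤ B * y ^ q + K := by
  have ht : Tendsto (fun y : ℝ => y ^ (q - p)) atTop atTop := tendsto_rpow_atTop (by linarith)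
  obtain ⟨Y, hY⟩ := (ht.eventually_ge_atTop (A / B)).exists_forall_of_atTop
  refine ⟨|A| * (max Y 1) ^ p, by positivity, fun y hy => ?_⟩
  rcases le_total y (max Y 1) with h | h
  · have h1 : A * y ^ p ≤ |A| * (max Y 1) ^ p := by
      have : y ^ p ≤ (max Y 1) ^ p := by gcongr
      calc A * y ^ p ≤ |A| * y ^ p := by gcongr; exact le_abs_self A
        _ ≤ _ := by gcongr
    have : 0 ≤ B * y ^ q := by positivity
    linarith
  · have hy0 : 0 < y := lt_of_lt_of_le (by positivity) h
    have h1 := hY y ((le_max_left _ _).trans h)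
    rw [div_le_iff₀ hB] at h1
    have h2 : y ^ q = y ^ (q - p) * y ^ p := by rw [← Real.rpow_add hy0]; congr 1; ring
    have h3 : 0 ≤ |A| * (max Y 1) ^ p := by positivity
    have h4 : A * y ^ p ≤ (y ^ (q - p) * B) * y ^ p := by gcongr
    rw [h2]
    nlinarith

section RegenerativeChain

variable {E : Type*} [MeasurableSpace E] {κ : Kernel E E} {Pm : E → Measure (ℕ → E)}
  {a : Set E} {xa : E} {γ : ℝ → ℝ} {α q : ℝ} {f : E → ℝ} {δ l C : ℝ}

namespace IsRegenerative

lemma exists_near (h : IsRegenerative κ Pm a xa γ α q f δ l C) [IsMarkovKernel κ] {s : ℝ}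
    (hs0 : 0 < s) (hs1 : s < 1) (hs : s < α) :
    ∃ k > (0 : ℝ), ∃ x₀ > (0 : ℝ), ∃ C' > (0 : ℝ), ∀ n : ℕ, 1 ≤ n → ∀ y ≥ (0 : ℝ),
      (k * y) ^ (1 - s)⁻¹ ≤ n / x₀ → ∀ x,
      Pm x {ω | y * γ n ≤ absSum f n ω} ≤
        ENNReal.ofReal (C' * Real.exp (-(k * y) ^ (1 - s)⁻¹)) := by
  obtain ⟨x₀, hx₀, c, hc, hpot⟩ := RegVary.exists_potter_lower h.mono h.regVary hs0.le hs
  have hC := h.one_le_bound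
  have hl := h.rate_pos
  have hq := h.const_pos
  set M := Real.exp 1 * C with hM
  have hM0 : 0 < M := by positivity
  set K := q * c * l / (4 * M) with hK
  have hK0 : 0 < K := by positivity
  refine ⟨K / 3, by positivity, x₀, hx₀, 1 + M + Real.exp 1, by positivity, fun n hn y hy hle x => ?_⟩
  have := h.law.prob x
  set θ := (K / 3 * y) ^ (1 - s)⁻¹ with hθ
  have hn0 : (0 : ℝ) < n := by exact_mod_cast hn
  have hθ0 : 0 ≤ θ := by positivity
  rcases lt_or_ge θ 1 with hθ1 | hθ1
  · refine prob_le_one.trans ?_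
    rw [ENNReal.one_le_ofReal]
    calc (1 : ℝ) = Real.exp 1 * Real.exp (-1) := by rw [← Real.exp_add]; simp
      _ ≤ _ := by gcongr; linarith
  · have hγ := h.pos n
    set μ := K * θ ^ s / γ n with hμ
    have hμ0 : 0 ≤ μ := by positivity
    have hxn : x₀ ≤ n / θ := by
      rw [le_div_iff₀ (by linarith)]
      rw [le_div_iff₀ hx₀] at hle
      linarith
    have hpp := (hpot _ hxn).2 θ hθ1
    rw [mul_div_cancel₀ _ (by linarith : θ ≠ 0)] at hpp
    have hγθ := h.pos (n / θ)
    refine (measure_absSum_ge_le_near h.law h.meas_atom h.atom h.mem_atom h.hit_ne_top h.meas_fun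
      h.one_le_exponent hl hC h.cycle hn hθ1 hμ0 ?_ x (y * γ n)).trans ?_
    · rw [h.tail _ (by positivity), ← ENNReal.ofReal_mul (by
        rw [sub_nonneg, Real.exp_le_one_iff]; norm_num)]
      refine ENNReal.ofReal_le_ofReal ?_
      have he : 1 / 2 ≤ 1 - Real.exp (-2) := by
        have h1 := Real.add_one_le_exp (2 : ℝ)
        have h2 : Real.exp (-2) ≤ 1 / 2 := by
          rw [Real.exp_neg, inv_eq_one_div]
          exact one_div_le_one_div_of_le (by norm_num) (by linarith)
        linarith
      calc 2 * μ / l * M = 1 / 2 * (q * (c * θ ^ s * γ (n / θ)) / (γ n * γ (n / θ))) := by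
            rw [hμ, hK]; field_simp; norm_num
        _ ≤ 1 / 2 * (q * γ n / (γ n * γ (n / θ))) := by gcongr
        _ = 1 / 2 * (q / γ (n / θ)) := by field_simp
        _ ≤ _ := by gcongr
    · refine ENNReal.ofReal_le_ofReal ?_
      have h1 : μ * (y * γ n) = 3 * θ := by
        have h2 : θ = θ ^ s * θ ^ (1 - s) := by
          rw [← Real.rpow_add (by linarith)]; simp
        have h3 : θ ^ (1 - s) = K / 3 * y := by
          rw [hθ, ← Real.rpow_mul (by positivity), inv_mul_cancel₀ (by linarith), Real.rpow_one]
        rw [h3] at h2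
        calc _ = 3 * (θ ^ s * (K / 3 * y)) := by rw [hμ]; field_simp
          _ = _ := by rw [← h2]
      rw [h1]
      have h4 : 2 * θ - 3 * θ = -θ := by ring
      rw [h4]
      exact mul_le_mul_of_nonneg_right (by linarith [Real.exp_pos 1]) (Real.exp_nonneg _)

lemma exists_rpow_le (h : IsRegenerative κ Pm a xa γ α q f δ l C) {s : ℝ}
    (hs0 : 0 ≤ s) (hs : s < α) :
    ∃ c > (0 : ℝ), ∀ᶠ n : ℕ in atTop, c * (n : ℝ) ^ s ≤ γ n := by
  obtain ⟨x₀, hx₀, c, hc, hpot⟩ := RegVary.exists_potter_lower h.mono h.regVary hs0 hs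
  have hγ := h.pos x₀
  refine ⟨c * γ x₀ / x₀ ^ s, by positivity, ?_⟩
  filter_upwards [tendsto_natCast_atTop_atTop.eventually_ge_atTop x₀] with n hn
  have h1 := (hpot x₀ le_rfl).2 (n / x₀) ((one_le_div hx₀).2 hn)
  rw [div_mul_cancel₀ _ hx₀.ne', Real.div_rpow (by positivity) hx₀.le] at h1
  refine le_trans (le_of_eq ?_) h1
  ring

lemma exists_far (h : IsRegenerative κ Pm a xa γ α q f δ l C) [IsMarkovKernel κ] {s : ℝ}
    (hs0 : 0 < s) (hs1 : s < 1) (hs : s < α) (hδs : δ * (1 - s) < 1) {k x₀ : ℝ} (hk : 0 < k)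
    (hx₀ : 0 < x₀) (L : ℝ) :
    ∀ᶠ n : ℕ in atTop, ∀ y ≥ (0 : ℝ), n / x₀ < (k * y) ^ (1 - s)⁻¹ → ∀ x,
      Pm x {ω | y * γ n ≤ absSum f n ω} ≤ ENNReal.ofReal (Real.exp (-(L * y ^ δ))) := by
  obtain ⟨s', hs', hs'α⟩ := exists_between hs
  obtain ⟨c, hc, hcn⟩ := h.exists_rpow_le hs0.le hs
  obtain ⟨c', hc', hcn'⟩ := h.exists_rpow_le (hs0.le.trans hs'.le) hs'α
  have hl := h.rate_pos
  have hδ := h.one_le_exponent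
  have ht1 : Tendsto (fun n : ℕ => 2 * (l * c / 8) ^ δ * (n : ℝ) ^ (1 - δ * (1 - s))) atTop atTop :=
    ((tendsto_rpow_atTop (by linarith)).comp tendsto_natCast_atTop_atTop).const_mul_atTop
      (by positivity)
  have ht2 : Tendsto (fun n : ℕ => l * c' / (8 * (k * x₀ ^ (1 - s))) * (n : ℝ) ^ (s' - s)) atTop atTop :=
    ((tendsto_rpow_atTop (by linarith)).comp tendsto_natCast_atTop_atTop).const_mul_atTop
      (by positivity)
  filter_upwards [hcn, hcn', ht1.eventually_ge_atTop L, ht2.eventually_ge_atTop (max 1 (Real.log C)),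
    eventually_ge_atTop 1] with n h1 h2 h3 h4 hn y hy hlt x
  have hn0 : (0 : ℝ) < n := by exact_mod_cast hn
  have hγ := h.pos n
  have hky : (n : ℝ) ^ (1 - s) / x₀ ^ (1 - s) < k * y := by
    rw [← Real.div_rpow hn0.le hx₀.le]
    calc (n / x₀) ^ (1 - s) < ((k * y) ^ (1 - s)⁻¹) ^ (1 - s) :=
          Real.rpow_lt_rpow (by positivity) hlt (by linarith)
      _ = k * y := by rw [← Real.rpow_mul (by positivity), inv_mul_cancel₀ (by linarith), Real.rpow_one]
  have hy0 : 0 < y := by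
    by_contra hcon
    have : y = 0 := le_antisymm (not_lt.1 hcon) hy
    rw [this, mul_zero] at hky
    have : 0 ≤ (n : ℝ) ^ (1 - s) / x₀ ^ (1 - s) := by positivity
    linarith
  set v := γ n * y / (8 * n) with hv
  have hv0 : 0 < v := by positivity
  have hlv : max 1 (Real.log C) ≤ l * v := by
    refine h4.trans ?_
    calc _ = l / (8 * n * k) * (c' * (n : ℝ) ^ s') * ((n : ℝ) ^ (1 - s) / x₀ ^ (1 - s)) := by
          have e1 : (n : ℝ) ^ (s' - s) = (n : ℝ) ^ s' * (n : ℝ) ^ (1 - s) / n := by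
            rw [eq_div_iff hn0.ne', ← Real.rpow_add hn0]
            nth_rewrite 2 [← Real.rpow_one (n : ℝ)]
            rw [← Real.rpow_add hn0]; congr 1; ring
          rw [e1]; field_simp
      _ ≤ l / (8 * n * k) * γ n * (k * y) := by gcongr
      _ = _ := by rw [hv]; field_simp
  have hlog : Real.log C ≤ (l * v) ^ δ :=
    ((le_max_right _ _).trans hlv).trans (Real.self_le_rpow_of_one_le ((le_max_left _ _).trans hlv) hδ)
  have hmain := measure_absSum_ge_le_far h.law h.meas_atom h.atom h.mem_atom h.hit_ne_top h.meas_fun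
    hδ hl h.one_le_bound h.cycle hn hv0 hlog x
  have e : 8 * n * v = y * γ n := by rw [hv]; field_simp
  rw [e] at hmain
  refine hmain.trans (ENNReal.ofReal_le_ofReal (Real.exp_le_exp.2 (neg_le_neg ?_)))
  calc L * y ^ δ ≤ (2 * (l * c / 8) ^ δ * (n : ℝ) ^ (1 - δ * (1 - s))) * y ^ δ := by gcongr
    _ = 2 * n * (l * (c * (n : ℝ) ^ s * y / (8 * n))) ^ δ := by
        have e1 : l * (c * (n : ℝ) ^ s * y / (8 * n)) = (l * c / 8) * (n : ℝ) ^ (s - 1) * y := by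
          rw [Real.rpow_sub hn0, Real.rpow_one]; field_simp
        rw [e1, Real.mul_rpow (by positivity) hy, Real.mul_rpow (by positivity) (by positivity),
          ← Real.rpow_mul hn0.le, show 1 - δ * (1 - s) = 1 + (s - 1) * δ by ring,
          Real.rpow_add hn0, Real.rpow_one]
        ring
    _ ≤ _ := by rw [hv]; gcongr

/-- The stretched exponential tails of the normalised sums of `|f|`, uniformly in the starting
point. -/
lemma exists_tail (h : IsRegenerative κ Pm a xa γ α q f δ l C) [IsMarkovKernel κ] (hα : α < 1) (L : ℝ) :
    ∃ C' > (0 : ℝ), ∀ᶠ n : ℕ in atTop, ∀ y ≥ (0 : ℝ), ∀ x,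
      Pm x {ω | y * γ n ≤ absSum f n ω} ≤ ENNReal.ofReal (C' * Real.exp (-(L * y ^ δ))) := by
  obtain ⟨s, hs0, hs, hδs⟩ := exists_index_lt h.one_le_exponent h.exponent_lt h.index_pos
  have hs1 : s < 1 := hs.trans hα
  have hδ := h.one_le_exponent
  obtain ⟨k, hk, x₀, hx₀, C₁, hC₁, hnear⟩ := h.exists_near hs0 hs1 hs
  have hδq : δ < (1 - s)⁻¹ := by rw [lt_inv_comm₀ (by linarith) (by linarith), ← one_div, lt_div_iff₀ (by linarith)]; linarith
  obtain ⟨K, hK, hKy⟩ := exists_add_const_le_rpow (A := L) (B := k ^ (1 - s)⁻¹) (by linarith : 0 ≤ δ) hδq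
    (by positivity)
  refine ⟨C₁ * Real.exp K + 1, by positivity, ?_⟩
  filter_upwards [h.exists_far hs0 hs1 hs hδs hk hx₀ L, eventually_ge_atTop 1] with n hn hn1 y hy x
  rcases le_or_gt ((k * y) ^ (1 - s)⁻¹) (n / x₀) with hc | hc
  · refine (hnear n hn1 y hy hc x).trans (ENNReal.ofReal_le_ofReal ?_)
    have h1 := hKy y hy
    rw [← Real.mul_rpow hk.le hy] at h1
    calc C₁ * Real.exp (-(k * y) ^ (1 - s)⁻¹) ≤ C₁ * Real.exp (K + -(L * y ^ δ)) := by
          gcongr; linarith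
      _ = C₁ * Real.exp K * Real.exp (-(L * y ^ δ)) := by rw [Real.exp_add]; ring
      _ ≤ _ := by gcongr; linarith
  · refine (hn y hy hc x).trans (ENNReal.ofReal_le_ofReal ?_)
    have : 0 < C₁ * Real.exp K := by positivity
    nlinarith [Real.exp_pos (-(L * y ^ δ))]

end IsRegenerative

/-- A random variable with sufficiently light stretched exponential tail has a stretched
exponential moment. -/
lemma lintegral_exp_rpow_le_of_tail {Ω : Type*} [MeasurableSpace Ω] (P : Measure Ω)
    {Y : Ω → ℝ} (hY : Measurable Y) (hY0 : ∀ ω, 0 ≤ Y ω) {δ L C : ℝ} (hδ : 1 ≤ δ)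
    (hL : 0 ≤ L) (hC : 0 ≤ C)
    (htail : ∀ y ≥ (0 : ℝ), P {ω | y ≤ Y ω} ≤ ENNReal.ofReal (C * Real.exp (-((L * 2 ^ δ + 1) * y ^ δ)))) :
    ∫⁻ ω, ENNReal.ofReal (Real.exp (L * Y ω ^ δ)) ∂P ≤
      ENNReal.ofReal (C * Real.exp (L * 2 ^ δ) * 2) := by
  have hA : ∀ k : ℕ, MeasurableSet {ω | (k : ℝ) ≤ Y ω} := fun k =>
    measurableSet_le measurable_const hY
  calc _ ≤ ∫⁻ ω, ∑' k : ℕ, {ω | (k : ℝ) ≤ Y ω}.indicator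
        (fun _ => ENNReal.ofReal (Real.exp (L * ((k : ℝ) + 1) ^ δ))) ω ∂P := by
        refine lintegral_mono fun ω => ?_
        refine le_trans ?_ (ENNReal.le_tsum ⌊Y ω⌋₊)
        rw [indicator_of_mem (by exact Nat.floor_le (hY0 ω))]
        refine ENNReal.ofReal_le_ofReal (Real.exp_le_exp.2 ?_)
        have := (Nat.lt_floor_add_one (Y ω)).le
        have := hY0 ω
        gcongr
    _ = ∑' k : ℕ, ENNReal.ofReal (Real.exp (L * ((k : ℝ) + 1) ^ δ)) * P {ω | (k : ℝ) ≤ Y ω} := by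
        rw [lintegral_tsum fun k => (measurable_const.indicator (hA k)).aemeasurable]
        exact tsum_congr fun k => lintegral_indicator_const (hA k) _
    _ ≤ ∑' k : ℕ, ENNReal.ofReal (C * Real.exp (L * 2 ^ δ) * (1 / 2) ^ k) := by
        refine ENNReal.tsum_le_tsum fun k => ?_
        refine (mul_le_mul_right (htail k (Nat.cast_nonneg k)) _).trans ?_
        rw [← ENNReal.ofReal_mul (Real.exp_nonneg _)]
        refine ENNReal.ofReal_le_ofReal ?_
        have h2 : Real.exp (-(k : ℝ)) ≤ (1 / 2) ^ k := by
          rw [show -(k : ℝ) = k * (-1) by ring, Real.exp_nat_mul]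
          gcongr
          rw [Real.exp_neg, inv_eq_one_div]
          exact one_div_le_one_div_of_le (by norm_num) (by linarith [Real.add_one_le_exp (1 : ℝ)])
        have h3 : L * ((k : ℝ) + 1) ^ δ - (L * 2 ^ δ + 1) * (k : ℝ) ^ δ ≤ L * 2 ^ δ - k := by
          rcases Nat.eq_zero_or_pos k with rfl | hk
          · have : (0 : ℝ) ^ δ = 0 := Real.zero_rpow (by linarith)
            have h4 : (1 : ℝ) ≤ 2 ^ δ := Real.one_le_rpow (by norm_num) (by linarith)
            simp only [Nat.cast_zero, zero_add, Real.one_rpow, this]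
            nlinarith
          · have hk1 : (1 : ℝ) ≤ k := by exact_mod_cast hk
            have h4 : ((k : ℝ) + 1) ^ δ ≤ 2 ^ δ * (k : ℝ) ^ δ := by
              rw [← Real.mul_rpow (by norm_num) (by positivity)]
              gcongr; linarith
            have h5 := Real.self_le_rpow_of_one_le hk1 hδ
            have h6 : 0 ≤ L * 2 ^ δ := by positivity
            nlinarith [mul_le_mul_of_nonneg_left h4 hL]
        calc _ = C * Real.exp (L * ((k : ℝ) + 1) ^ δ - (L * 2 ^ δ + 1) * (k : ℝ) ^ δ) := by
              rw [sub_eq_add_neg, Real.exp_add]; ring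
          _ ≤ C * Real.exp (L * 2 ^ δ - k) := by gcongr
          _ = C * Real.exp (L * 2 ^ δ) * Real.exp (-(k : ℝ)) := by
              rw [sub_eq_add_neg, Real.exp_add]; ring
          _ ≤ _ := by gcongr
    _ = _ := by
        rw [← ENNReal.ofReal_tsum_of_nonneg (fun k => by positivity)
          (summable_geometric_two.mul_left _), tsum_mul_left, tsum_geometric_two]

namespace IsRegenerative

lemma exists_lintegral_exp_le (h : IsRegenerative κ Pm a xa γ α q f δ l C) [IsMarkovKernel κ]
    (hα : α < 1) {L : ℝ} (hL : 0 ≤ L) :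
    ∃ C' > (0 : ℝ), ∀ᶠ n : ℕ in atTop, ∀ x,
      ∫⁻ ω, ENNReal.ofReal (Real.exp (L * (absSum f n ω / γ n) ^ δ)) ∂(Pm x) ≤ ENNReal.ofReal C' := by
  obtain ⟨C', hC', ht⟩ := h.exists_tail hα (L * 2 ^ δ + 1)
  refine ⟨C' * Real.exp (L * 2 ^ δ) * 2, by positivity, ?_⟩
  filter_upwards [ht] with n hn x
  have hγ := h.pos n
  refine lintegral_exp_rpow_le_of_tail (Pm x) ((measurable_absSum h.meas_fun n).div_const _)
    (fun ω => div_nonneg (absSum_nonneg _ _ _) hγ.le) h.one_le_exponent hL hC'.le fun y hy => ?_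
  simpa only [le_div_iff₀ hγ] using hn y hy x

end IsRegenerative

end RegenerativeChain

section PartitionMoments

lemma absSum_min_le_cycleSum {E : Type*} {a : Set E} (f : E → ℝ) {ω : ℕ → E} (hω : hitT a ω ≠ ⊤) (j : ℕ∞) :
    absSum f (hitT a ω ⊓ j).toNat ω ≤ cycleSum a f ω :=
  absSum_mono f ω (ENat.toNat_le_toNat inf_le_left hω)

variable {E : Type*} [MeasurableSpace E] {κ : Kernel E E} {Pm : E → Measure (ℕ → E)}
  {π : Measure E} {Epart : ℕ → Set E}

lemma isProbabilityMeasure_smul_restrict {k : ℕ} (hpos : 0 < π (Epart k)) (hfin : π (Epart k) ≠ ⊤) :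
    IsProbabilityMeasure ((π (Epart k))⁻¹ • π.restrict (Epart k)) :=
  ⟨by simp [ENNReal.inv_mul_cancel hpos.ne' hfin]⟩

lemma lintegral_Ppart (h : IsChainLaw κ Pm) [IsMarkovKernel κ] (k : ℕ) {F : (ℕ → E) → ℝ≥0∞}
    (hF : Measurable F) :
    ∫⁻ ω, F ω ∂(Ppart π Epart Pm k) =
      ∫⁻ x, ∫⁻ ω, F ω ∂(Pm x) ∂((π (Epart k))⁻¹ • π.restrict (Epart k)) :=
  Measure.lintegral_bind h.measurable_law.aemeasurable hF.aemeasurable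

lemma isProbabilityMeasure_Ppart (h : IsChainLaw κ Pm) [IsMarkovKernel κ] {k : ℕ}
    (hpos : 0 < π (Epart k)) (hfin : π (Epart k) ≠ ⊤) :
    IsProbabilityMeasure (Ppart π Epart Pm k) := by
  have := isProbabilityMeasure_smul_restrict hpos hfin
  have := h.prob
  refine ⟨?_⟩
  rw [← lintegral_one, lintegral_Ppart h k measurable_const]
  simp

lemma mul_lintegral_Ppart (h : IsChainLaw κ Pm) [IsMarkovKernel κ] {k : ℕ}
    (hpos : 0 < π (Epart k)) (hfin : π (Epart k) ≠ ⊤) {F : (ℕ → E) → ℝ≥0∞} (hF : Measurable F) :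
    π (Epart k) * ∫⁻ ω, F ω ∂(Ppart π Epart Pm k) =
      ∫⁻ x in Epart k, ∫⁻ ω, F ω ∂(Pm x) ∂π := by
  rw [lintegral_Ppart h k hF, lintegral_smul_measure, smul_eq_mul, ← mul_assoc,
    ENNReal.mul_inv_cancel hpos.ne' hfin, one_mul]

lemma lintegral_Ppart_le (h : IsChainLaw κ Pm) [IsMarkovKernel κ] {k : ℕ}
    (hpos : 0 < π (Epart k)) (hfin : π (Epart k) ≠ ⊤) {F : (ℕ → E) → ℝ≥0∞} (hF : Measurable F)
    {B : ℝ≥0∞} (hB : ∀ x, ∫⁻ ω, F ω ∂(Pm x) ≤ B) : ∫⁻ ω, F ω ∂(Ppart π Epart Pm k) ≤ B := by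
  have := isProbabilityMeasure_smul_restrict hpos hfin
  rw [lintegral_Ppart h k hF]
  calc _ ≤ ∫⁻ _, B ∂((π (Epart k))⁻¹ • π.restrict (Epart k)) := lintegral_mono fun x => hB x
    _ = B := by rw [lintegral_const, measure_univ, mul_one]

lemma lintegral_Ppart_add_mul_le (h : IsChainLaw κ Pm) [IsMarkovKernel κ] {k : ℕ}
    {F G : (ℕ → E) → ℝ≥0∞} (hF : Measurable F) (hG : Measurable G) {s : Set (ℕ → E)}
    (hs : MeasurableSet s) {M : ℝ≥0∞}
    (hle : ∀ x, ∫⁻ ω, F ω ∂(Pm x) ≤ ∫⁻ ω, G ω ∂(Pm x) + M * Pm x s) :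
    ∫⁻ ω, F ω ∂(Ppart π Epart Pm k) ≤
      ∫⁻ ω, G ω ∂(Ppart π Epart Pm k) + M * Ppart π Epart Pm k s := by
  have hm : Measurable fun ω => s.indicator (fun _ => M) ω := measurable_const.indicator hs
  have hGm : Measurable fun ω => G ω + s.indicator (fun _ => M) ω := hG.add hm
  calc _ ≤ ∫⁻ ω, (G ω + s.indicator (fun _ => M) ω) ∂(Ppart π Epart Pm k) := by
        rw [lintegral_Ppart h k hF, lintegral_Ppart h k hGm]
        refine lintegral_mono fun x => (hle x).trans ?_
        rw [lintegral_add_left hG, lintegral_indicator_const hs]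
    _ = _ := by rw [lintegral_add_left hG, lintegral_indicator_const hs]

lemma measurable_absSum_min_hitT {a : Set E} (ha : MeasurableSet a) {f : E → ℝ} (hf : Measurable f)
    (j : ℕ∞) : Measurable fun ω => absSum f (hitT a ω ⊓ j).toNat ω :=
  measurable_absSum_hitT ha hf fun T => (T ⊓ j).toNat

variable {a : Set E} {xa : E} {γ : ℝ → ℝ} {α q : ℝ} {f : E → ℝ} {δ l C : ℝ} {ρ : Measure ℝ}

namespace IsRegenerative

lemma lintegral_exp_truncated_le (h : IsRegenerative κ Pm a xa γ α q f δ l C) [IsMarkovKernel κ]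
    {k : ℕ} (hpos : 0 < π (Epart k)) (hfin : π (Epart k) ≠ ⊤) (j : ℕ∞) :
    ∫⁻ ω, ENNReal.ofReal (Real.exp ((l * absSum f (hitT a ω ⊓ j).toNat ω) ^ δ))
      ∂(Ppart π Epart Pm k) ≤ ENNReal.ofReal C := by
  have hl := h.rate_pos
  have hδ := h.one_le_exponent
  have hm := measurable_absSum_min_hitT h.meas_atom h.meas_fun j
  refine lintegral_Ppart_le h.law hpos hfin (by fun_prop) fun x => ?_
  refine le_trans (lintegral_mono_ae ?_) (h.cycle x)
  filter_upwards [h.hit_ne_top x] with ω hω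
  have h0 := absSum_nonneg f (hitT a ω ⊓ j).toNat ω
  have h1 := absSum_min_le_cycleSum f hω j
  gcongr

/-- The bound on the truncated cycle, for the power function instead of the cumulant. -/
lemma exists_truncated_min_le (h : IsRegenerative κ Pm a xa γ α q f δ l C) [IsMarkovKernel κ]
    (hEpos : ∀ k, 0 < π (Epart k)) (hEfin : ∀ k, π (Epart k) ≠ ⊤)
    (hρ2 : (∫⁻ z, ENNReal.ofReal (trunc z ^ 2) ∂ρ) ≠ ⊤)
    (hρexp : ∀ l : ℝ, (∫⁻ z in {z : ℝ | 1 < |z|}, ENNReal.ofReal (Real.exp (l * z)) ∂ρ) ≠ ⊤)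
    {k₀ C₀ c₀ : ℝ} (hk₀ : 0 < k₀) (hC₀ : 0 < C₀) (hc₀ : 0 < c₀)
    (hup : ∀ y : ℝ, symCumulant ρ y ≤ ENNReal.ofReal (C₀ * Real.exp (k₀ * |y| ^ δ)))
    (hlow : ∀ y : ℝ, 0 ≤ y → c₀ * min (y ^ 2) y ≤ centredCumulant ρ y)
    {ψf : ℝ → ℝ} {ζ : ℝ}
    (hf : ∀ l : ℝ, 0 < l → ∃ k > (0:ℝ), ∃ N : ℝ, 1 < N ∧ ∃ ε > (0:ℝ),
      ∀ r : ℝ, 1 ≤ r → ∀ n : ℕ, N * r ≤ (n : ℝ) →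
        (∫ ω, centredCumulant ρ
            (l * absSum f (hitT a ω ⊓ ((⌊ψf ((n : ℝ) / r)⌋₊ : ℕ∞))).toNat ω)
              ∂(Ppart π Epart Pm n)) ≤ k * r ^ (-ζ - 1 - ε)) :
    ∃ k > (0:ℝ), ∃ N : ℝ, 1 < N ∧ ∃ ε > (0:ℝ),
      ∀ r : ℝ, 1 ≤ r → ∀ n : ℕ, N * r ≤ (n : ℝ) →
        (∫⁻ ω, ENNReal.ofReal
            (min ((absSum f (hitT a ω ⊓ ((⌊ψf ((n : ℝ) / r)⌋₊ : ℕ∞))).toNat ω) ^ 2)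
              (absSum f (hitT a ω ⊓ ((⌊ψf ((n : ℝ) / r)⌋₊ : ℕ∞))).toNat ω))
              ∂(Ppart π Epart Pm n)) ≤ ENNReal.ofReal (k * r ^ (-ζ - 1 - ε)) := by
  have hl := h.rate_pos
  have hδ := h.one_le_exponent
  have hδ0 : 0 < δ := by linarith
  set l₁ := l / (k₀ ^ δ⁻¹) with hl₁
  have hl₁0 : 0 < l₁ := by positivity
  have hl₁δ : k₀ * l₁ ^ δ = l ^ δ := by
    rw [hl₁, Real.div_rpow hl.le (by positivity), ← Real.rpow_mul hk₀.le, inv_mul_cancel₀ hδ0.ne',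
      Real.rpow_one]
    field_simp
  obtain ⟨k, hk, N, hN, ε, hε, hb⟩ := hf l₁ hl₁0
  set c₁ := c₀ * min (l₁ ^ 2) l₁ with hc₁
  have hc₁0 : 0 < c₁ := by positivity
  refine ⟨k / c₁, by positivity, N, hN, ε, hε, fun r hr n hn => ?_⟩
  have := isProbabilityMeasure_Ppart h.law (hEpos n) (hEfin n)
  specialize hb r hr n hn
  set j : ℕ∞ := (⌊ψf ((n : ℝ) / r)⌋₊ : ℕ∞)
  have hm := measurable_absSum_min_hitT h.meas_atom h.meas_fun j
  have hcont := continuous_centredCumulant hρ2 hρexp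
  have hfinite : ∫⁻ ω, ENNReal.ofReal (centredCumulant ρ (l₁ * absSum f (hitT a ω ⊓ j).toNat ω))
      ∂(Ppart π Epart Pm n) ≠ ⊤ := by
    refine ne_top_of_le_ne_top (b := ENNReal.ofReal C₀ * ENNReal.ofReal C) (by finiteness) ?_
    refine le_trans ?_ (mul_le_mul_right (h.lintegral_exp_truncated_le (hEpos n) (hEfin n) j) _)
    rw [← lintegral_const_mul' _ _ ENNReal.ofReal_ne_top]
    refine lintegral_mono fun ω => ?_
    refine (ofReal_centredCumulant_le hρ2 hρexp _).trans ((hup _).trans_eq ?_)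
    have h0 := absSum_nonneg f (hitT a ω ⊓ j).toNat ω
    rw [abs_of_nonneg (by positivity), Real.mul_rpow hl₁0.le h0, ← mul_assoc, hl₁δ,
      ← Real.mul_rpow hl.le h0, ENNReal.ofReal_mul hC₀.le]
  have hintg : Integrable (fun ω => centredCumulant ρ (l₁ * absSum f (hitT a ω ⊓ j).toNat ω))
      (Ppart π Epart Pm n) := by
    refine ⟨(hcont.measurable.comp (hm.const_mul l₁)).aestronglyMeasurable, ?_⟩
    rw [hasFiniteIntegral_iff_ofReal (ae_of_all _ fun ω => centredCumulant_nonneg _)]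
    exact hfinite.lt_top
  have h1 : ∫⁻ ω, ENNReal.ofReal (centredCumulant ρ (l₁ * absSum f (hitT a ω ⊓ j).toNat ω))
      ∂(Ppart π Epart Pm n) ≤ ENNReal.ofReal (k * r ^ (-ζ - 1 - ε)) := by
    rw [← ofReal_integral_eq_lintegral_ofReal hintg (ae_of_all _ fun ω => centredCumulant_nonneg _)]
    exact ENNReal.ofReal_le_ofReal hb
  have h2 : ENNReal.ofReal c₁ * ∫⁻ ω, ENNReal.ofReal
      (min ((absSum f (hitT a ω ⊓ j).toNat ω) ^ 2) (absSum f (hitT a ω ⊓ j).toNat ω))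
        ∂(Ppart π Epart Pm n) ≤ ENNReal.ofReal (k * r ^ (-ζ - 1 - ε)) := by
    refine le_trans ?_ h1
    rw [← lintegral_const_mul' _ _ ENNReal.ofReal_ne_top]
    refine lintegral_mono fun ω => ?_
    dsimp only
    rw [← ENNReal.ofReal_mul hc₁0.le]
    refine ENNReal.ofReal_le_ofReal (le_trans ?_ (hlow _ (mul_nonneg hl₁0.le (absSum_nonneg f _ ω))))
    have h0 := absSum_nonneg f (hitT a ω ⊓ j).toNat ω
    set S := absSum f (hitT a ω ⊓ j).toNat ω
    rw [hc₁, mul_assoc]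
    gcongr
    refine le_min ?_ ?_
    · calc min (l₁ ^ 2) l₁ * min (S ^ 2) S ≤ l₁ ^ 2 * S ^ 2 := by gcongr <;> exact min_le_left _ _
        _ = _ := by ring
    · gcongr <;> exact min_le_right _ _
  rw [div_mul_eq_mul_div, ENNReal.ofReal_div_of_pos hc₁0, ENNReal.le_div_iff_mul_le
    (Or.inl (by simpa using hc₁0)) (Or.inl ENNReal.ofReal_ne_top), mul_comm]
  exact h2

/-- The interpolation between the second-order bound and the stretched exponential moment. -/
lemma exists_truncated_symCumulant_le (h : IsRegenerative κ Pm a xa γ α q f δ l C)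
    [IsMarkovKernel κ] (hEpos : ∀ k, 0 < π (Epart k)) (hEfin : ∀ k, π (Epart k) ≠ ⊤)
    {k₀ C₀ : ℝ} (hk₀ : 0 < k₀) (hC₀ : 0 < C₀)
    (hup : ∀ y : ℝ, symCumulant ρ y ≤ ENNReal.ofReal (C₀ * Real.exp (k₀ * |y| ^ δ)))
    {ψf : ℝ → ℝ} {ζ : ℝ} (hζ : -1 < ζ)
    (hmin : ∃ k > (0:ℝ), ∃ N : ℝ, 1 < N ∧ ∃ ε > (0:ℝ),
      ∀ r : ℝ, 1 ≤ r → ∀ n : ℕ, N * r ≤ (n : ℝ) →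
        (∫⁻ ω, ENNReal.ofReal
            (min ((absSum f (hitT a ω ⊓ ((⌊ψf ((n : ℝ) / r)⌋₊ : ℕ∞))).toNat ω) ^ 2)
              (absSum f (hitT a ω ⊓ ((⌊ψf ((n : ℝ) / r)⌋₊ : ℕ∞))).toNat ω))
              ∂(Ppart π Epart Pm n)) ≤ ENNReal.ofReal (k * r ^ (-ζ - 1 - ε))) :
    ∃ k > (0:ℝ), ∃ N : ℝ, 1 < N ∧ ∃ ε > (0:ℝ), ∃ t₀ > (0 : ℝ),
      ∀ r : ℝ, 1 ≤ r → ∀ n : ℕ, N * r ≤ (n : ℝ) → ∀ t, 0 ≤ t → t ≤ t₀ →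
        (∫⁻ ω, symCumulant ρ (t * absSum f (hitT a ω ⊓ ((⌊ψf ((n : ℝ) / r)⌋₊ : ℕ∞))).toNat ω)
              ∂(Ppart π Epart Pm n)) ≤ ENNReal.ofReal (k * r ^ (-ζ - 1 - ε)) := by
  obtain ⟨k, hk, N, hN, ε, hε, hb⟩ := hmin
  have hl := h.rate_pos
  have hδ := h.one_le_exponent
  have hδ0 : 0 < δ := by linarith
  have hC := h.one_le_bound
  set η := (ε / 2) / (ζ + 1 + ε) with hη
  have hη0 : 0 < η := div_pos (by linarith) (by linarith)
  have hη1 : η < 1 := (div_lt_one (by linarith)).2 (by linarith)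
  have hηε : (1 - η) * (-ζ - 1 - ε) = -ζ - 1 - ε / 2 := by
    have : ζ + 1 + ε ≠ 0 := by linarith
    rw [hη]; field_simp; ring
  set t₁ := l * (η / k₀) ^ δ⁻¹ with ht₁
  have ht₁0 : 0 < t₁ := by positivity
  set t₀ := min 1 t₁ with ht₀
  have ht₀0 : 0 < t₀ := by positivity
  have ht₀δ : k₀ * t₀ ^ δ ≤ η * l ^ δ := by
    calc k₀ * t₀ ^ δ ≤ k₀ * t₁ ^ δ := by gcongr; exact min_le_right _ _
      _ = η * l ^ δ := by
        rw [ht₁, Real.mul_rpow hl.le (by positivity), ← Real.rpow_mul (by positivity),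
          inv_mul_cancel₀ hδ0.ne', Real.rpow_one]
        field_simp
  set D := C₀ * Real.exp k₀ + C₀ with hD
  have hD0 : 0 < D := by positivity
  refine ⟨D * (k ^ (1 - η) * C ^ η), by positivity, N, hN, ε / 2, by linarith, t₀, ht₀0,
    fun r hr n hn t ht htt => ?_⟩
  specialize hb r hr n hn
  set j : ℕ∞ := (⌊ψf ((n : ℝ) / r)⌋₊ : ℕ∞)
  have hm := measurable_absSum_min_hitT h.meas_atom h.meas_fun j
  have hpt : ∀ S : ℝ, 0 ≤ S → symCumulant ρ (t * S) ≤ ENNReal.ofReal D *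
      (ENNReal.ofReal (min (S ^ 2) S) ^ (1 - η) * ENNReal.ofReal (Real.exp ((l * S) ^ δ)) ^ η) := by
    intro S hS
    have hmin0 : 0 ≤ min (S ^ 2) S := by positivity
    rw [ENNReal.ofReal_rpow_of_nonneg hmin0 (by linarith),
      ENNReal.ofReal_rpow_of_nonneg (Real.exp_nonneg _) hη0.le, ← ENNReal.ofReal_mul (by positivity),
      ← ENNReal.ofReal_mul hD0.le]
    rw [← Real.exp_mul]
    rcases le_total S 1 with h1 | h1
    · have h2 : symCumulant ρ (t * S) ≤ ENNReal.ofReal (S ^ 2) * ENNReal.ofReal (C₀ * Real.exp k₀) := by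
        rw [mul_comm]
        refine (symCumulant_mul_le (by rwa [abs_of_nonneg hS]) t).trans ?_
        gcongr
        refine (symCumulant_mono (t := 1) ?_).trans ((hup 1).trans_eq (by simp))
        rw [abs_of_nonneg ht, abs_one]
        exact htt.trans (min_le_left _ _)
      refine h2.trans ?_
      rw [← ENNReal.ofReal_mul (by positivity)]
      refine ENNReal.ofReal_le_ofReal ?_
      have hSS : S ^ 2 ≤ S := by nlinarith
      rw [min_eq_left hSS]
      have h3 : S ^ 2 ≤ (S ^ 2) ^ (1 - η) := by
        rcases hS.eq_or_lt with rfl | hS'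
        · rw [zero_pow (by norm_num)]; positivity
        · exact Real.self_le_rpow_of_le_one (by positivity) (by nlinarith) (by linarith)
      have h4 : 1 ≤ Real.exp ((l * S) ^ δ * η) := Real.one_le_exp (by positivity)
      calc S ^ 2 * (C₀ * Real.exp k₀) ≤ (S ^ 2) ^ (1 - η) * D := by
            gcongr; rw [hD]; linarith
        _ = D * ((S ^ 2) ^ (1 - η) * 1) := by ring
        _ ≤ _ := by gcongr
    · refine (hup _).trans (ENNReal.ofReal_le_ofReal ?_)
      have hSS : S ≤ S ^ 2 := by nlinarith
      rw [min_eq_right hSS, abs_of_nonneg (by positivity), Real.mul_rpow ht hS]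
      have h3 : 1 ≤ S ^ (1 - η) := Real.one_le_rpow h1 (by linarith)
      have h4 : k₀ * (t ^ δ * S ^ δ) ≤ (l * S) ^ δ * η := by
        calc k₀ * (t ^ δ * S ^ δ) ≤ k₀ * (t₀ ^ δ * S ^ δ) := by gcongr
          _ = k₀ * t₀ ^ δ * S ^ δ := by ring
          _ ≤ η * l ^ δ * S ^ δ := by gcongr
          _ = _ := by rw [Real.mul_rpow hl.le hS]; ring
      calc C₀ * Real.exp (k₀ * (t ^ δ * S ^ δ)) ≤ D * (1 * Real.exp ((l * S) ^ δ * η)) := by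
            rw [one_mul]
            gcongr
            rw [hD]
            have : 0 < C₀ * Real.exp k₀ := by positivity
            linarith
        _ ≤ _ := by gcongr
  calc _ ≤ ∫⁻ ω, ENNReal.ofReal D * (ENNReal.ofReal (min ((absSum f (hitT a ω ⊓ j).toNat ω) ^ 2)
          (absSum f (hitT a ω ⊓ j).toNat ω)) ^ (1 - η) *
          ENNReal.ofReal (Real.exp ((l * absSum f (hitT a ω ⊓ j).toNat ω) ^ δ)) ^ η)
          ∂(Ppart π Epart Pm n) := lintegral_mono fun ω => hpt _ (absSum_nonneg _ _ _)
    _ ≤ ENNReal.ofReal D * (ENNReal.ofReal (k * r ^ (-ζ - 1 - ε)) ^ (1 - η) *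
          ENNReal.ofReal C ^ η) := by
        rw [lintegral_const_mul' _ _ ENNReal.ofReal_ne_top]
        gcongr
        have hmS := measurable_absSum_min_hitT h.meas_atom h.meas_fun j
        have hmexp : Measurable fun ω => ENNReal.ofReal
            (Real.exp ((l * absSum f (hitT a ω ⊓ j).toNat ω) ^ δ)) := by fun_prop
        have hmmin : Measurable fun ω => ENNReal.ofReal
            (min ((absSum f (hitT a ω ⊓ j).toNat ω) ^ 2) (absSum f (hitT a ω ⊓ j).toNat ω)) := by
          fun_prop
        refine (ENNReal.lintegral_mul_norm_pow_le hmmin.aemeasurable hmexp.aemeasurable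
          (by linarith) hη0.le (by ring)).trans ?_
        gcongr
        exact h.lintegral_exp_truncated_le (hEpos n) (hEfin n) j
    _ = _ := by
        have hr0 : 0 < r := by linarith
        rw [ENNReal.ofReal_rpow_of_nonneg (by positivity) (by linarith),
          ENNReal.ofReal_rpow_of_nonneg (by positivity) hη0.le, ← ENNReal.ofReal_mul (by positivity),
          ← ENNReal.ofReal_mul hD0.le, Real.mul_rpow hk.le (by positivity), ← Real.rpow_mul hr0.le,
          mul_comm (-ζ - 1 - ε), hηε]
        congr 1
        ring

end IsRegenerative

/-- The probability of returning to the atom before time `ψ(k/r)`, starting from `E_k`. -/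
lemma exists_Ppart_hitT_le (h : IsChainLaw κ Pm) [IsMarkovKernel κ]
    (hEpos : ∀ k, 0 < π (Epart k)) (hEfin : ∀ k, π (Epart k) ≠ ⊤)
    {ψf : ℝ → ℝ} {β ζ : ℝ} (hβ : 0 < β) (hψmono : Monotone ψf) (hψRV : RegVary ψf β)
    (hQ : ∃ ε' > (0:ℝ), ∃ c > (0:ℝ), ∃ N : ℝ, 1 < N ∧ ∃ k > (0:ℝ), ∃ ε > (0:ℝ),
      ∀ r : ℝ, 1 ≤ r → ∀ n : ℕ, N * r ≤ (n : ℝ) →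
        (Ppart π Epart Pm n {ω | hitTr a ω / ψf n ≤ c * r ^ (-β + ε')}).toReal
          < k * r ^ (-ζ - 1 - ε)) :
    ∃ k > (0:ℝ), ∃ N : ℝ, 1 < N ∧ ∃ ε > (0:ℝ), ∃ R ≥ (1 : ℝ), ∀ r : ℝ, R ≤ r → ∀ n : ℕ,
      N * r ≤ (n : ℝ) → ∀ j : ℕ, (j : ℝ) ≤ ψf (n / r) →
        Ppart π Epart Pm n {ω | hitT a ω ≤ j} ≤ ENNReal.ofReal (k * r ^ (-ζ - 1 - ε)) := by
  obtain ⟨ε', hε', c, hc, N, hN, k, hk, ε, hε, hb⟩ := hQ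
  set s := max (β - ε' / 2) (β / 2) with hs
  have hs0 : 0 < s := lt_max_of_lt_right (by linarith)
  have hsβ : s < β := max_lt (by linarith) (by linarith)
  have hsε : 0 < s - β + ε' := by have := le_max_left (β - ε' / 2) (β / 2); linarith
  obtain ⟨x₀, hx₀, c₁, hc₁, hpot⟩ := RegVary.exists_potter_lower hψmono hψRV hs0.le hsβ
  obtain ⟨R, hR⟩ := ((tendsto_rpow_atTop hsε).eventually_ge_atTop (1 / (c₁ * c))).exists_forall_of_atTop
  refine ⟨k, hk, max N x₀, lt_max_of_lt_left hN, ε, hε, max R 1, le_max_right _ _,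
    fun r hr n hn j hj => ?_⟩
  have hr1 : 1 ≤ r := (le_max_right _ _).trans hr
  have hr0 : 0 < r := by linarith
  have := isProbabilityMeasure_Ppart h (hEpos n) (hEfin n)
  have hb' := hb r hr1 n (le_trans (by gcongr; exact le_max_left _ _) hn)
  have hnr : x₀ ≤ n / r := by
    rw [le_div_iff₀ hr0]; exact le_trans (by gcongr; exact le_max_right _ _) hn
  have hψr := (hpot _ hnr).1
  have hψ := (hpot _ hnr).2 r hr1
  rw [mul_div_cancel₀ _ hr0.ne'] at hψ
  have hψ0 : 0 < ψf n := lt_of_lt_of_le (by positivity) hψ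
  have hsub : {ω | hitT a ω ≤ j} ⊆ {ω | hitTr a ω / ψf n ≤ c * r ^ (-β + ε')} := by
    intro ω hω
    have hω' : hitT a ω ≤ j := hω
    change hitTr a ω / ψf n ≤ c * r ^ (-β + ε')
    have h1 : hitTr a ω ≤ j := by
      have := ENat.toNat_le_of_le_natCast hω'
      unfold hitTr
      exact_mod_cast this
    rw [div_le_iff₀ hψ0]
    have h2 : 1 / (c₁ * c) ≤ r ^ (s - β + ε') := hR r ((le_max_left _ _).trans hr)
    rw [div_le_iff₀ (by positivity)] at h2
    calc hitTr a ω ≤ 1 * ψf (n / r) := by linarith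
      _ ≤ (r ^ (s - β + ε') * (c₁ * c)) * ψf (n / r) := by gcongr
      _ = c * r ^ (-β + ε') * (c₁ * r ^ s * ψf (n / r)) := by
          rw [show s - β + ε' = (-β + ε') + s by ring, Real.rpow_add hr0]; ring
      _ ≤ _ := by gcongr
  refine (measure_mono hsub).trans ?_
  rw [← ENNReal.ofReal_toReal (measure_ne_top (Ppart π Epart Pm n) _)]
  exact ENNReal.ofReal_le_ofReal hb'.le

end PartitionMoments

section PathBound

variable {E : Type*} [MeasurableSpace E] {κ : Kernel E E} {Pm : E → Measure (ℕ → E)}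
  {π : Measure E} {Epart : ℕ → Set E} {a : Set E} {xa : E} {γ : ℝ → ℝ} {α q : ℝ} {f : E → ℝ}
  {δ l C : ℝ} {ρ : Measure ℝ}

lemma lintegral_bind_eq_tsum (h : IsChainLaw κ Pm) [IsMarkovKernel κ]
    (hEmeas : ∀ n, MeasurableSet (Epart n)) (hEdisj : Pairwise fun i j => Disjoint (Epart i) (Epart j))
    (hEcover : (⋃ n, Epart n) = Set.univ) (hEpos : ∀ n, 0 < π (Epart n))
    (hEfin : ∀ n, π (Epart n) ≠ ⊤) {F : (ℕ → E) → ℝ≥0∞} (hF : Measurable F) :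
    ∫⁻ ω, F ω ∂(Measure.bind π Pm) =
      ∑' k, π (Epart k) * ∫⁻ ω, F ω ∂(Ppart π Epart Pm k) := by
  rw [Measure.lintegral_bind h.measurable_law.aemeasurable hF.aemeasurable, ← setLIntegral_univ,
    ← hEcover, lintegral_iUnion hEmeas hEdisj]
  exact tsum_congr fun k => (mul_lintegral_Ppart h (hEpos k) (hEfin k) hF).symm

namespace IsRegenerative

lemma exists_lintegral_symCumulant_le_of_start (h : IsRegenerative κ Pm a xa γ α q f δ l C)
    [IsMarkovKernel κ] (hα : α < 1) {k₀ C₀ : ℝ} (hk₀ : 0 < k₀) (hC₀ : 0 < C₀)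
    (hup : ∀ y : ℝ, symCumulant ρ y ≤ ENNReal.ofReal (C₀ * Real.exp (k₀ * |y| ^ δ)))
    {lam : ℝ} (hlam : 0 ≤ lam) :
    ∃ C' > (0 : ℝ), ∀ᶠ n : ℕ in atTop, ∀ j ≤ n, ∀ x,
      ∫⁻ ω, symCumulant ρ (lam / γ n * absSum f j ω) ∂(Pm x) ≤ ENNReal.ofReal C' := by
  have hδ := h.one_le_exponent
  obtain ⟨C', hC', hev⟩ := h.exists_lintegral_exp_le hα (L := k₀ * lam ^ δ) (by positivity)
  refine ⟨C₀ * C', by positivity, ?_⟩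
  filter_upwards [hev] with n hn j hj x
  have hγ := h.pos n
  calc _ ≤ ∫⁻ ω, ENNReal.ofReal C₀ *
        ENNReal.ofReal (Real.exp (k₀ * lam ^ δ * (absSum f n ω / γ n) ^ δ)) ∂(Pm x) := by
        refine lintegral_mono fun ω => ?_
        have h0 := absSum_nonneg f n ω
        have hj0 := absSum_nonneg f j ω
        have hmono := absSum_mono f ω hj
        dsimp only
        rw [← ENNReal.ofReal_mul hC₀.le]
        refine (symCumulant_mono (t := lam * (absSum f n ω / γ n)) ?_).trans ((hup _).trans_eq ?_)
        · rw [abs_of_nonneg (by positivity), abs_of_nonneg (by positivity), div_mul_eq_mul_div,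
            mul_div_assoc]
          gcongr
        · rw [abs_of_nonneg (by positivity), Real.mul_rpow hlam (by positivity), mul_assoc]
    _ ≤ _ := by
        rw [lintegral_const_mul' _ _ ENNReal.ofReal_ne_top, ENNReal.ofReal_mul hC₀.le]
        gcongr
        exact hn x

lemma tendsto_atTop (h : IsRegenerative κ Pm a xa γ α q f δ l C) : Tendsto γ atTop atTop :=
  h.regVary.tendsto_atTop h.mono h.index_pos

/-- The contribution of a distant cell of the partition. -/
lemma exists_lintegral_Ppart_symCumulant_le (h : IsRegenerative κ Pm a xa γ α q f δ l C)
    [IsMarkovKernel κ] (hα : α < 1) (hEpos : ∀ k, 0 < π (Epart k))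
    (hEfin : ∀ k, π (Epart k) ≠ ⊤) {k₀ C₀ : ℝ} (hk₀ : 0 < k₀) (hC₀ : 0 < C₀)
    (hup : ∀ y : ℝ, symCumulant ρ y ≤ ENNReal.ofReal (C₀ * Real.exp (k₀ * |y| ^ δ)))
    {ψf : ℝ → ℝ} {β ζ : ℝ} (hζ : -1 < ζ) (hβ : 0 < β) (hψmono : Monotone ψf)
    (hψRV : RegVary ψf β)
    (hmin : ∃ k > (0:ℝ), ∃ N : ℝ, 1 < N ∧ ∃ ε > (0:ℝ),
      ∀ r : ℝ, 1 ≤ r → ∀ n : ℕ, N * r ≤ (n : ℝ) →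
        (∫⁻ ω, ENNReal.ofReal
            (min ((absSum f (hitT a ω ⊓ ((⌊ψf ((n : ℝ) / r)⌋₊ : ℕ∞))).toNat ω) ^ 2)
              (absSum f (hitT a ω ⊓ ((⌊ψf ((n : ℝ) / r)⌋₊ : ℕ∞))).toNat ω))
              ∂(Ppart π Epart Pm n)) ≤ ENNReal.ofReal (k * r ^ (-ζ - 1 - ε)))
    (hQ : ∃ ε' > (0:ℝ), ∃ c > (0:ℝ), ∃ N : ℝ, 1 < N ∧ ∃ k > (0:ℝ), ∃ ε > (0:ℝ),
      ∀ r : ℝ, 1 ≤ r → ∀ n : ℕ, N * r ≤ (n : ℝ) →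
        (Ppart π Epart Pm n {ω | hitTr a ω / ψf n ≤ c * r ^ (-β + ε')}).toReal
          < k * r ^ (-ζ - 1 - ε))
    {lam : ℝ} (hlam : 0 ≤ lam) :
    ∃ k > (0:ℝ), ∃ ε > (0:ℝ), ∃ R ≥ (1 : ℝ), ∀ᶠ n : ℕ in atTop, ∀ i : ℕ,
      R ≤ i / (2 * geninv ψf n) →
        ∫⁻ ω, symCumulant ρ (lam / γ n * absSum f n ω) ∂(Ppart π Epart Pm i) ≤
          ENNReal.ofReal (k * (i / (2 * geninv ψf n)) ^ (-ζ - 1 - ε)) := by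
  obtain ⟨k₁, hk₁, N₁, hN₁, ε₁, hε₁, t₀, ht₀, hb₁⟩ :=
    h.exists_truncated_symCumulant_le hEpos hEfin hk₀ hC₀ hup hζ hmin
  obtain ⟨k₂, hk₂, N₂, hN₂, ε₂, hε₂, R, hR, hb₂⟩ :=
    exists_Ppart_hitT_le h.law hEpos hEfin hβ hψmono hψRV hQ
  obtain ⟨C', hC', hsup⟩ := h.exists_lintegral_symCumulant_le_of_start hα hk₀ hC₀ hup
    (lam := 2 * lam) (by positivity)
  have hψt : Tendsto ψf atTop atTop := hψRV.tendsto_atTop hψmono hβ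
  refine ⟨k₁ + C' * k₂, by positivity, min ε₁ ε₂, lt_min hε₁ hε₂, R, hR, ?_⟩
  have hA := (tendsto_geninv hψmono hψt).comp (tendsto_natCast_atTop_atTop (R := ℝ))
  have ht : Tendsto (fun n : ℕ => 2 * lam / γ n) atTop (𝓝 0) :=
    (h.tendsto_atTop.comp tendsto_natCast_atTop_atTop).const_div_atTop _
  filter_upwards [hsup, hA.eventually_ge_atTop N₁, hA.eventually_ge_atTop N₂,
    ht.eventually_le_const ht₀] with n hn hAN₁ hAN₂ htn i hi
  have hγ := h.pos n
  have hA1 : 1 ≤ geninv ψf n := one_le_geninv hψt n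
  simp only [Function.comp] at hAN₁ hAN₂
  set A := geninv ψf n with hAdef
  set r := (i : ℝ) / (2 * A) with hr
  have hr1 : 1 ≤ r := hR.trans hi
  have hr0 : 0 < r := by linarith
  have hri : 2 * A * r = i := by rw [hr]; field_simp
  have hir : (i : ℝ) / r = 2 * A := by rw [← hri]; field_simp
  have hψn : (n : ℝ) ≤ ψf (i / r) := by
    rw [hir]; exact le_apply_of_geninv_lt hψmono hψt (by linarith)
  have hN₁i : N₁ * r ≤ i := by rw [← hri]; gcongr; linarith
  have hN₂i : N₂ * r ≤ i := by rw [← hri]; gcongr; linarith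
  have hm := measurable_symCumulant (ρ := ρ)
  have hset : MeasurableSet {ω : ℕ → E | hitT a ω ≤ n} := by
    have : {ω : ℕ → E | hitT a ω ≤ n} = {ω | (n : ℕ∞) < hitT a ω}ᶜ := by ext ω; simp
    rw [this]; exact (measurableSet_lt_hitT h.meas_atom n).compl
  have hS := measurable_absSum_min_hitT h.meas_atom h.meas_fun (n : ℕ∞)
  have hSn := measurable_absSum h.meas_fun n
  have hsplit := lintegral_Ppart_add_mul_le (π := π) (Epart := Epart) h.law (k := i)
    (F := fun ω => symCumulant ρ (lam / γ n * absSum f n ω))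
    (G := fun ω => symCumulant ρ (lam / γ n * (2 * absSum f (hitT a ω ⊓ n).toNat ω)))
    (hm.comp (by fun_prop)) (hm.comp (by fun_prop)) hset (M := ENNReal.ofReal C')
    (fun x => h.law.lintegral_absSum_split h.meas_atom h.meas_fun
      (Φ := fun s => symCumulant ρ (lam / γ n * s)) (hm.comp (by fun_prop))
      (fun s t hs ht => by
        rw [mul_add, show lam / γ n * (2 * s) = 2 * (lam / γ n * s) by ring,
          show lam / γ n * (2 * t) = 2 * (lam / γ n * t) by ring]
        exact symCumulant_add_le (by positivity) (by positivity))
      (fun s hs => symCumulant_mono (by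
        rw [abs_of_nonneg (by positivity), abs_of_nonneg (by positivity)]
        gcongr; linarith))
      n (fun j hj y => by
        have := hn j hj y
        simpa only [show ∀ s : ℝ, lam / γ n * (2 * s) = 2 * lam / γ n * s from fun s => by ring]
          using this) x)
  refine hsplit.trans ?_
  have h1 : ∫⁻ ω, symCumulant ρ (lam / γ n * (2 * absSum f (hitT a ω ⊓ n).toNat ω))
      ∂(Ppart π Epart Pm i) ≤ ENNReal.ofReal (k₁ * r ^ (-ζ - 1 - ε₁)) := by
    refine le_trans (lintegral_mono fun ω => ?_) (hb₁ r hr1 i hN₁i _ (by positivity) htn)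
    have h0 := absSum_nonneg f (hitT a ω ⊓ n).toNat ω
    have h0' := absSum_nonneg f (hitT a ω ⊓ (⌊ψf (i / r)⌋₊ : ℕ∞)).toNat ω
    refine symCumulant_mono ?_
    rw [abs_of_nonneg (by positivity), abs_of_nonneg (by positivity), ← mul_assoc,
      show lam / γ n * 2 = 2 * lam / γ n by ring]
    gcongr
    refine absSum_mono f ω (ENat.toNat_le_toNat ?_ ?_)
    · refine inf_le_inf_left _ ?_
      exact_mod_cast Nat.le_floor hψn
    · exact ne_top_of_le_ne_top (ENat.natCast_ne_top _) inf_le_right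
  have h2 := hb₂ r hi i hN₂i n hψn
  calc _ ≤ ENNReal.ofReal (k₁ * r ^ (-ζ - 1 - ε₁)) +
        ENNReal.ofReal C' * ENNReal.ofReal (k₂ * r ^ (-ζ - 1 - ε₂)) := by gcongr
    _ = ENNReal.ofReal (k₁ * r ^ (-ζ - 1 - ε₁) + C' * (k₂ * r ^ (-ζ - 1 - ε₂))) := by
        rw [← ENNReal.ofReal_mul hC'.le, ← ENNReal.ofReal_add (by positivity) (by positivity)]
    _ ≤ _ := by
        refine ENNReal.ofReal_le_ofReal ?_
        have h3 : r ^ (-ζ - 1 - ε₁) ≤ r ^ (-ζ - 1 - min ε₁ ε₂) :=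
          Real.rpow_le_rpow_of_exponent_le hr1 (by linarith [min_le_left ε₁ ε₂])
        have h4 : r ^ (-ζ - 1 - ε₂) ≤ r ^ (-ζ - 1 - min ε₁ ε₂) :=
          Real.rpow_le_rpow_of_exponent_le hr1 (by linarith [min_le_right ε₁ ε₂])
        calc _ ≤ k₁ * r ^ (-ζ - 1 - min ε₁ ε₂) + C' * (k₂ * r ^ (-ζ - 1 - min ε₁ ε₂)) := by
              gcongr
          _ = _ := by ring

/-- Under the stationary path measure, the scaled cumulant of a window of length `n` is of order
`p(ψ^←(n)) ψ^←(n)`. -/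
lemma exists_lintegral_bind_symCumulant_le (h : IsRegenerative κ Pm a xa γ α q f δ l C)
    [IsMarkovKernel κ] (hα : α < 1) (hEmeas : ∀ n, MeasurableSet (Epart n))
    (hEdisj : Pairwise fun i j => Disjoint (Epart i) (Epart j))
    (hEcover : (⋃ n, Epart n) = Set.univ) (hEpos : ∀ k, 0 < π (Epart k))
    (hEfin : ∀ k, π (Epart k) ≠ ⊤) {k₀ C₀ : ℝ} (hk₀ : 0 < k₀) (hC₀ : 0 < C₀)
    (hup : ∀ y : ℝ, symCumulant ρ y ≤ ENNReal.ofReal (C₀ * Real.exp (k₀ * |y| ^ δ)))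
    {ψf : ℝ → ℝ} {β ζ : ℝ} (hζ : -1 < ζ) (hp : RegSeq (fun k => (π (Epart k)).toReal) ζ)
    (hβ : 0 < β) (hψmono : Monotone ψf) (hψRV : RegVary ψf β)
    (hmin : ∃ k > (0:ℝ), ∃ N : ℝ, 1 < N ∧ ∃ ε > (0:ℝ),
      ∀ r : ℝ, 1 ≤ r → ∀ n : ℕ, N * r ≤ (n : ℝ) →
        (∫⁻ ω, ENNReal.ofReal
            (min ((absSum f (hitT a ω ⊓ ((⌊ψf ((n : ℝ) / r)⌋₊ : ℕ∞))).toNat ω) ^ 2)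
              (absSum f (hitT a ω ⊓ ((⌊ψf ((n : ℝ) / r)⌋₊ : ℕ∞))).toNat ω))
              ∂(Ppart π Epart Pm n)) ≤ ENNReal.ofReal (k * r ^ (-ζ - 1 - ε)))
    (hQ : ∃ ε' > (0:ℝ), ∃ c > (0:ℝ), ∃ N : ℝ, 1 < N ∧ ∃ k > (0:ℝ), ∃ ε > (0:ℝ),
      ∀ r : ℝ, 1 ≤ r → ∀ n : ℕ, N * r ≤ (n : ℝ) →
        (Ppart π Epart Pm n {ω | hitTr a ω / ψf n ≤ c * r ^ (-β + ε')}).toReal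
          < k * r ^ (-ζ - 1 - ε))
    {lam : ℝ} (hlam : 0 ≤ lam) :
    ∃ C' > (0 : ℝ), ∀ᶠ n : ℕ in atTop,
      ∫⁻ ω, symCumulant ρ (lam / γ n * absSum f n ω) ∂(Measure.bind π Pm) ≤
        ENNReal.ofReal (C' * (⌊geninv ψf n⌋₊ * (π (Epart ⌊geninv ψf n⌋₊)).toReal)) := by
  set p : ℕ → ℝ := fun k => (π (Epart k)).toReal with hpdef
  obtain ⟨k, hk, ε, hε, R, hR, hfar⟩ := h.exists_lintegral_Ppart_symCumulant_le hα hEpos hEfin hk₀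
    hC₀ hup hζ hβ hψmono hψRV hmin hQ hlam
  obtain ⟨C₁, hC₁, hnear⟩ := h.exists_lintegral_symCumulant_le_of_start hα hk₀ hC₀ hup hlam
  obtain ⟨R', hR'⟩ := exists_nat_ge (4 * R)
  have hR'1 : 1 ≤ R' := by
    have : (1 : ℝ) ≤ R' := by linarith
    exact_mod_cast this
  obtain ⟨n₁, D₁, hD₁, hhead⟩ := hp.exists_sum_head_le hζ R' hR'1
  obtain ⟨n₂, D₂, hD₂, htail⟩ := hp.exists_sum_tail_le hε
  have hψt : Tendsto ψf atTop atTop := hψRV.tendsto_atTop hψmono hβ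
  have hA : Tendsto (fun n : ℕ => ⌊geninv ψf n⌋₊) atTop atTop :=
    tendsto_nat_floor_atTop.comp ((tendsto_geninv hψmono hψt).comp tendsto_natCast_atTop_atTop)
  set e := ζ + 1 + ε with he
  have he0 : 0 < e := by linarith
  refine ⟨C₁ * D₁ + k * 4 ^ e * D₂, by positivity, ?_⟩
  filter_upwards [hfar, hnear, hA.eventually_ge_atTop n₁, hA.eventually_ge_atTop n₂,
    hA.eventually_ge_atTop 1] with n hfarn hnearn hn₁ hn₂ hn1
  set n' := ⌊geninv ψf n⌋₊ with hn'
  have hn'0 : (0 : ℝ) < n' := by exact_mod_cast hn1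
  have hn'1 : (1 : ℝ) ≤ n' := by exact_mod_cast hn1
  have hA2 : geninv ψf n ≤ 2 * n' := by
    have := Nat.lt_floor_add_one (geninv ψf n)
    rw [← hn'] at this
    linarith
  have hA0 : 1 ≤ geninv ψf n := one_le_geninv hψt n
  have hF : Measurable fun ω : ℕ → E => symCumulant ρ (lam / γ n * absSum f n ω) :=
    measurable_symCumulant.comp ((measurable_absSum h.meas_fun n).const_mul _)
  have hp0 : ∀ i, 0 ≤ p i := fun i => ENNReal.toReal_nonneg
  have hterm : ∀ i, π (Epart i) * ∫⁻ ω, symCumulant ρ (lam / γ n * absSum f n ω)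
        ∂(Ppart π Epart Pm i) ≤
      ENNReal.ofReal ((if i < R' * n' then C₁ * p i else 0) +
        if n' ≤ i then k * 4 ^ e * (p i * ((i : ℝ) / n') ^ (-ζ - 1 - ε)) else 0) := by
    intro i
    rw [← ENNReal.ofReal_toReal (hEfin i)]
    change ENNReal.ofReal (p i) * _ ≤ _
    have hnn : 0 ≤ k * 4 ^ e * (p i * ((i : ℝ) / n') ^ (-ζ - 1 - ε)) := by
      have := hp0 i; positivity
    split_ifs with h1 h2 h2
    · refine le_trans ?_ (ENNReal.ofReal_le_ofReal (le_add_of_nonneg_right hnn))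
      rw [mul_comm C₁, ENNReal.ofReal_mul (hp0 i)]
      gcongr
      exact lintegral_Ppart_le h.law (hEpos i) (hEfin i) hF (hnearn n le_rfl)
    · rw [add_zero, mul_comm C₁, ENNReal.ofReal_mul (hp0 i)]
      gcongr
      exact lintegral_Ppart_le h.law (hEpos i) (hEfin i) hF (hnearn n le_rfl)
    · have hi : (R' : ℝ) * n' ≤ i := by exact_mod_cast not_lt.1 h1
      have hi0 : (0 : ℝ) < i := lt_of_lt_of_le (by positivity) hi
      have hle : (i : ℝ) / n' / 4 ≤ i / (2 * geninv ψf n) := by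
        rw [div_div]
        exact div_le_div_of_nonneg_left hi0.le (by positivity) (by linarith)
      have hRi : R ≤ i / (2 * geninv ψf n) := by
        refine le_trans ?_ hle
        rw [div_div, le_div_iff₀ (by positivity)]
        nlinarith
      rw [zero_add, show k * 4 ^ e * (p i * ((i : ℝ) / n') ^ (-ζ - 1 - ε)) =
        p i * (k * (4 ^ e * ((i : ℝ) / n') ^ (-ζ - 1 - ε))) by ring, ENNReal.ofReal_mul (hp0 i)]
      gcongr
      refine (hfarn i hRi).trans (ENNReal.ofReal_le_ofReal ?_)
      gcongr
      calc _ ≤ ((i : ℝ) / n' / 4) ^ (-ζ - 1 - ε) :=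
            Real.rpow_le_rpow_of_nonpos (by positivity) hle (by linarith)
        _ = _ := by
            rw [Real.div_rpow (by positivity) (by norm_num), show -ζ - 1 - ε = -e by rw [he]; ring,
              Real.rpow_neg (by norm_num : (0:ℝ) ≤ 4)]
            field_simp
    · exfalso
      exact h2 ((Nat.le_mul_of_pos_left _ (by lia)).trans (not_lt.1 h1))
  rw [lintegral_bind_eq_tsum h.law hEmeas hEdisj hEcover hEpos hEfin hF]
  refine ENNReal.tsum_le_of_sum_range_le fun N => (Finset.sum_le_sum fun i _ => hterm i).trans ?_
  rw [← ENNReal.ofReal_sum_of_nonneg fun i _ => ?_]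
  · refine ENNReal.ofReal_le_ofReal ?_
    rw [Finset.sum_add_distrib, add_mul]
    refine add_le_add ?_ ?_
    · rw [← Finset.sum_filter, ← Finset.mul_sum, mul_assoc]
      gcongr
      refine le_trans (Finset.sum_le_sum_of_subset_of_nonneg ?_ fun i _ _ => hp0 i) (hhead n' hn₁)
      intro i hi
      simpa using (Finset.mem_filter.1 hi).2
    · rw [← Finset.sum_filter, ← Finset.mul_sum, mul_assoc (k * 4 ^ e)]
      gcongr
      refine le_trans (Finset.sum_le_sum_of_subset_of_nonneg ?_ fun i _ _ => ?_) (htail n' hn₂ N)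
      · intro i hi
        simp only [Finset.mem_filter, Finset.mem_range] at hi
        exact Finset.mem_Ico.2 ⟨hi.2, hi.1⟩
      · have := hp0 i; positivity
  · have := hp0 i
    positivity

end IsRegenerative

end PathBound

section Increments

/-- The partial sums `X_1 + ⋯ + X_k`. -/
def partialSum {Ω : Type*} (X : ℤ → Ω → ℝ) (k : ℕ) (ω : Ω) : ℝ :=
  ∑ i ∈ Finset.Icc 1 k, X (i : ℤ) ω

lemma partialSum_add_sub {Ω : Type*} (X : ℤ → Ω → ℝ) (l j : ℕ) (ω : Ω) :
    partialSum X (l + j) ω - partialSum X l ω = ∑ i ∈ Finset.Icc 1 j, X ((l : ℤ) + (i : ℤ)) ω := by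
  induction j with
  | zero => simp
  | succ j ih =>
    rw [Finset.sum_Icc_succ_top (by lia), ← ih, partialSum, ← add_assoc,
      Finset.sum_Icc_succ_top (by lia), partialSum, partialSum]
    push_cast
    ring_nf

variable {Ω : Type*} [MeasurableSpace Ω] {P : Measure Ω} {X : ℤ → Ω → ℝ}

lemma measurable_partialSum (hX : ∀ i, Measurable (X i)) (k : ℕ) : Measurable (partialSum X k) :=
  Finset.measurable_fun_sum _ fun i _ => hX i

variable {E : Type*} [MeasurableSpace E] {ρ : Measure ℝ} {m : Measure (ℤ → E)}
  {ν : Measure (ℕ → E)} {f : E → ℝ}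

/-- An exponential moment bound for the increments of the partial sums. -/
lemma lintegral_exp_increment_le
    (hρ2 : (∫⁻ z, ENNReal.ofReal (trunc z ^ 2) ∂ρ) ≠ ⊤)
    (hρexp : ∀ l : ℝ, (∫⁻ z in {z : ℝ | 1 < |z|}, ENNReal.ofReal (Real.exp (l * z)) ∂ρ) ≠ ⊤)
    (hcum : ∀ y, cumulant ρ y = centredCumulant ρ y) (hf : Measurable f)
    (hwin : ∀ n : ℤ, m.map (fun s (i : ℕ) => s (n + (i : ℤ))) = ν)
    (hXchar : ∀ (J : Finset ℤ) (c : ℤ → ℝ),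
      (∫ ω, Real.exp (∑ n ∈ J, c n * X n ω) ∂P)
        = Real.exp (∫ s, cumulant ρ (∑ n ∈ J, c n * f (s n)) ∂m))
    {t M : ℝ} (hM : 0 ≤ M) {j : ℕ}
    (hb : ∫⁻ ω, symCumulant ρ (|t| * absSum f j ω) ∂ν ≤ ENNReal.ofReal M) (l : ℕ) :
    ∫⁻ ω, ENNReal.ofReal (Real.exp (t * (partialSum X (l + j) ω - partialSum X l ω))) ∂P ≤
      ENNReal.ofReal (Real.exp M) := by
  set emb : ℕ ↪ ℤ := ⟨fun i => (l : ℤ) + i, fun x y h => by simpa using h⟩ with hemb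
  have hS : ∀ ω, ∑ n ∈ (Finset.Icc 1 j).map emb, (fun _ => t) n * X n ω =
      t * (partialSum X (l + j) ω - partialSum X l ω) := fun ω => by
    rw [partialSum_add_sub, Finset.sum_map, Finset.mul_sum]; rfl
  have hchar := hXchar ((Finset.Icc 1 j).map emb) fun _ => t
  simp only [hS] at hchar
  have hintg : Integrable (fun ω => Real.exp (t * (partialSum X (l + j) ω - partialSum X l ω))) P := by
    by_contra h
    rw [integral_undef h] at hchar
    exact (Real.exp_pos _).ne hchar
  rw [← ofReal_integral_eq_lintegral_ofReal hintg (ae_of_all _ fun _ => (Real.exp_pos _).le), hchar]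
  refine ENNReal.ofReal_le_ofReal (Real.exp_le_exp.2 ?_)
  simp only [hcum]
  have hmeas : Measurable fun s : ℤ → E =>
      centredCumulant ρ (∑ n ∈ (Finset.Icc 1 j).map emb, t * f (s n)) :=
    (continuous_centredCumulant hρ2 hρexp).measurable.comp
      (Finset.measurable_fun_sum _ fun i _ => (hf.comp (measurable_pi_apply i)).const_mul t)
  rw [integral_eq_lintegral_of_nonneg_ae (ae_of_all _ fun _ => centredCumulant_nonneg _)
    hmeas.aestronglyMeasurable]
  refine ENNReal.toReal_le_of_le_ofReal hM (le_trans ?_ hb)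
  have hsym : Measurable fun ω : ℕ → E => symCumulant ρ (|t| * absSum f j ω) :=
    measurable_symCumulant.comp ((measurable_absSum hf j).const_mul _)
  rw [← hwin l, lintegral_map hsym (measurable_pi_lambda _ fun i => measurable_pi_apply _)]
  refine lintegral_mono fun s => (ofReal_centredCumulant_le hρ2 hρexp _).trans (symCumulant_mono ?_)
  rw [Finset.sum_map, ← Finset.mul_sum, abs_mul, abs_mul, abs_abs,
    abs_of_nonneg (absSum_nonneg f j _)]
  gcongr
  exact Finset.abs_sum_le_sum_abs _ _

/-- A two-sided Chernoff bound. -/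
lemma measure_le_abs_le {S : Ω → ℝ} (hS : Measurable S) {t M : ℝ} (ht : 0 ≤ t)
    (h1 : ∫⁻ ω, ENNReal.ofReal (Real.exp (t * S ω)) ∂P ≤ ENNReal.ofReal (Real.exp M))
    (h2 : ∫⁻ ω, ENNReal.ofReal (Real.exp (-t * S ω)) ∂P ≤ ENNReal.ofReal (Real.exp M)) (y : ℝ) :
    P {ω | y ≤ |S ω|} ≤ ENNReal.ofReal (2 * Real.exp (M - t * y)) := by
  have hsub : {ω | y ≤ |S ω|} ⊆ {ω | y ≤ S ω} ∪ {ω | y ≤ -S ω} := fun ω hω => by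
    rcases le_abs.1 (show y ≤ |S ω| from hω) with h | h
    exacts [Or.inl h, Or.inr h]
  have e : ENNReal.ofReal (Real.exp (-(t * y))) * ENNReal.ofReal (Real.exp M) =
      ENNReal.ofReal (Real.exp (M - t * y)) := by
    rw [← ENNReal.ofReal_mul (Real.exp_pos _).le, ← Real.exp_add]; ring_nf
  have g1 : P {ω | y ≤ S ω} ≤ ENNReal.ofReal (Real.exp (M - t * y)) := by
    rw [← e]
    exact (measure_ge_le_exp_mul_lintegral P hS ht y).trans (by gcongr)
  have g2 : P {ω | y ≤ -S ω} ≤ ENNReal.ofReal (Real.exp (M - t * y)) := by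
    rw [← e]
    refine (measure_ge_le_exp_mul_lintegral P hS.neg ht y).trans ?_
    simp only [Pi.neg_apply, mul_neg, neg_mul] at h2 ⊢
    gcongr
  rw [two_mul, ENNReal.ofReal_add (Real.exp_pos _).le (Real.exp_pos _).le]
  exact (measure_mono hsub).trans ((measure_union_le _ _).trans (add_le_add g1 g2))

/-- Exponential tails, at speed `b n`, for the increments of the normalised partial sums. -/
def IncrementTail (P : Measure Ω) (X : ℤ → Ω → ℝ) (aseq bseq : ℕ → ℝ) (C lam s : ℝ) : Prop :=
  ∀ᶠ n : ℕ in atTop, ∀ l j : ℕ, 1 ≤ j → j ≤ n → ∀ z > (0 : ℝ),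
    P {ω | z * aseq n ≤ |partialSum X (l + j) ω - partialSum X l ω|} ≤
      ENNReal.ofReal (2 * Real.exp (bseq n * (C - lam * ((n : ℝ) / j) ^ s * z)))

lemma incrementTail_of_ae_eq_zero (hX0 : ∀ i, X i =ᵐ[P] 0) {aseq bseq : ℕ → ℝ}
    (ha : ∀ᶠ n in atTop, 0 < aseq n) (C lam s : ℝ) : IncrementTail P X aseq bseq C lam s := by
  filter_upwards [ha] with n hn l j _ _ z hz
  have h0 : P {ω | z * aseq n ≤ |partialSum X (l + j) ω - partialSum X l ω|} = 0 := by
    have hall : ∀ᵐ ω ∂P, ∀ i, X i ω = 0 := ae_all_iff.2 hX0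
    refine measure_eq_zero_iff_ae_notMem.2 ?_
    filter_upwards [hall] with ω hω hmem
    have : z * aseq n ≤ |partialSum X (l + j) ω - partialSum X l ω| := hmem
    simp only [partialSum, hω, Finset.sum_const_zero, sub_self, abs_zero] at this
    exact absurd this (not_le.2 (mul_pos hz hn))
  rw [h0]
  exact zero_le

lemma exists_incrementTail {γ : ℝ → ℝ} {α : ℝ} (hα : 0 < α) (hγmono : Monotone γ)
    (hγpos : ∀ x, 0 < γ x) (hγ : RegVary γ α)
    (hρ2 : (∫⁻ z, ENNReal.ofReal (trunc z ^ 2) ∂ρ) ≠ ⊤)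
    (hρexp : ∀ l : ℝ, (∫⁻ z in {z : ℝ | 1 < |z|}, ENNReal.ofReal (Real.exp (l * z)) ∂ρ) ≠ ⊤)
    (hcum : ∀ y, cumulant ρ y = centredCumulant ρ y) (hf : Measurable f)
    (hwin : ∀ n : ℤ, m.map (fun s (i : ℕ) => s (n + (i : ℤ))) = ν)
    (hXmeas : ∀ n, Measurable (X n))
    (hXchar : ∀ (J : Finset ℤ) (c : ℤ → ℝ),
      (∫ ω, Real.exp (∑ n ∈ J, c n * X n ω) ∂P)
        = Real.exp (∫ s, cumulant ρ (∑ n ∈ J, c n * f (s n)) ∂m))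
    {B cseq aseq bseq : ℕ → ℝ} (hB0 : ∀ n, 0 ≤ B n) {D : ℝ} (hD : 0 < D)
    (hcore : ∀ᶠ n : ℕ in atTop,
      ∫⁻ ω, symCumulant ρ (1 / γ n * absSum f n ω) ∂ν ≤ ENNReal.ofReal (D * B n))
    (hBmono : ∃ C₁ > (0 : ℝ), ∃ N : ℕ, ∀ j ≥ N, ∀ n ≥ j, B j ≤ C₁ * B n)
    (hc : ∀ᶠ n in atTop, 1 ≤ cseq n) (hb : ∀ᶠ n in atTop, B n / cseq n ^ 2 ≤ bseq n)
    (hab : ∀ᶠ n : ℕ in atTop, aseq n = bseq n * γ n * cseq n) :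
    ∃ C > (0 : ℝ), ∃ lam > (0 : ℝ), ∃ s : ℝ, 0 < s ∧ IncrementTail P X aseq bseq C lam s := by
  obtain ⟨C₁, hC₁, N₁, hN₁⟩ := hBmono
  obtain ⟨x₀, hx₀, c₁, hc₁, hpot⟩ := RegVary.exists_potter_lower hγmono hγ
    (s := α / 2) (by linarith) (by linarith)
  obtain ⟨N₂, hN₂⟩ := eventually_atTop.1 hcore
  set J := max (max N₁ N₂) (max ⌈x₀⌉₊ 1) with hJ
  have hJN₁ : N₁ ≤ J := (le_max_left _ _).trans (le_max_left _ _)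
  have hJN₂ : N₂ ≤ J := (le_max_right _ _).trans (le_max_left _ _)
  have hJx : x₀ ≤ J := (Nat.le_ceil x₀).trans
    (by exact_mod_cast (le_max_left _ _).trans (le_max_right _ _))
  have hJ1 : 1 ≤ J := (le_max_right _ _).trans (le_max_right _ _)
  have hJ0 : (0 : ℝ) < J := by exact_mod_cast hJ1
  refine ⟨D * C₁, by positivity, c₁ * (J : ℝ) ^ (-(α / 2)), by positivity, α / 2, by linarith, ?_⟩
  filter_upwards [hc, hb, hab, eventually_ge_atTop J] with n hcn hbn habn hJn l j hj1 hjn z hz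
  have hj0 : (0 : ℝ) < j := by exact_mod_cast hj1
  have hn0 : (0 : ℝ) < n := by exact_mod_cast hj1.trans hjn
  set i := max j J with hi
  have hin : i ≤ n := max_le hjn hJn
  have hiJ : J ≤ i := le_max_right _ _
  have hi0 : (0 : ℝ) < i := by exact_mod_cast hJ1.trans hiJ
  have hγi := hγpos i
  have hγn := hγpos n
  have hc0 : 0 < cseq n := by linarith
  have hbn0 : 0 ≤ bseq n := le_trans (div_nonneg (hB0 n) (by positivity)) hbn
  set t := 1 / (γ i * cseq n) with ht
  have ht0 : 0 < t := by positivity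
  set M := D * C₁ * bseq n with hM
  have hM0 : 0 ≤ M := by positivity
  have hcum_le : ∀ t' : ℝ, |t'| = t →
      ∫⁻ ω, symCumulant ρ (|t'| * absSum f j ω) ∂ν ≤ ENNReal.ofReal M := by
    intro t' ht'
    rw [ht']
    calc _ ≤ ∫⁻ ω, ENNReal.ofReal ((1 / cseq n) ^ 2) *
          symCumulant ρ (1 / γ i * absSum f i ω) ∂ν := by
          refine lintegral_mono fun ω => ?_
          refine le_trans (symCumulant_mono (t := 1 / cseq n * (1 / γ i * absSum f i ω)) ?_)
            (symCumulant_mul_le ?_ _)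
          · have h1 := absSum_nonneg f j ω
            have h2 := absSum_nonneg f i ω
            have h3 := absSum_mono f ω (le_max_left j J)
            rw [abs_of_nonneg (by positivity), abs_of_nonneg (by positivity), ht]
            calc _ ≤ 1 / (γ i * cseq n) * absSum f i ω := by gcongr
              _ = _ := by field_simp
          · rw [abs_of_nonneg (by positivity), div_le_one hc0]; exact hcn
      _ ≤ ENNReal.ofReal ((1 / cseq n) ^ 2) * ENNReal.ofReal (D * B i) := by
          rw [lintegral_const_mul' _ _ ENNReal.ofReal_ne_top]
          gcongr
          exact hN₂ i (hJN₂.trans hiJ)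
      _ ≤ _ := by
          rw [← ENNReal.ofReal_mul (by positivity)]
          refine ENNReal.ofReal_le_ofReal ?_
          calc (1 / cseq n) ^ 2 * (D * B i) ≤ (1 / cseq n) ^ 2 * (D * (C₁ * B n)) := by
                gcongr
                exact hN₁ i (hJN₁.trans hiJ) n hin
            _ = D * C₁ * (B n / cseq n ^ 2) := by field_simp
            _ ≤ _ := by rw [hM]; gcongr
  have hexp : ∀ t' : ℝ, |t'| = t → ∫⁻ ω, ENNReal.ofReal
      (Real.exp (t' * (partialSum X (l + j) ω - partialSum X l ω))) ∂P ≤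
        ENNReal.ofReal (Real.exp M) := fun t' ht' =>
    lintegral_exp_increment_le hρ2 hρexp hcum hf hwin hXchar hM0 (hcum_le t' ht') l
  refine (measure_le_abs_le ((measurable_partialSum hXmeas _).sub (measurable_partialSum hXmeas _))
    ht0.le (hexp t (abs_of_pos ht0)) (hexp (-t) (by rw [abs_neg, abs_of_pos ht0])) _).trans ?_
  refine ENNReal.ofReal_le_ofReal ?_
  have hiR : x₀ ≤ (i : ℝ) := hJx.trans (by exact_mod_cast hiJ)
  have hpot' := (hpot i hiR).2 (n / i) ((one_le_div hi0).2 (by exact_mod_cast hin))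
  rw [div_mul_cancel₀ _ hi0.ne'] at hpot'
  have hij : (i : ℝ) ≤ J * j := by
    have : i ≤ J * j := max_le (Nat.le_mul_of_pos_left _ (by lia)) (Nat.le_mul_of_pos_right _ hj1)
    exact_mod_cast this
  have hkey : c₁ * (J : ℝ) ^ (-(α / 2)) * ((n : ℝ) / j) ^ (α / 2) ≤ γ n / γ i := by
    rw [le_div_iff₀ hγi]
    refine le_trans ?_ hpot'
    gcongr ?_ * γ i
    rw [mul_assoc]
    gcongr
    rw [Real.rpow_neg hJ0.le, ← Real.inv_rpow hJ0.le,
      ← Real.mul_rpow (by positivity) (by positivity)]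
    refine Real.rpow_le_rpow (by positivity) ?_ (by linarith)
    rw [inv_mul_eq_div, div_div, mul_comm (j : ℝ)]
    exact div_le_div_of_nonneg_left hn0.le hi0 hij
  have hta : t * (z * aseq n) = bseq n * (γ n / γ i * z) := by
    rw [ht, habn]; field_simp
  rw [hta]
  gcongr
  calc M - bseq n * (γ n / γ i * z) = bseq n * (D * C₁ - γ n / γ i * z) := by rw [hM]; ring
    _ ≤ _ := by gcongr

end Increments

section Chaining

lemma abs_sub_div_mul_pow_le {S D : ℕ → ℝ} {N k : ℕ} (hD : ∀ j, 0 ≤ D j)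
    (h : ∀ j < k, ∀ l, (l + 1) * 2 ^ j ≤ N → |S ((l + 1) * 2 ^ j) - S (l * 2 ^ j)| ≤ D j)
    {i : ℕ} (hi : i ≤ N) : |S i - S (i / 2 ^ k * 2 ^ k)| ≤ ∑ j ∈ Finset.range k, D j := by
  induction k with
  | zero => simp
  | succ k ih =>
    rw [Finset.sum_range_succ]
    refine (abs_sub_le _ (S (i / 2 ^ k * 2 ^ k)) _).trans
      (add_le_add (ih fun j hj => h j (by lia)) ?_)
    have hq : i / 2 ^ (k + 1) = i / 2 ^ k / 2 := by rw [pow_succ, Nat.div_div_eq_div_mul]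
    rw [hq, pow_succ, mul_comm (2 ^ k) 2, ← mul_assoc]
    rcases Nat.mod_two_eq_zero_or_one (i / 2 ^ k) with h0 | h1
    · rw [show i / 2 ^ k / 2 * 2 = i / 2 ^ k by lia, sub_self, abs_zero]
      exact hD k
    · have e : i / 2 ^ k = i / 2 ^ k / 2 * 2 + 1 := by lia
      have hle : (i / 2 ^ k / 2 * 2 + 1) * 2 ^ k ≤ N := by
        rw [← e]; exact (Nat.div_mul_le_self _ _).trans hi
      have := h k (by lia) (i / 2 ^ k / 2 * 2) hle
      rwa [← e] at this

/-- Dyadic chaining for the oscillation of a sequence. -/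
lemma abs_sub_le_of_dyadic {S D : ℕ → ℝ} {N k : ℕ} (hD : ∀ j, 0 ≤ D j)
    (h : ∀ j ≤ k, ∀ l, (l + 1) * 2 ^ j ≤ N → |S ((l + 1) * 2 ^ j) - S (l * 2 ^ j)| ≤ D j)
    {i i' : ℕ} (hii' : i ≤ i') (hi' : i' ≤ N) (hd : i' ≤ i + 2 ^ k) :
    |S i' - S i| ≤ 2 * ∑ j ∈ Finset.range (k + 1), D j := by
  have h1 := abs_sub_div_mul_pow_le (k := k) hD (fun j hj => h j hj.le) (hii'.trans hi')
  have h2 := abs_sub_div_mul_pow_le (k := k) hD (fun j hj => h j hj.le) hi'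
  have hpos : 0 < 2 ^ k := by positivity
  have h3 : |S (i' / 2 ^ k * 2 ^ k) - S (i / 2 ^ k * 2 ^ k)| ≤ D k := by
    have hle : i / 2 ^ k ≤ i' / 2 ^ k := Nat.div_le_div_right hii'
    have hge : i' / 2 ^ k ≤ i / 2 ^ k + 1 := by
      rw [← Nat.add_div_right _ hpos]; exact Nat.div_le_div_right hd
    rcases (show i' / 2 ^ k = i / 2 ^ k ∨ i' / 2 ^ k = i / 2 ^ k + 1 by lia) with e | e
    · rw [e, sub_self, abs_zero]; exact hD k
    · rw [e]
      exact h k le_rfl _ (by rw [← e]; exact (Nat.div_mul_le_self _ _).trans hi')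
  rw [Finset.sum_range_succ]
  have := hD k
  rw [abs_le] at *
  constructor <;> linarith [h1.1, h1.2, h2.1, h2.2, h3.1, h3.2]

lemma abs_interp_sub_le {x y z θ M : ℝ} (h0 : 0 ≤ θ) (h1 : θ ≤ 1) (hx : |x - z| ≤ M)
    (hy : |y - z| ≤ M) : |x + θ * (y - x) - z| ≤ M := by
  rw [abs_le] at *
  constructor <;> nlinarith [hx.1, hx.2, hy.1, hy.2]

/-- The linear interpolation of a sequence. -/
def interp (S : ℕ → ℝ) (x : ℝ) : ℝ := S ⌊x⌋₊ + (x - ⌊x⌋₊) * (S (⌊x⌋₊ + 1) - S ⌊x⌋₊)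

lemma abs_interp_sub_interp_le {S : ℕ → ℝ} {N L : ℕ} {M : ℝ}
    (h : ∀ i i', i ≤ i' → i' ≤ N + 1 → i' ≤ i + L → |S i' - S i| ≤ M)
    {x y d : ℝ} (hx0 : 0 ≤ x) (hy0 : 0 ≤ y) (hxN : x ≤ N) (hyN : y ≤ N) (hd : |x - y| < d)
    (hL : d + 2 ≤ L) : |interp S x - interp S y| ≤ M := by
  have hfx := Nat.floor_le hx0
  have hfx' := Nat.lt_floor_add_one x
  have hfy := Nat.floor_le hy0
  have hfy' := Nat.lt_floor_add_one y
  have hxi : ⌊x⌋₊ ≤ N := Nat.floor_le_of_le hxN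
  have hyi : ⌊y⌋₊ ≤ N := Nat.floor_le_of_le hyN
  rw [abs_lt] at hd
  have hxy : ⌊x⌋₊ + 1 ≤ ⌊y⌋₊ + L := by
    have : ((⌊x⌋₊ + 1 : ℕ) : ℝ) ≤ ((⌊y⌋₊ + L : ℕ) : ℝ) := by push_cast; linarith
    exact_mod_cast this
  have hyx : ⌊y⌋₊ + 1 ≤ ⌊x⌋₊ + L := by
    have : ((⌊y⌋₊ + 1 : ℕ) : ℝ) ≤ ((⌊x⌋₊ + L : ℕ) : ℝ) := by push_cast; linarith
    exact_mod_cast this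
  have hsym : ∀ i i', i ≤ N + 1 → i' ≤ N + 1 → i' ≤ i + L → i ≤ i' + L → |S i' - S i| ≤ M := by
    intro i i' hi hi' h1 h2
    rcases le_total i i' with hle | hle
    · exact h i i' hle hi' h1
    · rw [abs_sub_comm]; exact h i' i hle hi h2
  have key : ∀ i, i = ⌊x⌋₊ ∨ i = ⌊x⌋₊ + 1 → |interp S y - S i| ≤ M := fun i hi =>
    abs_interp_sub_le (by linarith) (by linarith) (hsym _ _ (by lia) (by lia) (by lia) (by lia))
      (hsym _ _ (by lia) (by lia) (by lia) (by lia))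
  refine abs_interp_sub_le (by linarith) (by linarith) ?_ ?_
  · rw [abs_sub_comm]; exact key _ (Or.inl rfl)
  · rw [abs_sub_comm]; exact key _ (Or.inr rfl)

lemma sum_rpow_dyadic_le {h : ℝ} (hh : 0 < h) {n : ℝ} (hn : 0 < n) (k : ℕ) :
    ∑ j ∈ Finset.range (k + 1), ((2 : ℝ) ^ j / n) ^ h ≤
      (1 - (2 : ℝ) ^ (-h))⁻¹ * ((2 : ℝ) ^ k / n) ^ h := by
  have hq : (2 : ℝ) ^ (-h) < 1 := Real.rpow_lt_one_of_one_lt_of_neg one_lt_two (by linarith)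
  have hq0 : (0 : ℝ) < 2 ^ (-h) := by positivity
  have hq1 : 0 < 1 - (2 : ℝ) ^ (-h) := by linarith
  induction k with
  | zero =>
    simp only [zero_add, Finset.range_one, Finset.sum_singleton]
    exact le_mul_of_one_le_left (by positivity) ((one_le_inv₀ hq1).2 (by linarith))
  | succ k ih =>
    rw [Finset.sum_range_succ]
    have e : ((2 : ℝ) ^ k / n) ^ h = 2 ^ (-h) * ((2 : ℝ) ^ (k + 1) / n) ^ h := by
      rw [Real.rpow_neg two_pos.le, ← Real.inv_rpow two_pos.le,
        ← Real.mul_rpow (by norm_num) (by positivity)]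
      congr 1
      rw [pow_succ]; field_simp
    refine (add_le_add_left ih _).trans (le_of_eq ?_)
    rw [e]
    field_simp
    ring

end Chaining

section Modulus

variable {Ω : Type*} [MeasurableSpace Ω] {P : Measure Ω} {X : ℤ → Ω → ℝ} {aseq bseq : ℕ → ℝ}

/-- The event that the modulus of continuity of the polygonal process exceeds `ε`. -/
def oscEvent {Ω : Type*} (X : ℤ → Ω → ℝ) (aseq : ℕ → ℝ) (n : ℕ) (u ε : ℝ) : Set Ω :=
  {ω | ∃ s t : Set.Icc (0:ℝ) 1, |(s : ℝ) - (t : ℝ)| < u ∧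
      ε < |UniformFun.toFun (Ytil X aseq n ω) s - UniformFun.toFun (Ytil X aseq n ω) t|}

lemma oscEvent_mono {Ω : Type*} (X : ℤ → Ω → ℝ) (aseq : ℕ → ℝ) (n : ℕ) {u v : ℝ} (h : u ≤ v)
    (ε : ℝ) : oscEvent X aseq n u ε ⊆ oscEvent X aseq n v ε :=
  fun _ ⟨s, t, hst, hε⟩ => ⟨s, t, hst.trans_le h, hε⟩

lemma Ytil_apply {Ω : Type*} (X : ℤ → Ω → ℝ) (aseq : ℕ → ℝ) (n : ℕ) (ω : Ω)
    (t : Set.Icc (0:ℝ) 1) : UniformFun.toFun (Ytil X aseq n ω) t =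
      (aseq n)⁻¹ * interp (fun k => partialSum X k ω) (n * (t : ℝ)) := by
  have : partialSum X (⌊(n : ℝ) * (t : ℝ)⌋₊ + 1) ω - partialSum X ⌊(n : ℝ) * (t : ℝ)⌋₊ ω =
      X ((⌊(n : ℝ) * (t : ℝ)⌋₊ : ℤ) + 1) ω := by
    rw [partialSum_add_sub]; simp
  simp only [interp, this]
  rfl

/-- If the oscillation is large then some dyadic increment is large. -/
lemma oscEvent_subset {Ω : Type*} {X : ℤ → Ω → ℝ} {aseq : ℕ → ℝ} {n k : ℕ} {u ε : ℝ} (han : 0 < aseq n) (hk : n * u + 2 ≤ 2 ^ k)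
    {z : ℕ → ℝ} (hz : ∀ j, 0 ≤ z j) (hsum : 2 * ∑ j ∈ Finset.range (k + 1), z j ≤ ε) :
    oscEvent X aseq n u ε ⊆ ⋃ j ∈ Finset.range (k + 1), ⋃ l ∈ Finset.range ((n + 1) / 2 ^ j),
      {ω | z j * aseq n ≤ |partialSum X (l * 2 ^ j + 2 ^ j) ω - partialSum X (l * 2 ^ j) ω|} := by
  rintro ω ⟨s, t, hst, hε⟩
  by_contra hcon
  simp only [mem_iUnion, not_exists, Set.mem_ofPred_eq, not_le, Finset.mem_range] at hcon
  have hdy : ∀ j ≤ k, ∀ l, (l + 1) * 2 ^ j ≤ n + 1 →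
      |partialSum X ((l + 1) * 2 ^ j) ω - partialSum X (l * 2 ^ j) ω| ≤ z j * aseq n := by
    intro j hj l hl
    rw [add_mul, one_mul]
    refine (hcon j (by lia) l ?_).le
    have := (Nat.le_div_iff_mul_le (by positivity)).2 hl
    lia
  have hosc := abs_interp_sub_interp_le (S := fun k => partialSum X k ω) (N := n) (L := 2 ^ k)
    (M := 2 * ∑ j ∈ Finset.range (k + 1), z j * aseq n)
    (fun i i' h1 h2 h3 => abs_sub_le_of_dyadic (S := fun k => partialSum X k ω)
      (fun j => mul_nonneg (hz j) han.le) hdy h1 h2 h3)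
    (x := n * (s : ℝ)) (y := n * (t : ℝ)) (d := n * u)
    (mul_nonneg n.cast_nonneg s.2.1) (mul_nonneg n.cast_nonneg t.2.1)
    (mul_le_of_le_one_right n.cast_nonneg s.2.2) (mul_le_of_le_one_right n.cast_nonneg t.2.2)
  rcases Nat.eq_zero_or_pos n with rfl | hn
  · rw [Ytil_apply, Ytil_apply] at hε
    simp only [Nat.cast_zero, zero_mul, sub_self, abs_zero] at hε
    have : 0 ≤ 2 * ∑ j ∈ Finset.range (k + 1), z j :=
      mul_nonneg two_pos.le (Finset.sum_nonneg fun j _ => hz j)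
    linarith
  have hn0 : (0 : ℝ) < n := by exact_mod_cast hn
  have hosc' := hosc (by rw [← mul_sub, abs_mul, abs_of_pos hn0]; gcongr) (by exact_mod_cast hk)
  rw [Ytil_apply, Ytil_apply, ← mul_sub, abs_mul, abs_of_pos (inv_pos.2 han), ← Finset.sum_mul,
    ← mul_assoc] at *
  have : (aseq n)⁻¹ * |interp (fun k => partialSum X k ω) (n * (s : ℝ)) -
      interp (fun k => partialSum X k ω) (n * (t : ℝ))| ≤ ε := by
    rw [inv_mul_le_iff₀ han, mul_comm (aseq n)]
    exact hosc'.trans (mul_le_mul_of_nonneg_right hsum han.le)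
  linarith

lemma exists_sq_mul_exp_le {c h : ℝ} (hc : 0 < c) (hh : 0 < h) :
    ∃ K > (0 : ℝ), ∀ x ≥ (1 : ℝ), x ^ 2 * Real.exp (-(c * x ^ h)) ≤ K := by
  obtain ⟨N, hN⟩ := exists_nat_ge (2 / h)
  refine ⟨N.factorial / c ^ N, by positivity, fun x hx => ?_⟩
  have hx0 : 0 < x := by linarith
  have h1 : (c * x ^ h) ^ N / N.factorial ≤ Real.exp (c * x ^ h) :=
    Real.pow_div_factorial_le_exp _ (by positivity) N
  have h2 : x ^ 2 ≤ (x ^ h) ^ N := by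
    rw [← Real.rpow_natCast, ← Real.rpow_natCast, ← Real.rpow_mul hx0.le]
    refine Real.rpow_le_rpow_of_exponent_le hx ?_
    rw [div_le_iff₀ hh] at hN
    push_cast; linarith
  rw [Real.exp_neg, ← div_eq_mul_inv, div_le_iff₀ (Real.exp_pos _)]
  calc x ^ 2 ≤ (x ^ h) ^ N := h2
    _ = N.factorial / c ^ N * ((c * x ^ h) ^ N / N.factorial) := by
        rw [mul_pow]; field_simp
    _ ≤ _ := by gcongr

/-- Exponential control of the modulus of continuity of the polygonal processes. -/
lemma IncrementTail.exists_oscEvent_le {C lam s : ℝ} (h : IncrementTail P X aseq bseq C lam s)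
    (hlam : 0 < lam) (hs : 0 < s) (ha : ∀ᶠ n in atTop, 0 < aseq n)
    (hb : Tendsto bseq atTop atTop) {ε : ℝ} (hε : 0 < ε) (p : ℝ) :
    ∃ u > (0 : ℝ), ∀ᶠ n in atTop,
      P (oscEvent X aseq n u ε) ≤ ENNReal.ofReal (Real.exp (-(bseq n * p))) := by
  set e := s / 2 with he
  have he0 : 0 < e := by linarith
  obtain ⟨K, hK, hKx⟩ := exists_sq_mul_exp_le (c := lam / 4) (by linarith) he0
  have hG : 0 < (1 - (2 : ℝ) ^ (-e))⁻¹ := by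
    have : (2 : ℝ) ^ (-e) < 1 := Real.rpow_lt_one_of_one_lt_of_neg one_lt_two (by linarith)
    exact inv_pos.2 (by linarith)
  set G := (1 - (2 : ℝ) ^ (-e))⁻¹ with hGdef
  have hR : Tendsto (fun R : ℝ => R ^ e) atTop atTop := tendsto_rpow_atTop he0
  obtain ⟨R, hR1, hRC, hRp, hRε⟩ := ((eventually_ge_atTop 1).and
    (((hR.const_mul_atTop (by linarith : 0 < lam / 2)).eventually_ge_atTop C).and
    (((hR.const_mul_atTop (by linarith : 0 < lam / 4)).eventually_ge_atTop (p + 1)).and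
      (hR.eventually_ge_atTop (2 * G / ε))))).exists
  have hR0 : 0 < R := by linarith
  refine ⟨1 / (4 * R), by positivity, ?_⟩
  filter_upwards [h, ha, hb.eventually_ge_atTop 1, hb.eventually_ge_atTop (Real.log (8 * K)),
    eventually_ge_atTop ⌈8 * R⌉₊, eventually_ge_atTop 1] with n hn han hbn hbK hnR hn1
  set u := 1 / (4 * R) with hu
  have hu0 : 0 < u := by positivity
  have hn0 : (0 : ℝ) < n := by exact_mod_cast hn1
  have hnu : 2 ≤ n * u := by
    have : 8 * R ≤ n := (Nat.le_ceil _).trans (by exact_mod_cast hnR)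
    rw [hu, mul_one_div, le_div_iff₀ (by positivity)]; linarith
  obtain ⟨k', hk1, hk2⟩ := exists_nat_pow_near (x := n * u + 2) (y := 2) (by linarith) one_lt_two
  set k := k' + 1 with hk
  have hkn : (2 : ℝ) ^ k ≤ n / R := by
    rw [hk, pow_succ]
    calc (2 : ℝ) ^ k' * 2 ≤ (n * u + 2) * 2 := by gcongr
      _ ≤ 4 * (n * u) := by linarith
      _ = n / R := by rw [hu]; field_simp
  have hx : ∀ j ≤ k, R ≤ (n : ℝ) / 2 ^ j := fun j hj => by
    rw [le_div_iff₀ (by positivity)]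
    rw [le_div_iff₀ hR0] at hkn
    have : (2 : ℝ) ^ j ≤ 2 ^ k := pow_le_pow_right₀ one_le_two hj
    nlinarith
  have hzsum : 2 * ∑ j ∈ Finset.range (k + 1), ((2 : ℝ) ^ j / n) ^ e ≤ ε := by
    have h1 := sum_rpow_dyadic_le he0 hn0 k
    rw [← hGdef] at h1
    have h2 : ((2 : ℝ) ^ k / n) ^ e ≤ (R ^ e)⁻¹ := by
      rw [← Real.inv_rpow hR0.le]
      refine Real.rpow_le_rpow (by positivity) ?_ he0.le
      rw [div_le_iff₀ hn0, inv_mul_eq_div]; exact hkn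
    have h3 : 2 * G * (R ^ e)⁻¹ ≤ ε := by
      have hRe : 0 < R ^ e := by positivity
      rw [← div_eq_mul_inv, div_le_iff₀ hRe]
      rw [div_le_iff₀ hε] at hRε
      linarith
    nlinarith [mul_le_mul_of_nonneg_left h2 hG.le]
  have hsub := oscEvent_subset (X := X) (ε := ε) han (by exact_mod_cast hk2.le)
    (z := fun j => ((2 : ℝ) ^ j / n) ^ e) (fun j => by positivity) hzsum
  have hlevel : ∀ j ∈ Finset.range (k + 1), P (⋃ l ∈ Finset.range ((n + 1) / 2 ^ j),
      {ω | ((2 : ℝ) ^ j / n) ^ e * aseq n ≤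
        |partialSum X (l * 2 ^ j + 2 ^ j) ω - partialSum X (l * 2 ^ j) ω|}) ≤
      ENNReal.ofReal (4 * K * Real.exp (-(bseq n * (p + 1))) * ((2 : ℝ) ^ j / n)) := by
    intro j hj
    have hjk : j ≤ k := by have := Finset.mem_range.1 hj; lia
    have hxj := hx j hjk
    set x := (n : ℝ) / 2 ^ j with hxdef
    have hx1 : 1 ≤ x := hR1.trans hxj
    have hx0 : 0 < x := by linarith
    have hinv : (2 : ℝ) ^ j / n = x⁻¹ := by rw [hxdef, inv_div]
    rw [hinv]
    have hjn : 2 ^ j ≤ n := by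
      have : (2 : ℝ) ^ j ≤ n := by rw [hxdef, le_div_iff₀ (by positivity)] at hx1; linarith
      exact_mod_cast this
    have hterm : ∀ l, P {ω | (x⁻¹) ^ e * aseq n ≤
        |partialSum X (l * 2 ^ j + 2 ^ j) ω - partialSum X (l * 2 ^ j) ω|} ≤
        ENNReal.ofReal (2 * Real.exp (bseq n * (C - lam * x ^ e))) := by
      intro l
      refine (hn (l * 2 ^ j) (2 ^ j) Nat.one_le_two_pow hjn ((x⁻¹) ^ e) (by positivity)).trans_eq ?_
      congr 4
      rw [Nat.cast_pow, Nat.cast_ofNat, ← hxdef, mul_assoc, Real.inv_rpow hx0.le, he,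
        show s = s / 2 + s / 2 by ring, Real.rpow_add hx0, ← show s = s / 2 + s / 2 by ring]
      field_simp
    have hcount : (((n + 1) / 2 ^ j : ℕ) : ℝ) ≤ 2 * x := by
      refine Nat.cast_div_le.trans ?_
      rw [hxdef, ← mul_div_assoc]
      push_cast
      gcongr
      have : (1 : ℝ) ≤ n := by exact_mod_cast hn1
      linarith
    refine (measure_biUnion_finset_le _ _).trans ((Finset.sum_le_sum fun l _ => hterm l).trans ?_)
    rw [Finset.sum_const, Finset.card_range, nsmul_eq_mul, ← ENNReal.ofReal_natCast,
      ← ENNReal.ofReal_mul (Nat.cast_nonneg _)]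
    refine ENNReal.ofReal_le_ofReal ?_
    have hxe : R ^ e ≤ x ^ e := Real.rpow_le_rpow hR0.le hxj he0.le
    have hxe0 : 0 < x ^ e := by positivity
    have hexp : Real.exp (bseq n * (C - lam * x ^ e)) ≤
        Real.exp (-(bseq n * (p + 1))) * Real.exp (-(lam / 4 * x ^ e)) := by
      rw [← Real.exp_add]
      refine Real.exp_le_exp.2 ?_
      have h1 : C - lam * x ^ e ≤ -(p + 1) - lam / 4 * x ^ e := by nlinarith
      have h2 : lam / 4 * x ^ e ≤ bseq n * (lam / 4 * x ^ e) :=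
        le_mul_of_one_le_left (by positivity) hbn
      nlinarith
    calc _ ≤ 2 * x * (2 * (Real.exp (-(bseq n * (p + 1))) * Real.exp (-(lam / 4 * x ^ e)))) := by
          gcongr
      _ = 4 * Real.exp (-(bseq n * (p + 1))) * (x ^ 2 * Real.exp (-(lam / 4 * x ^ e))) * x⁻¹ := by
          field_simp; ring
      _ ≤ 4 * Real.exp (-(bseq n * (p + 1))) * K * x⁻¹ := by
          gcongr; exact hKx x hx1
      _ = _ := by ring
  refine (measure_mono hsub).trans ((measure_biUnion_finset_le _ _).trans
    ((Finset.sum_le_sum hlevel).trans ?_))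
  rw [← ENNReal.ofReal_sum_of_nonneg fun j _ => by positivity]
  refine ENNReal.ofReal_le_ofReal ?_
  rw [← Finset.mul_sum, ← Finset.sum_div]
  have hgeo : (∑ j ∈ Finset.range (k + 1), (2 : ℝ) ^ j) / n ≤ 2 := by
    rw [div_le_iff₀ hn0, geom_sum_eq (by norm_num)]
    have : (2 : ℝ) ^ k ≤ n := hkn.trans (div_le_self hn0.le hR1)
    rw [pow_succ]; linarith
  have hKexp : 8 * K ≤ Real.exp (bseq n) := (Real.log_le_iff_le_exp (by positivity)).1 hbK
  calc _ ≤ 4 * K * Real.exp (-(bseq n * (p + 1))) * 2 := by gcongr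
    _ = 8 * K * Real.exp (-(bseq n * (p + 1))) := by ring
    _ ≤ Real.exp (bseq n) * Real.exp (-(bseq n * (p + 1))) := by gcongr
    _ = _ := by rw [← Real.exp_add]; ring_nf

end Modulus

section Tightness

/-- The paths started at `0` whose modulus of continuity at `u k` is at most `1/(k+1)`. -/
def modulusSet (u : ℕ → ℝ) : Set Dsp :=
  {ξ | UniformFun.toFun ξ 0 = 0 ∧ ∀ (k : ℕ) (s t : Set.Icc (0:ℝ) 1), |(s : ℝ) - (t : ℝ)| < u k →
    |UniformFun.toFun ξ s - UniformFun.toFun ξ t| ≤ 1 / ((k : ℝ) + 1)}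

lemma abs_le_of_modulus {F : Set.Icc (0:ℝ) 1 → ℝ} {u : ℝ} {N : ℕ} (hN : 1 < N * u)
    (h0 : F 0 = 0) (h : ∀ s t : Set.Icc (0:ℝ) 1, |(s : ℝ) - (t : ℝ)| < u → |F s - F t| ≤ 1)
    (t : Set.Icc (0:ℝ) 1) : |F t| ≤ N := by
  have hN0 : (0 : ℝ) < N := by
    rcases Nat.eq_zero_or_pos N with rfl | h
    · norm_num at hN
    · exact_mod_cast h
  have hmem : ∀ i ≤ N, (i : ℝ) / N * t ∈ Set.Icc (0:ℝ) 1 := fun i hi =>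
    ⟨mul_nonneg (by positivity) t.2.1,
      mul_le_one₀ ((div_le_one hN0).2 (by exact_mod_cast hi)) t.2.1 t.2.2⟩
  have key : ∀ i (hi : i ≤ N), |F ⟨(i : ℝ) / N * t, hmem i hi⟩| ≤ i := by
    intro i
    induction i with
    | zero =>
      intro hi
      have : (⟨((0 : ℕ) : ℝ) / N * t, hmem 0 hi⟩ : Set.Icc (0:ℝ) 1) = 0 := by ext; simp
      rw [this, h0]; simp
    | succ i ih =>
      intro hi
      have h1 := ih (by lia)
      have h2 := h ⟨((i + 1 : ℕ) : ℝ) / N * t, hmem _ hi⟩ ⟨(i : ℝ) / N * t, hmem i (by lia)⟩ (by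
        have e : ((i + 1 : ℕ) : ℝ) / N * t - (i : ℝ) / N * t = t / N := by push_cast; ring
        rw [e, abs_of_nonneg (div_nonneg t.2.1 hN0.le), div_lt_iff₀ hN0]
        linarith [t.2.2])
      push_cast at *
      rw [abs_le] at *
      constructor <;> linarith [h1.1, h1.2, h2.1, h2.2]
  have e : (⟨(N : ℝ) / N * t, hmem N le_rfl⟩ : Set.Icc (0:ℝ) 1) = t := by
    ext; simp [hN0.ne']
  simpa only [e] using key N le_rfl

lemma isCompact_modulusSet {u : ℕ → ℝ} (hu : ∀ k, 0 < u k) : IsCompact (modulusSet u) := by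
  let A : Set (Set.Icc (0:ℝ) 1 →ᵇ ℝ) := {F | F 0 = 0 ∧ ∀ (k : ℕ) (s t : Set.Icc (0:ℝ) 1),
    |(s : ℝ) - (t : ℝ)| < u k → |F s - F t| ≤ 1 / ((k : ℝ) + 1)}
  obtain ⟨N, hN⟩ := exists_nat_gt (1 / u 0)
  rw [div_lt_iff₀ (hu 0)] at hN
  have hA : IsCompact A := by
    refine BoundedContinuousFunction.arzela_ascoli₂ (Metric.closedBall 0 N)
      (isCompact_closedBall _ _) A ?_ ?_ ?_
    · simp only [A, Set.ofPred_and, Set.ofPred_forall]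
      refine (isClosed_eq (by fun_prop) continuous_const).inter ?_
      refine isClosed_iInter fun k => isClosed_iInter fun s => isClosed_iInter fun t =>
        isClosed_iInter fun _ => isClosed_le ?_ continuous_const
      fun_prop
    · intro F t hF
      rw [mem_closedBall_zero_iff, Real.norm_eq_abs]
      exact abs_le_of_modulus hN hF.1 (fun s t hst => (hF.2 0 s t hst).trans (by simp)) t
    · refine UniformEquicontinuous.equicontinuous (Metric.uniformEquicontinuous_iff.2 fun ε hε => ?_)
      obtain ⟨k, hk⟩ := exists_nat_one_div_lt hε
      exact ⟨u k, hu k, fun s t hst F => (F.2.2 k s t hst).trans_lt hk⟩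
  convert hA.image BoundedContinuousFunction.isInducing_coeFn.continuous using 1
  ext ξ
  constructor
  · rintro ⟨h0, h⟩
    have hcont : Continuous (UniformFun.toFun ξ) := by
      refine Metric.continuous_iff.2 fun t ε hε => ?_
      obtain ⟨k, hk⟩ := exists_nat_one_div_lt hε
      exact ⟨u k, hu k, fun s hst => (h k s t hst).trans_lt hk⟩
    exact ⟨BoundedContinuousFunction.mkOfCompact ⟨UniformFun.toFun ξ, hcont⟩, ⟨h0, h⟩, rfl⟩
  · rintro ⟨F, hF, rfl⟩
    exact hF

lemma abs_interp_sub_le_mul {S : ℕ → ℝ} {N : ℕ} {M : ℝ} (h : ∀ i ≤ N, |S (i + 1) - S i| ≤ M)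
    {x y : ℝ} (hx : 0 ≤ x) (hxy : x ≤ y) (hy : y ≤ N) :
    |interp S y - interp S x| ≤ M * (y - x) := by
  have hfx := Nat.floor_le hx
  have hfx' := Nat.lt_floor_add_one x
  have hfy := Nat.floor_le (hx.trans hxy)
  have hfy' := Nat.lt_floor_add_one y
  have hyN : ⌊y⌋₊ ≤ N := Nat.floor_le_of_le hy
  have hle : ⌊x⌋₊ ≤ ⌊y⌋₊ := Nat.floor_mono hxy
  have hS : ∀ i j, i ≤ j → j ≤ N → |S j - S i| ≤ M * (j - i) := by
    intro i j hij
    induction j, hij using Nat.le_induction with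
    | base => simp
    | succ j hij ih =>
      intro hj
      have h1 := ih (by lia)
      have h2 := h j (by lia)
      push_cast
      rw [abs_le] at *
      constructor <;> linarith [h1.1, h1.2, h2.1, h2.2]
  have hmul : ∀ i ≤ N, ∀ θ : ℝ, 0 ≤ θ → |θ * (S (i + 1) - S i)| ≤ M * θ := fun i hi θ hθ => by
    rw [abs_mul, abs_of_nonneg hθ, mul_comm]
    exact mul_le_mul_of_nonneg_right (h i hi) hθ
  rcases hle.eq_or_lt with heq | hlt
  · have e : interp S y - interp S x = (y - x) * (S (⌊x⌋₊ + 1) - S ⌊x⌋₊) := by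
      simp only [interp, ← heq]; ring
    rw [e]
    exact hmul _ (hle.trans hyN) _ (by linarith)
  · have e : interp S y - interp S x = (S ⌊y⌋₊ - S (⌊x⌋₊ + 1)) +
        (y - ⌊y⌋₊) * (S (⌊y⌋₊ + 1) - S ⌊y⌋₊) + (⌊x⌋₊ + 1 - x) * (S (⌊x⌋₊ + 1) - S ⌊x⌋₊) := by
      simp only [interp]; ring
    rw [e]
    have h1 := hS _ _ hlt hyN
    have h2 := hmul _ hyN (y - ⌊y⌋₊) (by linarith)
    have h3 := hmul _ (hle.trans hyN) (⌊x⌋₊ + 1 - x) (by linarith)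
    refine (abs_add_three _ _ _).trans ((add_le_add (add_le_add h1 h2) h3).trans_eq ?_)
    push_cast; ring

lemma tendsto_measure_le_atTop {Ω : Type*} [MeasurableSpace Ω] (P : Measure Ω)
    [IsFiniteMeasure P] {Z : Ω → ℝ} (hZ : Measurable Z) :
    Tendsto (fun k : ℕ => P {ω | (k : ℝ) ≤ Z ω}) atTop (𝓝 0) := by
  have h := tendsto_measure_iInter_atTop (μ := P) (s := fun k : ℕ => {ω | (k : ℝ) ≤ Z ω})
    (fun k => (measurableSet_le measurable_const hZ).nullMeasurableSet)
    (fun i j hij ω (hω : (j : ℝ) ≤ Z ω) => (Nat.cast_le.2 hij).trans hω)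
    ⟨0, measure_ne_top _ _⟩
  have he : (⋂ k : ℕ, {ω | (k : ℝ) ≤ Z ω}) = ∅ := by
    refine eq_empty_of_forall_notMem fun ω hω => ?_
    obtain ⟨k, hk⟩ := exists_nat_gt (Z ω)
    exact absurd (mem_iInter.1 hω k) (not_le.2 hk)
  rwa [he, measure_empty] at h

lemma exists_measure_oscEvent_le {Ω : Type*} [MeasurableSpace Ω] {P : Measure Ω}
    [IsFiniteMeasure P] {X : ℤ → Ω → ℝ} (hX : ∀ i, Measurable (X i)) (aseq : ℕ → ℝ) (n : ℕ)
    {ε : ℝ} (hε : 0 < ε) {η : ℝ≥0∞} (hη : 0 < η) :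
    ∃ u > (0 : ℝ), P (oscEvent X aseq n u ε) ≤ η := by
  let Z : Ω → ℝ := fun ω => |(aseq n)⁻¹| * ((∑ i ∈ Finset.range (n + 1), |X ((i : ℤ) + 1) ω|) * n)
  have hZ : Measurable Z := by
    refine measurable_const.mul (Measurable.mul_const ?_ _)
    exact Finset.measurable_sum _ fun i _ => (hX _).abs
  obtain ⟨k, hk, hk1⟩ := (((tendsto_measure_le_atTop P hZ).eventually (ge_mem_nhds hη)).and
    (eventually_ge_atTop 1)).exists
  have hk0 : (0 : ℝ) < k := by exact_mod_cast hk1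
  refine ⟨ε / k, by positivity, (measure_mono ?_).trans hk⟩
  rintro ω ⟨s, t, hst, hlt⟩
  set M := ∑ i ∈ Finset.range (n + 1), |X ((i : ℤ) + 1) ω|
  have hM : ∀ i ≤ n, |partialSum X (i + 1) ω - partialSum X i ω| ≤ M := fun i hi => by
    have e : partialSum X (i + 1) ω - partialSum X i ω = X ((i : ℤ) + 1) ω := by
      rw [partialSum_add_sub]; simp
    rw [e]
    exact Finset.single_le_sum (f := fun i : ℕ => |X ((i : ℤ) + 1) ω|) (fun _ _ => abs_nonneg _)
      (Finset.mem_range.2 (by lia))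
  have hlip : ∀ s t : Set.Icc (0:ℝ) 1, s ≤ t →
      |UniformFun.toFun (Ytil X aseq n ω) s - UniformFun.toFun (Ytil X aseq n ω) t| ≤
        Z ω * |(s : ℝ) - (t : ℝ)| := by
    intro s t hst
    have hst' : (s : ℝ) ≤ t := hst
    rw [Ytil_apply, Ytil_apply, ← mul_sub, abs_mul, abs_sub_comm, abs_sub_comm (s : ℝ),
      abs_of_nonneg (sub_nonneg.2 hst')]
    have h := abs_interp_sub_le_mul (S := fun k => partialSum X k ω) hM
      (mul_nonneg n.cast_nonneg s.2.1) (mul_le_mul_of_nonneg_left hst' n.cast_nonneg)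
      (mul_le_of_le_one_right n.cast_nonneg t.2.2)
    calc _ ≤ |(aseq n)⁻¹| * (M * (n * (t : ℝ) - n * s)) :=
          mul_le_mul_of_nonneg_left h (abs_nonneg _)
      _ = Z ω * (t - s) := by simp only [Z, M]; ring
  have hlip' : |UniformFun.toFun (Ytil X aseq n ω) s - UniformFun.toFun (Ytil X aseq n ω) t| ≤
      Z ω * |(s : ℝ) - (t : ℝ)| := by
    rcases le_total s t with h | h
    · exact hlip s t h
    · rw [abs_sub_comm, abs_sub_comm (s : ℝ)]; exact hlip t s h
  have hZ0 : 0 ≤ Z ω := by positivity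
  have h1 : ε < Z ω * (ε / k) :=
    hlt.trans_le (hlip'.trans (mul_le_mul_of_nonneg_left hst.le hZ0))
  rw [← mul_div_assoc, lt_div_iff₀ hk0, mul_comm] at h1
  exact (lt_of_mul_lt_mul_right h1 hε.le).le

lemma inv_mul_log_le {b p : ℝ} {x : ℝ≥0∞} (hb : 0 < b)
    (hx : x ≤ ENNReal.ofReal (Real.exp (-(b * p)))) :
    ((b⁻¹ : ℝ) : EReal) * ENNReal.log x ≤ ((-p : ℝ) : EReal) := by
  have h := ENNReal.log_monotone hx
  rw [ENNReal.log_ofReal_of_pos (Real.exp_pos _), Real.log_exp] at h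
  refine (mul_le_mul_of_nonneg_left h (by exact_mod_cast (inv_pos.2 hb).le)).trans_eq ?_
  rw [← EReal.coe_mul]
  congr 1
  field_simp

variable {Ω : Type*} [MeasurableSpace Ω] {P : Measure Ω} {X : ℤ → Ω → ℝ} {aseq bseq : ℕ → ℝ}

lemma tendsto_limsup_log_oscEvent (hb : Tendsto bseq atTop atTop) {ε : ℝ}
    (h : ∀ p : ℝ, ∃ u > (0 : ℝ), ∀ᶠ n in atTop,
      P (oscEvent X aseq n u ε) ≤ ENNReal.ofReal (Real.exp (-(bseq n * p)))) :
    Tendsto (fun u : ℝ => limsup (fun n => (((bseq n)⁻¹ : ℝ) : EReal) *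
      ENNReal.log (P (oscEvent X aseq n u ε))) atTop) (𝓝[>] 0) (𝓝 ⊥) := by
  refine EReal.tendsto_nhds_bot_iff_real.2 fun x => ?_
  obtain ⟨u, hu, hn⟩ := h (1 - x)
  filter_upwards [Ioo_mem_nhdsGT hu] with v hv
  refine lt_of_le_of_lt (limsup_le_of_le (by isBoundedDefault) ?_)
    (EReal.coe_lt_coe_iff.2 (by linarith : -(1 - x) < x))
  filter_upwards [hn, hb.eventually_gt_atTop 0] with n hn hbn
  exact inv_mul_log_le hbn ((measure_mono (oscEvent_mono X aseq n hv.2.le ε)).trans hn)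

lemma exists_forall_oscEvent_le [IsFiniteMeasure P] (hX : ∀ i, Measurable (X i)) {ε : ℝ}
    (hε : 0 < ε) {c : ℕ → ℝ} (h : ∃ u > (0 : ℝ), ∀ᶠ n in atTop,
      P (oscEvent X aseq n u ε) ≤ ENNReal.ofReal (Real.exp (c n))) :
    ∃ u > (0 : ℝ), ∀ n, P (oscEvent X aseq n u ε) ≤ ENNReal.ofReal (Real.exp (c n)) := by
  obtain ⟨u, hu, hn⟩ := h
  obtain ⟨N, hN⟩ := eventually_atTop.1 hn
  choose v hv hvP using fun n => exists_measure_oscEvent_le (P := P) hX aseq n hε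
    (ENNReal.ofReal_pos.2 (Real.exp_pos (c n)))
  have hmin : ∀ N : ℕ, ∃ w > (0 : ℝ), ∀ n < N, w ≤ v n := fun N => by
    induction N with
    | zero => exact ⟨1, one_pos, by simp⟩
    | succ N ih =>
      obtain ⟨w, hw, hwN⟩ := ih
      refine ⟨min w (v N), lt_min hw (hv N), fun n hn => ?_⟩
      rcases Nat.lt_succ_iff_lt_or_eq.1 hn with h | rfl
      · exact (min_le_left _ _).trans (hwN n h)
      · exact min_le_right _ _
  obtain ⟨w, hw, hwN⟩ := hmin N
  refine ⟨min u w, lt_min hu hw, fun n => ?_⟩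
  rcases lt_or_ge n N with h | h
  · exact (measure_mono (oscEvent_mono X aseq n ((min_le_right _ _).trans (hwN n h)) ε)).trans
      (hvP n)
  · exact (measure_mono (oscEvent_mono X aseq n (min_le_left _ _) ε)).trans (hN n h)

lemma exists_isCompact_limsup_log_le [IsFiniteMeasure P] (hX : ∀ i, Measurable (X i))
    (hb : Tendsto bseq atTop atTop)
    (h : ∀ ε > (0 : ℝ), ∀ p : ℝ, ∃ u > (0 : ℝ), ∀ᶠ n in atTop,
      P (oscEvent X aseq n u ε) ≤ ENNReal.ofReal (Real.exp (-(bseq n * p)))) (p : ℝ) :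
    ∃ K : Set Dsp, IsCompact K ∧ limsup (fun n => (((bseq n)⁻¹ : ℝ) : EReal) *
      ENNReal.log (Measure.map (Ytil X aseq n) P Kᶜ)) atTop ≤ ((-p : ℝ) : EReal) := by
  choose u hu huP using fun k : ℕ => exists_forall_oscEvent_le (P := P) (aseq := aseq) hX
    (ε := 1 / ((k : ℝ) + 1)) (by positivity) (h (1 / ((k : ℝ) + 1)) (by positivity) (p + k + 1))
  have hK := isCompact_modulusSet hu
  refine ⟨modulusSet u, hK, limsup_le_of_le (by isBoundedDefault) ?_⟩
  filter_upwards [hb.eventually_ge_atTop 1] with n hbn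
  refine inv_mul_log_le (by linarith) ?_
  by_cases hmeas : AEMeasurable (Ytil X aseq n) P
  swap
  · rw [Measure.map_of_not_aemeasurable hmeas]; simp
  have : BorelSpace Dsp := ⟨rfl⟩
  rw [Measure.map_apply_of_aemeasurable hmeas hK.isClosed.measurableSet.compl]
  have hsub : Ytil X aseq n ⁻¹' (modulusSet u)ᶜ ⊆ ⋃ k, oscEvent X aseq n (u k) (1 / ((k : ℝ) + 1)) := by
    intro ω hω
    by_contra hcon
    simp only [mem_iUnion, not_exists] at hcon
    refine hω ⟨?_, fun k s t hst => not_lt.1 fun hlt => hcon k ⟨s, t, hst, hlt⟩⟩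
    rw [Ytil_apply]
    simp [interp, partialSum]
  refine (measure_mono hsub).trans ((measure_iUnion_le _).trans ?_)
  have hterm : ∀ k : ℕ, P (oscEvent X aseq n (u k) (1 / ((k : ℝ) + 1))) ≤
      ENNReal.ofReal (Real.exp (-(bseq n * p))) * 2⁻¹ ^ (k + 1) := fun k => by
    refine (huP k n).trans ?_
    have e : (2⁻¹ : ℝ≥0∞) ^ (k + 1) = ENNReal.ofReal ((2⁻¹ : ℝ) ^ (k + 1)) := by
      rw [ENNReal.ofReal_pow (by norm_num), ENNReal.ofReal_inv_of_pos two_pos]; simp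
    rw [e, ← ENNReal.ofReal_mul (Real.exp_pos _).le]
    refine ENNReal.ofReal_le_ofReal ?_
    have h2 : Real.exp (-1) ≤ 2⁻¹ := by
      rw [Real.exp_neg]
      exact inv_anti₀ two_pos (by linarith [Real.add_one_le_exp (1 : ℝ)])
    calc Real.exp (-(bseq n * (p + k + 1)))
        ≤ Real.exp (-(bseq n * p) + (k + 1 : ℕ) * (-1)) := by
          refine Real.exp_le_exp.2 ?_
          push_cast
          nlinarith [(Nat.cast_nonneg k : (0 : ℝ) ≤ k)]
      _ = Real.exp (-(bseq n * p)) * Real.exp (-1) ^ (k + 1) := by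
          rw [Real.exp_add, Real.exp_nat_mul]
      _ ≤ _ := by gcongr
  refine (ENNReal.tsum_le_tsum hterm).trans_eq ?_
  rw [ENNReal.tsum_mul_left, ENNReal.tsum_geometric_add_one, ENNReal.one_sub_inv_two, inv_inv,
    ENNReal.inv_mul_cancel two_ne_zero ENNReal.ofNat_ne_top, mul_one]

end Tightness

section Assembly

variable {E : Type*} [MeasurableSpace E] {κ : Kernel E E} {Pm : E → Measure (ℕ → E)}
  {π : Measure E} {a : Set E} {xa : E} {γ : ℝ → ℝ} {α : ℝ}

lemma setOf_avoid_eq {E : Type*} (a : Set E) {x : ℝ} (hx : 0 ≤ x) :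
    {ω : ℕ → E | ∀ n : ℕ, 0 < n → (n : ℝ) ≤ x → ω n ∉ a} =
      {ω | ((⌊x⌋₊ : ℕ) : ℕ∞) < hitT a ω} := by
  ext ω
  simp only [Set.mem_ofPred_eq, lt_hitT_iff, Nat.le_floor_iff hx]

lemma isRegenerative_of_harris [SigmaFinite π] (hlaw : IsChainLaw κ Pm)
    (hHarris : ∀ A : Set E, MeasurableSet A → 0 < π A → ∀ x,
      Pm x {ω | ∀ N : ℕ, ∃ n ≥ N, ω n ∈ A} = 1)
    (hameas : MeasurableSet a) (hπa : 0 < π a) (hπafin : π a ≠ ⊤)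
    (hatom : ∀ x ∈ a, ∀ y ∈ a, κ x = κ y) (hxa : xa ∈ a) (hα0 : 0 < α) (hα1 : α < 1)
    (hγdef : ∀ x : ℝ, γ x =
      ((π a).toReal * (Pm xa {ω | ∀ n : ℕ, 0 < n → (n : ℝ) ≤ x → ω n ∉ a}).toReal)⁻¹)
    (hγRV : RegVary γ α) {f : E → ℝ} (hf : Measurable f) {δ l : ℝ} (hδ : 1 ≤ δ)
    (hδα : δ < (1 - α)⁻¹) (hl : 0 < l) {C : ℝ≥0∞} (hC : C ≠ ⊤)
    (hcycle : ∀ x : E, (∫⁻ ω, ENNReal.ofReal (Real.exp ((l * cycleSum a f ω) ^ δ)) ∂(Pm x)) ≤ C) :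
    IsRegenerative κ Pm a xa γ α ((π a).toReal)⁻¹ f δ l (max 1 C.toReal) := by
  have hprob := hlaw.prob
  have hp : 0 < (π a).toReal := ENNReal.toReal_pos hπa.ne' hπafin
  set G : ℝ → ℝ := fun x => (Pm xa {ω | ∀ n : ℕ, 0 < n → (n : ℝ) ≤ x → ω n ∉ a}).toReal with hG
  have hγG : ∀ x, γ x = ((π a).toReal * G x)⁻¹ := hγdef
  have hGanti : Antitone G := fun x y hxy =>
    ENNReal.toReal_mono (measure_ne_top _ _)
      (measure_mono fun ω hω n hn hnx => hω n hn (hnx.trans hxy))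
  have hGpos : ∀ x, 0 < G x := by
    intro x
    have h1 := hγRV 1 one_pos
    rw [Real.one_rpow] at h1
    obtain ⟨t, ht, htx⟩ := ((h1.eventually (lt_mem_nhds zero_lt_one)).and
      (eventually_ge_atTop x)).exists
    have ht0 : γ t ≠ 0 := fun h => by simp [h] at ht
    have hGt : G t ≠ 0 := fun h => ht0 (by rw [hγG, h]; simp)
    exact ((ENNReal.toReal_nonneg).lt_of_ne' hGt).trans_le (hGanti htx)
  have hγpos : ∀ x, 0 < γ x := fun x => by
    rw [hγG]; exact inv_pos.2 (mul_pos hp (hGpos x))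
  refine ⟨hlaw, hameas, hatom, hxa, fun x => ?_, fun x y hxy => ?_, hγpos, hγRV, hα0,
    inv_pos.2 hp, fun x hx => ?_, hf, hδ, ?_, hl, le_max_left _ _, fun x => ?_⟩
  · have hmeas : MeasurableSet {ω : ℕ → E | ∀ N : ℕ, ∃ n ≥ N, ω n ∈ a} := by
      have e : {ω : ℕ → E | ∀ N : ℕ, ∃ n ≥ N, ω n ∈ a} =
          ⋂ N : ℕ, ⋃ n : ℕ, ⋃ _ : n ≥ N, (fun ω : ℕ → E => ω n) ⁻¹' a := by
        ext ω; simp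
      rw [e]
      exact MeasurableSet.iInter fun N => MeasurableSet.iUnion fun n => MeasurableSet.iUnion
        fun _ => measurable_pi_apply n hameas
    filter_upwards [(mem_ae_iff_prob_eq_one hmeas).2 (hHarris a hameas hπa x)] with ω hω
    obtain ⟨n, hn, hna⟩ := hω 1
    intro htop
    have := (lt_hitT_iff a ω n).1 (htop ▸ ENat.natCast_lt_top n)
    exact this n hn le_rfl hna
  · rw [hγG, hγG]
    exact inv_anti₀ (mul_pos hp (hGpos y)) (mul_le_mul_of_nonneg_left (hGanti hxy) hp.le)
  · rw [← setOf_avoid_eq a hx, hγG, div_inv_eq_mul, ← mul_assoc, inv_mul_cancel₀ hp.ne', one_mul,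
      ENNReal.ofReal_toReal (measure_ne_top _ _)]
  · rwa [lt_inv_comm₀ (by linarith) (by linarith), ← one_div, lt_div_iff₀ (by linarith),
      mul_comm] at hδα
  · refine (hcycle x).trans ?_
    rw [← ENNReal.ofReal_toReal hC]
    refine ENNReal.ofReal_le_ofReal ?_
    rw [ENNReal.toReal_ofReal ENNReal.toReal_nonneg]
    exact le_max_right _ _

lemma map_eval_of_marginals {m : Measure (ℤ → E)}
    (hm : ∀ (n : ℤ) (k : ℕ) (A : ℕ → Set E), (∀ i, MeasurableSet (A i)) →
      m {s | ∀ i ≤ k, s (n + (i : ℤ)) ∈ A i}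
        = ∫⁻ x in A 0, stepProb κ (fun i => A (i + 1)) k x ∂π) (n : ℤ) :
    m.map (fun s => s n) = π := by
  ext A hA
  rw [Measure.map_apply (measurable_pi_apply n) hA]
  have h := hm n 0 (fun _ => A) fun _ => hA
  simp only [stepProb, lintegral_one, Measure.restrict_apply_univ, Nat.le_zero, forall_eq,
    Nat.cast_zero, add_zero] at h
  exact h

end Assembly

/-- **Lemma 5.3 (Exponential tightness of the polygonal processes in the sup norm).** -/
theorem exponential_tightness
    /- the state space and the Markov kernel -/
    {E : Type*} [MeasurableSpace E] (κ : Kernel E E) [IsMarkovKernel κ]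
    (π : Measure E) [SigmaFinite π]
    (hinv : Measure.bind π (fun x => κ x) = π)
    (hnull : π Set.univ = ⊤)
    /- the laws `P_x` of the chain started at `x` -/
    (Pm : E → Measure (ℕ → E)) (hPmProb : ∀ x, IsProbabilityMeasure (Pm x))
    (hstart : ∀ x, Pm x {ω | ω 0 = x} = 1)
    (hmarkov : ∀ (x : E) (k : ℕ) (A : ℕ → Set E), (∀ i, MeasurableSet (A i)) →
      Pm x {ω | ∀ i < k, ω (i + 1) ∈ A i} = stepProb κ A k x)
    /- irreducibility and Harris recurrence -/
    (hHarris : ∀ A : Set E, MeasurableSet A → 0 < π A → ∀ x,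
      Pm x {ω | ∀ N : ℕ, ∃ n ≥ N, ω n ∈ A} = 1)
    /- the atom -/
    (a : Set E) (hameas : MeasurableSet a) (hπa : 0 < π a) (hπafin : π a ≠ ⊤)
    (hatom : ∀ x ∈ a, ∀ y ∈ a, κ x = κ y) (xa : E) (hxa : xa ∈ a)
    /- `γ(x) = (π(a) P_a[T > x])⁻¹` is regularly varying of index `α ∈ (0,1)` -/
    (γ : ℝ → ℝ) (α : ℝ) (hα0 : 0 < α) (hα1 : α < 1)
    (hγdef : ∀ x : ℝ, γ x =
      ((π a).toReal * (Pm xa {ω | ∀ n : ℕ, 0 < n → (n : ℝ) ≤ x → ω n ∉ a}).toReal)⁻¹)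
    (hγRV : RegVary γ α)
    /- the partition `(E_n)` of `E` -/
    (Epart : ℕ → Set E) (hEmeas : ∀ n, MeasurableSet (Epart n))
    (hEdisj : Pairwise fun i j => Disjoint (Epart i) (Epart j))
    (hEcover : (⋃ n, Epart n) = Set.univ)
    (hEfin : ∀ n, π (Epart n) ≠ ⊤) (hEpos : ∀ n, 0 < π (Epart n))
    /- `ψ ∈ RV_β` monotone, and `P_{π_n}[T/ψ(n) ∈ ·] ⇒ Q` -/
    (ψf : ℝ → ℝ) (β : ℝ) (hβ : 0 < β) (hψmono : Monotone ψf) (hψRV : RegVary ψf β)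
    (Q : Measure ℝ) [IsProbabilityMeasure Q]
    (hQweak : ∀ F : ℝ →ᵇ ℝ, Tendsto
      (fun n : ℕ => ∫ ω, F (hitTr a ω / ψf n) ∂(Ppart π Epart Pm n)) atTop
      (nhds (∫ x, F x ∂Q)))
    /- `π(E_{[rn]})/π(E_n) → r^ζ` -/
    (ζ : ℝ) (hζ : -1 < ζ)
    (hπreg : ∀ r : ℝ, 0 < r → Tendsto
      (fun n : ℕ => (π (Epart ⌊r * (n : ℝ)⌋₊)).toReal / (π (Epart n)).toReal) atTop
      (nhds (r ^ ζ)))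
    /- condition (eq:Qassmp) -/
    (hQasmp : ∃ ε' > (0:ℝ), ∃ c > (0:ℝ), ∃ N : ℝ, 1 < N ∧ ∃ k > (0:ℝ), ∃ ε > (0:ℝ),
      ∀ r : ℝ, 1 ≤ r → ∀ n : ℕ, N * r ≤ (n : ℝ) →
        (Ppart π Epart Pm n {ω | hitTr a ω / ψf n ≤ c * r ^ (-β + ε')}).toReal
          < k * r ^ (-ζ - 1 - ε))
    /- the Lévy measure `ρ` with exponential moments -/
    (ρ : Measure ℝ) (hρ0 : ρ {0} = 0)
    (hρ2 : (∫⁻ z, ENNReal.ofReal (trunc z ^ 2) ∂ρ) ≠ ⊤)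
    (hρexp : ∀ l : ℝ, (∫⁻ z in {z : ℝ | 1 < |z|}, ENNReal.ofReal (Real.exp (l * z)) ∂ρ) ≠ ⊤)
    /- the path-space control measure `m` -/
    (m : Measure (ℤ → E))
    (hm : ∀ (n : ℤ) (k : ℕ) (A : ℕ → Set E), (∀ i, MeasurableSet (A i)) →
      m {s | ∀ i ≤ k, s (n + (i : ℤ)) ∈ A i}
        = ∫⁻ x in A 0, stepProb κ (fun i => A (i + 1)) k x ∂π)
    /- the function `f` -/
    (f : E → ℝ) (hfmeas : Measurable f) (hfint : Integrable f π)
    (hcf : (∫ x, f x ∂π) ≠ 0)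
    (hfM : (∫⁻ s, PhiM ρ (f (s 0)) ∂m) ≠ ⊤)
    /- condition (eq:fassmp) -/
    (hfassmp : ∀ l : ℝ, 0 < l → ∃ k > (0:ℝ), ∃ N : ℝ, 1 < N ∧ ∃ ε > (0:ℝ),
      ∀ r : ℝ, 1 ≤ r → ∀ n : ℕ, N * r ≤ (n : ℝ) →
        (∫ ω, cumulant ρ
            (l * ∑ i ∈ Finset.Icc 1 ((hitT a ω ⊓ ((⌊ψf ((n : ℝ) / r)⌋₊ : ℕ∞))).toNat),
              |f (ω i)|) ∂(Ppart π Epart Pm n))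
          ≤ k * r ^ (-ζ - 1 - ε))
    /- the stationary infinitely divisible process `X_n = ∫_S f(s_n) M(ds)` -/
    {Ω : Type*} [MeasurableSpace Ω] (P : Measure Ω) [IsProbabilityMeasure P]
    (X : ℤ → Ω → ℝ) (hXmeas : ∀ n, Measurable (X n))
    (hXchar : ∀ (J : Finset ℤ) (c : ℤ → ℝ),
      (∫ ω, Real.exp (∑ n ∈ J, c n * X n ω) ∂P)
        = Real.exp (∫ s, cumulant ρ (∑ n ∈ J, c n * f (s n)) ∂m))
    (hXmean : (∫ ω, X 0 ω ∂P) = 0)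
    (σ2 : ℝ) (hσ2 : σ2 = ∫ ω, (X 0 ω) ^ 2 ∂P)
    /- Assumption 4.1 -/
    (hassmp : ∃ δ : ℝ, 1 ≤ δ ∧ δ < (1 - α)⁻¹ ∧
      (∃ k₀ > (0:ℝ),
        (∫⁻ t in Set.Ioi (0:ℝ), ENNReal.ofReal (Real.exp (-k₀ * gbar ρ t ^ δ))) ≠ ⊤) ∧
      (∃ l > (0:ℝ), ∃ C : ℝ≥0∞, C ≠ ⊤ ∧ ∀ x : E,
        (∫⁻ ω, ENNReal.ofReal
            (Real.exp ((l * ∑ i ∈ Finset.Icc 1 (hitT a ω).toNat, |f (ω i)|) ^ δ))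
          ∂(Pm x)) ≤ C))
    /- the normalization: `c_n = 1` (LDP case) or `c_n → ∞` with `b_n → ∞` (MDP case) -/
    (cseq : ℕ → ℝ) (aseq bseq : ℕ → ℝ)
    (haseq : ∀ n : ℕ, aseq n =
      (π (Epart ⌊geninv ψf (n : ℝ)⌋₊)).toReal * γ (n : ℝ) * geninv ψf (n : ℝ) / cseq n)
    (hbseq : ∀ n : ℕ, bseq n =
      (π (Epart ⌊geninv ψf (n : ℝ)⌋₊)).toReal * geninv ψf (n : ℝ) / (cseq n) ^ 2)
    (hcase : (∀ n, cseq n = 1) ∨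
      (Tendsto cseq atTop atTop ∧ Tendsto bseq atTop atTop)) :
    (∀ p : ℝ, 0 < p → ∃ K : Set Dsp, IsCompact K ∧
      limsup (fun n => (((bseq n)⁻¹ : ℝ) : EReal) *
          ENNReal.log (Measure.map (Ytil X aseq n) P Kᶜ)) atTop ≤ ((-p : ℝ) : EReal)) ∧
    (∀ ε : ℝ, 0 < ε →
      Tendsto (fun u : ℝ =>
          limsup (fun n => (((bseq n)⁻¹ : ℝ) : EReal) *
            ENNReal.log (P {ω | ∃ s t : Set.Icc (0:ℝ) 1, |(s : ℝ) - (t : ℝ)| < u ∧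
              ε < |UniformFun.toFun (Ytil X aseq n ω) s
                    - UniformFun.toFun (Ytil X aseq n ω) t|})) atTop)
        (nhdsWithin (0:ℝ) (Set.Ioi 0)) (nhds (⊥ : EReal))) := by
  obtain ⟨δ, hδ, hδα, ⟨k₀, hk₀, hgbar⟩, l, hl, C, hC, hcycle⟩ := hassmp
  have hlaw : IsChainLaw κ Pm := ⟨hPmProb, hstart, hmarkov⟩
  have hreg := isRegenerative_of_harris hlaw hHarris hameas hπa hπafin hatom hxa hα0 hα1 hγdef hγRV
    hfmeas hδ hδα hl hC hcycle
  have hψtop := hψRV.tendsto_atTop hψmono hβ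
  have hfloor : Tendsto (fun n : ℕ => ⌊geninv ψf n⌋₊) atTop atTop :=
    tendsto_nat_floor_atTop.comp ((tendsto_geninv hψmono hψtop).comp tendsto_natCast_atTop_atTop)
  set w : ℕ → ℝ := fun k => (π (Epart k)).toReal with hw
  have hwpos : ∀ k, 0 < w k := fun k => ENNReal.toReal_pos (hEpos k).ne' (hEfin k)
  have hwreg : RegSeq w ζ := ⟨hwpos, hπreg⟩
  set B : ℕ → ℝ := fun n => ⌊geninv ψf n⌋₊ * w ⌊geninv ψf n⌋₊ with hB
  have hB0 : ∀ n, 0 ≤ B n := fun n => mul_nonneg (Nat.cast_nonneg _) (hwpos _).le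
  have hBmono : ∃ C₁ > (0 : ℝ), ∃ N, ∀ j ≥ N, ∀ n ≥ j, B j ≤ C₁ * B n := by
    obtain ⟨K, -, C₁, hC₁, hK⟩ := hwreg.exists_mul_le hζ
    obtain ⟨N, hN⟩ := eventually_atTop.1 (hfloor.eventually_ge_atTop K)
    exact ⟨C₁, hC₁, N, fun j hj n hn => hK _ (hN j hj) _
      (Nat.floor_mono (geninv_mono hψtop (Nat.cast_le.2 hn)))⟩
  have hc : ∀ᶠ n in atTop, 1 ≤ cseq n := by
    rcases hcase with h | h
    · exact Eventually.of_forall fun n => (h n).ge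
    · exact h.1.eventually_ge_atTop 1
  have hbB : ∀ n, B n / cseq n ^ 2 ≤ bseq n := fun n => by
    rw [hbseq, hB, mul_comm]
    exact div_le_div_of_nonneg_right (mul_le_mul_of_nonneg_right
      (Nat.floor_le (zero_le_one.trans (one_le_geninv hψtop _))) (hwpos _).le) (sq_nonneg _)
  have hbtop : Tendsto bseq atTop atTop := by
    rcases hcase with h | h
    · refine tendsto_atTop_mono (fun n => ?_) ((hwreg.tendsto_mul_atTop hζ).comp hfloor)
      have := hbB n
      rwa [h, one_pow, div_one] at this
    · exact h.2
  have hab : ∀ᶠ n in atTop, aseq n = bseq n * γ n * cseq n := by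
    filter_upwards [hc] with n hn
    have : cseq n ≠ 0 := by linarith
    rw [haseq, hbseq]
    field_simp
  have ha : ∀ᶠ n in atTop, 0 < aseq n := by
    filter_upwards [hab, hc, hbtop.eventually_gt_atTop 0] with n h1 h2 h3
    rw [h1]
    exact mul_pos (mul_pos h3 (hreg.pos _)) (by linarith)
  have htail : ∃ C > (0 : ℝ), ∃ lam > (0 : ℝ), ∃ s : ℝ, 0 < s ∧
      IncrementTail P X aseq bseq C lam s := by
    have hX1 : ∀ (i : ℤ) (c : ℝ), ∫ ω, Real.exp (c * X i ω) ∂P =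
        Real.exp (∫ x, cumulant ρ (c * f x) ∂π) := fun i c => by
      have h := hXchar {i} fun _ => c
      simp only [Finset.sum_singleton] at h
      rw [h, ← map_eval_of_marginals hm i, integral_map (measurable_pi_apply i).aemeasurable]
      refine Measurable.aestronglyMeasurable ?_
      simp only [cumulant_eq hρ2 hρexp]
      have hcm : Measurable fun x => c * f x := hfmeas.const_mul c
      exact ((continuous_centredCumulant hρ2 hρexp).measurable.comp hcm).add (hcm.mul_const _)
    rcases centring_dichotomy hρ2 hρexp hfint hcf hX1 hXmean with hd | hzero
    swap
    · exact ⟨1, one_pos, 1, one_pos, 1, one_pos, incrementTail_of_ae_eq_zero hzero ha 1 1 1⟩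
    have hcum : ∀ y, cumulant ρ y = centredCumulant ρ y := fun y => by
      rw [cumulant_eq hρ2 hρexp, hd, mul_zero, add_zero]
    have hδ0 : 0 < δ := by linarith
    obtain ⟨C₀, hC₀, hup⟩ := exists_symCumulant_le hρ2 hρexp hd hδ0.le hk₀ hgbar
    obtain ⟨c₀, hc₀, hlow⟩ := exists_le_centredCumulant hρ2 hρexp hρ0 (ne_zero_of_gbar hδ0 hgbar)
    simp only [hcum] at hfassmp
    have hmin := hreg.exists_truncated_min_le hEpos hEfin hρ2 hρexp hk₀ hC₀ hc₀ hup hlow hfassmp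
    obtain ⟨D, hD, hcore⟩ := hreg.exists_lintegral_bind_symCumulant_le hα1 hEmeas hEdisj hEcover
      hEpos hEfin hk₀ hC₀ hup hζ hwreg hβ hψmono hψRV hmin hQasmp zero_le_one
    exact exists_incrementTail hα0 hreg.mono hreg.pos hγRV hρ2 hρexp hcum hfmeas
      (hlaw.map_window hm hEmeas hEcover hEfin) hXmeas hXchar hB0 hD hcore hBmono hc
      (Eventually.of_forall hbB) hab
  obtain ⟨C', -, lam, hlam, s, hs, htail⟩ := htail
  have hosc : ∀ ε > (0 : ℝ), ∀ p : ℝ, ∃ u > (0 : ℝ), ∀ᶠ n in atTop,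
      P (oscEvent X aseq n u ε) ≤ ENNReal.ofReal (Real.exp (-(bseq n * p))) :=
    fun ε hε p => htail.exists_oscEvent_le hlam hs ha hbtop hε p
  exact ⟨fun p _ => exists_isCompact_limsup_log_le hXmeas hbtop hosc p,
    fun ε hε => tendsto_limsup_log_oscEvent hbtop (hosc ε hε)⟩
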